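/- Let n ≥ r ≥ 3 and let H be an n-vertex r-uniform hypergraph. Suppose that (i) r ≤ n/2 and the minimum degree of H is at least C(⌊n/2⌋, r−1) + 1, or (ii) n−1 ≥ r > n/2 ≥ 3 and the minimum degree of H is at least r−1, or (iii) r = 3, n = 5 and the minimum degree of H is at least 3. Then H is hamiltonian-connected, i.e., between any two distinct vertices of H there is a Berge path whose defining vertices are all n vertices of H. -/

import Mathlib

/-- A Berge path of length `k` in a hypergraph with hyperedge set `E`. -/
def IsBergePath {V : Type*} (E : Finset (Finset V)) (k : ℕ)
    (v : Fin (k + 1) → V) (h : Fin k → Finset V) : Prop :=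
  Function.Injective v ∧ Function.Injective h ∧ (∀ i, h i ∈ E) ∧
    ∀ i : Fin k, v i.castSucc ∈ h i ∧ v i.succ ∈ h i

/-- The degree of a vertex: the number of hyperedges containing it. -/
def degree {V : Type*} [DecidableEq V] (E : Finset (Finset V)) (x : V) : ℕ :=
  (E.filter (fun e => x ∈ e)).card

/-- A sequence `v 0, …, v (N - 1)` of distinct vertices from `a` to `b` in which every consecutive
pair `v i, v (i + 1)` whose label `i` is not in `U` is covered by an edge `e i`,
all these edges being distinct. -/
structure PartialPath {V : Type*} (E : Finset (Finset V)) (a b : V) (N : ℕ)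
    (v : ℕ → V) (e : ℕ → Finset V) (U : ℕ → Prop) : Prop where
  first : v 0 = a
  last : v (N - 1) = b
  inj : ∀ i j, i < N → j < N → v i = v j → i = j
  mem : ∀ i, i + 1 < N → ¬ U i → e i ∈ E
  left : ∀ i, i + 1 < N → ¬ U i → v i ∈ e i
  right : ∀ i, i + 1 < N → ¬ U i → v (i + 1) ∈ e i
  einj : ∀ i j, i + 1 < N → j + 1 < N → ¬ U i → ¬ U j → e i = e j → i = j

/-- The edge `g` does not cover any label outside `U`. -/
def Spare {V : Type*} (E : Finset (Finset V)) (N : ℕ) (e : ℕ → Finset V) (U : ℕ → Prop)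
    (g : Finset V) : Prop :=
  g ∈ E ∧ ∀ i, i + 1 < N → ¬ U i → e i ≠ g

/-- Reversal of the positions `lo + 1, …, hi`. -/
def revPos (lo hi t : ℕ) : ℕ := if lo < t ∧ t ≤ hi then lo + hi + 1 - t else t

/-- The action of `revPos lo hi` on labels strictly between `lo` and `hi`. -/
def revLab (lo hi t : ℕ) : ℕ := if lo < t ∧ t < hi then lo + hi - t else t

theorem revPos_in {lo hi t : ℕ} (h1 : lo < t) (h2 : t ≤ hi) : revPos lo hi t = lo + hi + 1 - t :=
  if_pos ⟨h1, h2⟩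

theorem revPos_out {lo hi t : ℕ} (h : t ≤ lo ∨ hi < t) : revPos lo hi t = t :=
  if_neg (by omega)

theorem revLab_in {lo hi t : ℕ} (h1 : lo < t) (h2 : t < hi) : revLab lo hi t = lo + hi - t :=
  if_pos ⟨h1, h2⟩

theorem revLab_out {lo hi t : ℕ} (h : t ≤ lo ∨ hi ≤ t) : revLab lo hi t = t :=
  if_neg (by omega)

theorem revLab_revLab (lo hi t : ℕ) : revLab lo hi (revLab lo hi t) = t := by
  unfold revLab; split_ifs <;> omega

theorem revLab_lt {lo hi N t : ℕ} (hhi : hi + 1 < N) (ht : t + 1 < N) :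
    revLab lo hi t + 1 < N := by
  unfold revLab; split_ifs <;> omega

section Operations

variable {V : Type*} {E : Finset (Finset V)} {a b : V} {N : ℕ} {v : ℕ → V}
  {e : ℕ → Finset V} {U U' : ℕ → Prop} {g h x : Finset V}

theorem PartialPath.mono (hP : PartialPath E a b N v e U)
    (hU : ∀ t, t + 1 < N → ¬ U' t → ¬ U t) : PartialPath E a b N v e U' :=
  ⟨hP.first, hP.last, hP.inj, fun i hi h => hP.mem i hi (hU i hi h),
    fun i hi h => hP.left i hi (hU i hi h), fun i hi h => hP.right i hi (hU i hi h),
    fun i j hi hj h h' => hP.einj i j hi hj (hU i hi h) (hU j hj h')⟩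

theorem Spare.mono (hg : Spare E N e U g) (hU : ∀ t, t + 1 < N → ¬ U' t → ¬ U t) :
    Spare E N e U' g :=
  ⟨hg.1, fun i hi h => hg.2 i hi (hU i hi h)⟩

/-- The edge covering a label becomes spare when the label is uncovered. -/
theorem PartialPath.spare (hP : PartialPath E a b N v e U) {i : ℕ} (hi : i + 1 < N) (hUi : ¬ U i)
    (hU : ∀ t, t + 1 < N → ¬ U' t → ¬ U t ∧ t ≠ i) : Spare E N e U' (e i) :=
  ⟨hP.mem i hi hUi, fun t ht h h' =>
    (hU t ht h).2 (hP.einj t i ht hi (hU t ht h).1 hUi h')⟩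

theorem PartialPath.assign (hP : PartialPath E a b N v e U) {i : ℕ} (hg : Spare E N e U g)
    (h1 : v i ∈ g) (h2 : v (i + 1) ∈ g) (hU : ∀ t, t + 1 < N → ¬ U' t → ¬ U t ∨ t = i) :
    PartialPath E a b N v (Function.update e i g) U' := by
  refine ⟨hP.first, hP.last, hP.inj, ?_, ?_, ?_, ?_⟩
  · intro t ht h
    rcases eq_or_ne t i with rfl | hne
    · simpa using hg.1
    · simpa [hne] using hP.mem t ht ((hU t ht h).resolve_right hne)
  · intro t ht h
    rcases eq_or_ne t i with rfl | hne
    · simpa using h1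
    · simpa [hne] using hP.left t ht ((hU t ht h).resolve_right hne)
  · intro t ht h
    rcases eq_or_ne t i with rfl | hne
    · simpa using h2
    · simpa [hne] using hP.right t ht ((hU t ht h).resolve_right hne)
  · intro s t hs ht h h' heq
    rcases eq_or_ne s i with rfl | hs'
    · rcases eq_or_ne t s with rfl | ht'
      · rfl
      · simp [ht'] at heq
        exact absurd heq.symm (hg.2 t ht ((hU t ht h').resolve_right ht'))
    · rcases eq_or_ne t i with rfl | ht'
      · simp [hs'] at heq
        exact absurd heq (hg.2 s hs ((hU s hs h).resolve_right hs'))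
      · simp [hs', ht'] at heq
        exact hP.einj s t hs ht ((hU s hs h).resolve_right hs')
          ((hU t ht h').resolve_right ht') heq

theorem Spare.assign (hh : Spare E N e U h) {i : ℕ} (hne : h ≠ g)
    (hU : ∀ t, t + 1 < N → ¬ U' t → ¬ U t ∨ t = i) :
    Spare E N (Function.update e i g) U' h := by
  refine ⟨hh.1, fun t ht h' => ?_⟩
  rcases eq_or_ne t i with rfl | h1
  · simpa using hne.symm
  · simpa [h1] using hh.2 t ht ((hU t ht h').resolve_right h1)

theorem PartialPath.rev (hP : PartialPath E a b N v e U) {lo hi : ℕ} (hlt : lo < hi)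
    (hhi : hi + 1 < N) (h1 : U lo) (h2 : U hi) :
    PartialPath E a b N (fun t => v (revPos lo hi t)) (fun t => e (revLab lo hi t))
      (fun t => U (revLab lo hi t)) := by
  refine ⟨?_, ?_, ?_, ?_, ?_, ?_, ?_⟩
  · simp only [revPos_out (Or.inl (Nat.zero_le lo))]; exact hP.first
  · simp only [revPos_out (show N - 1 ≤ lo ∨ hi < N - 1 by omega)]; exact hP.last
  · intro i j hi' hj' heq
    have h3 : revPos lo hi i < N := by unfold revPos; split_ifs <;> omega
    have h4 : revPos lo hi j < N := by unfold revPos; split_ifs <;> omega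
    have := hP.inj _ _ h3 h4 heq
    unfold revPos at this; split_ifs at this <;> omega
  · intro i hi' h; exact hP.mem _ (revLab_lt hhi hi') h
  · intro i hi' h
    by_cases hin : lo < i ∧ i < hi
    · rw [revPos_in hin.1 (by omega), revLab_in hin.1 hin.2]
      rw [revLab_in hin.1 hin.2] at h
      have := hP.right (lo + hi - i) (by omega) h
      rwa [show lo + hi - i + 1 = lo + hi + 1 - i by omega] at this
    · rw [revLab_out (by omega)] at h ⊢
      have : i ≠ lo := by rintro rfl; exact h h1
      have : i ≠ hi := by rintro rfl; exact h h2
      rw [revPos_out (by omega)]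
      exact hP.left i hi' h
  · intro i hi' h
    by_cases hin : lo < i ∧ i < hi
    · rw [revPos_in (by omega) (by omega), revLab_in hin.1 hin.2]
      rw [revLab_in hin.1 hin.2] at h
      have := hP.left (lo + hi - i) (by omega) h
      rwa [show lo + hi + 1 - (i + 1) = lo + hi - i by omega]
    · rw [revLab_out (by omega)] at h ⊢
      have : i ≠ lo := by rintro rfl; exact h h1
      have : i ≠ hi := by rintro rfl; exact h h2
      rw [revPos_out (by omega)]
      exact hP.right i hi' h
  · intro i j hi' hj' h h' heq
    have := hP.einj _ _ (revLab_lt hhi hi') (revLab_lt hhi hj') h h' heq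
    rw [← revLab_revLab lo hi i, this, revLab_revLab]

theorem Spare.rev (hg : Spare E N e U g) {lo hi : ℕ} (hhi : hi + 1 < N) :
    Spare E N (fun t => e (revLab lo hi t)) (fun t => U (revLab lo hi t)) g :=
  ⟨hg.1, fun _ ht h => hg.2 _ (revLab_lt hhi ht) h⟩

theorem PartialPath.mirror (hP : PartialPath E a b N v e U) :
    PartialPath E b a N (fun t => v (N - 1 - t)) (fun t => e (N - 2 - t))
      (fun t => U (N - 2 - t)) := by
  refine ⟨by simpa using hP.last, by simpa using hP.first, ?_, ?_, ?_, ?_, ?_⟩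
  · intro i j hi hj h
    have := hP.inj _ _ (by omega) (by omega) h
    omega
  · intro i hi h; exact hP.mem _ (by omega) h
  · intro i hi h
    have := hP.right _ (by omega) h
    rwa [show N - 2 - i + 1 = N - 1 - i by omega] at this
  · intro i hi h
    have := hP.left _ (by omega) h
    rwa [show N - 2 - i = N - 1 - (i + 1) by omega] at this ⊢
  · intro i j hi hj h h' heq
    have := hP.einj _ _ (by omega) (by omega) h h' heq
    omega

theorem Spare.mirror (hg : Spare E N e U g) :
    Spare E N (fun t => e (N - 2 - t)) (fun t => U (N - 2 - t)) g :=
  ⟨hg.1, fun _ _ h => hg.2 _ (by omega) h⟩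

theorem PartialPath.replace (hP : PartialPath E a b N v e U) {j : ℕ} {z : V} (hj : j + 2 < N)
    (hz : ∀ i, i < N → v i ≠ z) (h1 : U j) (h2 : U (j + 1)) :
    PartialPath E a b N (Function.update v (j + 1) z) e U := by
  refine ⟨by simpa using hP.first, ?_, ?_, hP.mem, ?_, ?_, hP.einj⟩
  · rw [Function.update_of_ne (by omega)]; exact hP.last
  · intro s t hs ht heq
    rcases eq_or_ne s (j + 1) with rfl | hs'
    · rcases eq_or_ne t (j + 1) with rfl | ht'
      · rfl
      · simp [ht'] at heq
        exact absurd heq.symm (hz t ht)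
    · rcases eq_or_ne t (j + 1) with rfl | ht'
      · simp [hs'] at heq
        exact absurd heq (hz s hs)
      · simp [hs', ht'] at heq
        exact hP.inj s t hs ht heq
  · intro i hi h
    have : i ≠ j + 1 := by rintro rfl; exact h h2
    simpa [this] using hP.left i hi h
  · intro i hi h
    have : i ≠ j := by rintro rfl; exact h h1
    simpa [this] using hP.right i hi h

/-- Insert the vertex `z` between positions `j` and `j + 1`. -/
theorem PartialPath.insert (hP : PartialPath E a b N v e U) {j : ℕ} {z : V} (hj : j + 1 < N)
    (hz : ∀ i, i < N → v i ≠ z) (h1 : U j) :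
    PartialPath E a b (N + 1) (fun t => if t ≤ j then v t else if t = j + 1 then z else v (t - 1))
      (fun t => if t ≤ j then e t else e (t - 1))
      (fun t => if t ≤ j then U t else U (t - 1)) := by
  refine ⟨by simpa using hP.first, ?_, ?_, ?_, ?_, ?_, ?_⟩
  · rw [if_neg (show ¬ N + 1 - 1 ≤ j by omega), if_neg (show N + 1 - 1 ≠ j + 1 by omega)]
    exact hP.last
  · intro s t hs ht heq
    split_ifs at heq
    · exact hP.inj _ _ (by omega) (by omega) heq
    · exact absurd heq (hz _ (by omega))
    · have := hP.inj _ _ (by omega) (by omega) heq; omega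
    · exact absurd heq.symm (hz _ (by omega))
    · omega
    · exact absurd heq.symm (hz _ (by omega))
    · have := hP.inj _ _ (by omega) (by omega) heq; omega
    · exact absurd heq (hz _ (by omega))
    · have := hP.inj _ _ (by omega) (by omega) heq; omega
  · intro i hi h
    split_ifs at h ⊢
    · exact hP.mem _ (by omega) h
    · exact hP.mem _ (by omega) h
  · intro i hi h
    split_ifs at h ⊢
    · exact hP.left _ (by omega) h
    · exact absurd h1 (by simp [*] at h)
    · exact hP.left _ (by omega) h
  · intro i hi h
    split_ifs at h ⊢ with h3 h4 h5 h6
    · exact hP.right _ (by omega) h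
    · exact absurd h1 (by rwa [show i = j by omega] at h)
    · omega
    · omega
    · omega
    · have := hP.right _ (by omega) h
      rwa [show i - 1 + 1 = i + 1 - 1 by omega] at this
  · intro s t hs ht h h' heq
    split_ifs at h h' heq
    · exact hP.einj _ _ (by omega) (by omega) h h' heq
    · have := hP.einj _ _ (by omega) (by omega) h h' heq
      have : s ≠ j := by rintro rfl; exact h h1
      omega
    · have := hP.einj _ _ (by omega) (by omega) h h' heq
      have : t ≠ j := by rintro rfl; exact h' h1
      omega
    · have := hP.einj _ _ (by omega) (by omega) h h' heq; omega

theorem Spare.insert (hg : Spare E N e U g) {j : ℕ} (hj : j + 1 < N) :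
    Spare E (N + 1) (fun t => if t ≤ j then e t else e (t - 1))
      (fun t => if t ≤ j then U t else U (t - 1)) g := by
  refine ⟨hg.1, fun t ht h => ?_⟩
  simp only at h ⊢
  split_ifs at h ⊢
  · exact hg.2 _ (by omega) h
  · exact hg.2 _ (by omega) h

/-- Remove the vertex at position `j + 1`. -/
theorem PartialPath.remove (hP : PartialPath E a b N v e U) {j : ℕ} (hj : j + 2 < N)
    (h1 : U j) :
    PartialPath E a b (N - 1) (fun t => if t ≤ j then v t else v (t + 1))
      (fun t => if t ≤ j then e t else e (t + 1))
      (fun t => if t ≤ j then U t else U (t + 1)) := by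
  refine ⟨by simpa using hP.first, ?_, ?_, ?_, ?_, ?_, ?_⟩
  · rw [if_neg (show ¬ N - 1 - 1 ≤ j by omega), show N - 1 - 1 + 1 = N - 1 by omega]
    exact hP.last
  · intro s t hs ht heq
    split_ifs at heq <;> (have := hP.inj _ _ (by omega) (by omega) heq; omega)
  · intro i hi h
    split_ifs at h ⊢
    · exact hP.mem _ (by omega) h
    · exact hP.mem _ (by omega) h
  · intro i hi h
    split_ifs at h ⊢
    · exact hP.left _ (by omega) h
    · exact hP.left _ (by omega) h
  · intro i hi h
    split_ifs at h ⊢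
    · exact hP.right _ (by omega) h
    · exact absurd h1 (by rwa [show i = j by omega] at h)
    · omega
    · exact hP.right _ (by omega) h
  · intro s t hs ht h h' heq
    split_ifs at h h' heq <;> (have := hP.einj _ _ (by omega) (by omega) h h' heq; omega)

theorem Spare.remove (hg : Spare E N e U g) {j : ℕ} :
    Spare E (N - 1) (fun t => if t ≤ j then e t else e (t + 1))
      (fun t => if t ≤ j then U t else U (t + 1)) g := by
  refine ⟨hg.1, fun t ht h => ?_⟩
  simp only at h ⊢
  split_ifs at h ⊢
  · exact hg.2 _ (by omega) h
  · exact hg.2 _ (by omega) h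

end Operations

section Crossing

variable {V : Type*} {E : Finset (Finset V)} {a b : V} {N : ℕ} {v : ℕ → V}
  {e : ℕ → Finset V} {U U' : ℕ → Prop} {f g h x : Finset V}

/-- Reverse the segment between two uncovered labels and cover the two new pairs. -/
theorem PartialPath.cross (hP : PartialPath E a b N v e U) {lo hi : ℕ} (hlt : lo < hi)
    (hhi : hi + 1 < N) (h1 : U lo) (h2 : U hi) (hg : Spare E N e U g) (hh : Spare E N e U h)
    (hne : g ≠ h) (hg1 : v lo ∈ g) (hg2 : v hi ∈ g) (hh1 : v (lo + 1) ∈ h) (hh2 : v (hi + 1) ∈ h)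
    (hU : ∀ t, t + 1 < N → ¬ U' t → ¬ U (revLab lo hi t) ∨ t = lo ∨ t = hi) :
    PartialPath E a b N (fun t => v (revPos lo hi t))
      (Function.update (Function.update (fun t => e (revLab lo hi t)) lo g) hi h) U' := by
  have hR := hP.rev hlt hhi h1 h2
  have hA := hR.assign (i := lo) (g := g) (U' := fun t => U (revLab lo hi t) ∧ t ≠ lo)
    (hg.rev hhi) (by simpa [revPos_out] using hg1)
    (by simpa [revPos_in (show lo < lo + 1 by omega) (show lo + 1 ≤ hi by omega)] using
        (by rwa [show lo + hi + 1 - (lo + 1) = hi by omega] : v (lo + hi + 1 - (lo + 1)) ∈ g))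
    (by intro t _ h; tauto)
  refine hA.assign (i := hi) ((hh.rev hhi).assign hne.symm (by intro t _ h; tauto)) ?_ ?_ ?_
  · show v (revPos lo hi hi) ∈ h
    rwa [revPos_in hlt le_rfl, show lo + hi + 1 - hi = lo + 1 by omega]
  · show v (revPos lo hi (hi + 1)) ∈ h
    rwa [revPos_out (by omega)]
  · intro t ht h
    have := hU t ht h
    tauto

theorem Spare.cross (hf : Spare E N e U f) {lo hi : ℕ} (hhi : hi + 1 < N)
    (hg : f ≠ g) (hh : f ≠ h)
    (hU : ∀ t, t + 1 < N → ¬ U' t → ¬ U (revLab lo hi t) ∨ t = lo ∨ t = hi) :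
    Spare E N (Function.update (Function.update (fun t => e (revLab lo hi t)) lo g) hi h) U' f :=
  ((hf.rev hhi).assign (U' := fun t => U (revLab lo hi t) ∧ t ≠ lo) hg
    (by intro t _ h; tauto)).assign hh (by intro t ht h; have := hU t ht h; tauto)

end Crossing

/-- There is no hamiltonian Berge path on `N` vertices from `a` to `b`. -/
def NoPath {V : Type*} (E : Finset (Finset V)) (a b : V) (N : ℕ) : Prop :=
  ∀ v e, ¬ PartialPath E a b N v e (fun _ => False)

/-- A sequence in which exactly one pair `v k, v (k + 1)` is not covered. -/
def Defect {V : Type*} (E : Finset (Finset V)) (a b : V) (n : ℕ) (v : ℕ → V) (e : ℕ → Finset V)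
    (k : ℕ) : Prop :=
  PartialPath E a b n v e (fun t => t = k) ∧ k + 1 < n

/-- Some edge that is unused, or used only at the label `i`, contains `v k` and `v i`. -/
def JLeft {V : Type*} (E : Finset (Finset V)) (n : ℕ) (v : ℕ → V) (e : ℕ → Finset V)
    (k i : ℕ) : Prop :=
  i + 1 < n ∧ i ≠ k ∧ ∃ g, Spare E n e (fun t => t = i ∨ t = k) g ∧ v k ∈ g ∧ v i ∈ g

/-- Some edge that is unused, or used only at the label `i`, contains `v (k + 1)` and
`v (i + 1)`. -/
def JRight {V : Type*} (E : Finset (Finset V)) (n : ℕ) (v : ℕ → V) (e : ℕ → Finset V)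
    (k i : ℕ) : Prop :=
  i + 1 < n ∧ i ≠ k ∧
    ∃ g, Spare E n e (fun t => t = i ∨ t = k) g ∧ v (k + 1) ∈ g ∧ v (i + 1) ∈ g

section DefectLemmas

variable {V : Type*} {E : Finset (Finset V)} {a b : V} {n : ℕ} {v : ℕ → V}
  {e : ℕ → Finset V} {k : ℕ} {f g h : Finset V}

theorem NoPath.symm {N : ℕ} (hN : NoPath E a b N) : NoPath E b a N :=
  fun _ _ hP => hN _ _ hP.mirror

theorem Defect.mirror (hD : Defect E a b n v e k) :
    Defect E b a n (fun t => v (n - 1 - t)) (fun t => e (n - 2 - t)) (n - 2 - k) := by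
  have := hD.2
  exact ⟨hD.1.mirror.mono (by intro t ht h h'; omega), by omega⟩

theorem Spare.mirror_iff {n i k : ℕ} (hi : i + 1 < n) (hk : k + 1 < n) :
    Spare E n (fun t => e (n - 2 - t)) (fun t => t = i ∨ t = n - 2 - k) g ↔
      Spare E n e (fun t => t = n - 2 - i ∨ t = k) g := by
  refine ⟨fun h => ⟨h.1, fun t ht h' => ?_⟩, fun h => h.mirror.mono (by intro t ht h; omega)⟩
  have := h.2 (n - 2 - t) (by omega) (by omega)
  simpa [show n - 2 - (n - 2 - t) = t by omega] using this

theorem Spare.mirror_iff_single {n k : ℕ} (hk : k + 1 < n) :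
    Spare E n (fun t => e (n - 2 - t)) (fun t => t = n - 2 - k) g ↔
      Spare E n e (fun t => t = k) g := by
  refine ⟨fun h => ⟨h.1, fun t ht h' => ?_⟩, fun h => h.mirror.mono (by intro t ht h; omega)⟩
  have := h.2 (n - 2 - t) (by omega) (by omega)
  simpa [show n - 2 - (n - 2 - t) = t by omega] using this

theorem jLeft_mirror_iff {i : ℕ} (hk : k + 1 < n) (hi : i + 1 < n) :
    JLeft E n (fun t => v (n - 1 - t)) (fun t => e (n - 2 - t)) (n - 2 - k) i ↔
      JRight E n v e k (n - 2 - i) := by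
  unfold JLeft JRight
  simp only [Spare.mirror_iff hi hk, show n - 1 - (n - 2 - k) = k + 1 by omega,
    show n - 2 - i + 1 = n - 1 - i by omega]
  constructor
  · rintro ⟨-, h1, h2⟩; exact ⟨by omega, by omega, h2⟩
  · rintro ⟨-, h1, h2⟩; exact ⟨by omega, by omega, h2⟩

theorem jRight_mirror_iff {i : ℕ} (hk : k + 1 < n) (hi : i + 1 < n) :
    JRight E n (fun t => v (n - 1 - t)) (fun t => e (n - 2 - t)) (n - 2 - k) i ↔
      JLeft E n v e k (n - 2 - i) := by
  unfold JLeft JRight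
  simp only [Spare.mirror_iff hi hk, show n - 1 - (n - 2 - k + 1) = k by omega,
    show n - 1 - (i + 1) = n - 2 - i by omega]
  constructor
  · rintro ⟨-, h1, h2⟩; exact ⟨by omega, by omega, h2⟩
  · rintro ⟨-, h1, h2⟩; exact ⟨by omega, by omega, h2⟩

theorem Defect.spare (hD : Defect E a b n v e k) {i : ℕ} (hi : i + 1 < n) (hik : i ≠ k) :
    Spare E n e (fun t => t = i ∨ t = k) (e i) :=
  hD.1.spare hi hik (by intro t _ h; tauto)

theorem Spare.or_left (hg : Spare E n e (fun t => t = k) g) (i : ℕ) :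
    Spare E n e (fun t => t = i ∨ t = k) g :=
  hg.mono (by intro t _ h; tauto)

theorem Defect.jLeft_of_mem (hD : Defect E a b n v e k) {i : ℕ} (hi : i + 1 < n) (hik : i ≠ k)
    (h : v k ∈ e i) : JLeft E n v e k i :=
  ⟨hi, hik, e i, hD.spare hi hik, h, hD.1.left i hi hik⟩

theorem Defect.jRight_of_mem (hD : Defect E a b n v e k) {i : ℕ} (hi : i + 1 < n) (hik : i ≠ k)
    (h : v (k + 1) ∈ e i) : JRight E n v e k i :=
  ⟨hi, hik, e i, hD.spare hi hik, h, hD.1.right i hi hik⟩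

theorem Defect.not_mem_both (hN : NoPath E a b n) (hD : Defect E a b n v e k)
    (hg : Spare E n e (fun t => t = k) g) (h1 : v k ∈ g) : v (k + 1) ∉ g := by
  intro h2
  exact hN _ _ (hD.1.assign (i := k) hg h1 h2 (by intro t _ _; tauto))

theorem Defect.crossing (hN : NoPath E a b n) (hD : Defect E a b n v e k) {i : ℕ}
    (hi : i + 1 < n) (hik : i ≠ k) (hg : Spare E n e (fun t => t = i ∨ t = k) g)
    (hh : Spare E n e (fun t => t = i ∨ t = k) h) (hg1 : v k ∈ g) (hg2 : v i ∈ g)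
    (hh1 : v (k + 1) ∈ h) (hh2 : v (i + 1) ∈ h) : g = h := by
  by_contra hne
  have hP : PartialPath E a b n v e (fun t => t = i ∨ t = k) :=
    hD.1.mono (by intro t _ h; tauto)
  have := hD.2
  rcases lt_or_gt_of_ne hik with hlt | hlt
  · refine hN _ _ (hP.cross hlt this (Or.inl rfl) (Or.inr rfl) hg hh hne hg2 hg1 hh2 hh1 ?_)
    intro t _ _; unfold revLab; split_ifs <;> omega
  · refine hN _ _ (hP.cross hlt hi (Or.inr rfl) (Or.inl rfl) hg hh hne hg1 hg2 hh1 hh2 ?_)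
    intro t _ _; unfold revLab; split_ifs <;> omega

/-- A label in both `J`-sets is covered by an edge containing both ends of the defect. -/
theorem Defect.mem_of_jLeft_jRight (hN : NoPath E a b n) (hD : Defect E a b n v e k) {i : ℕ}
    (h1 : JLeft E n v e k i) (h2 : JRight E n v e k i) : v k ∈ e i ∧ v (k + 1) ∈ e i := by
  obtain ⟨hi, hik, g, hg, hg1, hg2⟩ := h1
  obtain ⟨-, -, h, hh, hh1, hh2⟩ := h2
  obtain rfl := hD.crossing hN hi hik hg hh hg1 hg2 hh1 hh2
  by_cases hge : e i = g
  · rw [hge]; exact ⟨hg1, hh1⟩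
  · refine absurd hh1 (hD.not_mem_both hN ⟨hg.1, fun t ht h => ?_⟩ hg1)
    rcases eq_or_ne t i with rfl | hti
    · exact hge
    · exact hg.2 t ht (by tauto)

theorem Defect.not_jRight_of_spare (hN : NoPath E a b n) (hD : Defect E a b n v e k) {i : ℕ}
    (hg : Spare E n e (fun t => t = k) g) (h1 : v k ∈ g) (h2 : v i ∈ g) :
    ¬ JRight E n v e k i := by
  rintro ⟨hi, hik, h, hh, hh1, hh2⟩
  obtain rfl := hD.crossing hN hi hik (hg.or_left i) hh h1 h2 hh1 hh2
  exact hD.not_mem_both hN hg h1 hh1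

theorem Defect.not_jLeft_of_spare (hN : NoPath E a b n) (hD : Defect E a b n v e k) {i : ℕ}
    (hg : Spare E n e (fun t => t = k) g) (h1 : v (k + 1) ∈ g) (h2 : v (i + 1) ∈ g) :
    ¬ JLeft E n v e k i := by
  rintro ⟨hi, hik, h, hh, hh1, hh2⟩
  obtain rfl := hD.crossing hN hi hik hh (hg.or_left i) hh1 hh2 h1 h2
  exact hD.not_mem_both hN hg hh1 h1

/-- Cover the defect by an edge containing both of its ends. -/
theorem Defect.move (hD : Defect E a b n v e k) {p : ℕ} (hp : p + 1 < n) (hpk : p ≠ k)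
    (h1 : v k ∈ e p) (h2 : v (k + 1) ∈ e p) :
    Defect E a b n v (Function.update e k (e p)) p := by
  have hP : PartialPath E a b n v e (fun t => t = p ∨ t = k) :=
    hD.1.mono (by intro t _ h; tauto)
  exact ⟨hP.assign (i := k) (hD.spare hp hpk) h1 h2 (by intro t _ h; tauto), hp⟩

theorem Spare.move {p : ℕ} (hp : p + 1 < n) (hpk : p ≠ k)
    (hg : Spare E n e (fun t => t = k) g) :
    Spare E n (Function.update e k (e p)) (fun t => t = p) g := by
  refine Spare.assign (hg.or_left p) (hg.2 p hp hpk).symm ?_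
  intro t _ h; tauto

/-- Exchange an unused edge with the edge at label `i`. -/
theorem Defect.swap (hD : Defect E a b n v e k) {i : ℕ}
    (hf : Spare E n e (fun t => t = k) f) (h1 : v i ∈ f) (h2 : v (i + 1) ∈ f) :
    Defect E a b n v (Function.update e i f) k :=
  ⟨hD.1.assign hf h1 h2 (by intro t _ h; tauto), hD.2⟩

theorem Defect.spare_swap (hD : Defect E a b n v e k) {i : ℕ} (hi : i + 1 < n) (hik : i ≠ k)
    (hf : Spare E n e (fun t => t = k) f) :
    Spare E n (Function.update e i f) (fun t => t = k) (e i) :=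
  (hD.spare hi hik).assign (hf.2 i hi hik) (by intro t _ h; tauto)

theorem Spare.swap {i : ℕ}
    (hg : Spare E n e (fun t => t = k) g) (hgf : g ≠ f) :
    Spare E n (Function.update e i f) (fun t => t = k) g :=
  hg.assign hgf (by intro t _ h; tauto)

/-- If `e i` joins `v k` to `v l` and `g` joins `v (k + 1)` to `v (l + 1)`, the defect can be moved
to the pair covered by `e i`, this edge remaining in use elsewhere. -/
theorem Defect.transfer (hD : Defect E a b n v e k) {i l : ℕ}
    (hi : i + 1 < n) (hl : l + 1 < n) (hik : i ≠ k) (hlk : l ≠ k) (hil : i ≠ l)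
    (h1 : v k ∈ e i) (h2 : v l ∈ e i) (hg : Spare E n e (fun t => t = l ∨ t = k) g)
    (hg1 : v (k + 1) ∈ g) (hg2 : v (l + 1) ∈ g) :
    ∃ v' e' p k', Defect E a b n v' e' k' ∧ p + 1 < n ∧ p ≠ k' ∧ v' k' ∈ e' p ∧
      v' (k' + 1) ∈ e' p ∧
      ((v' k' = v i ∧ v' (k' + 1) = v (i + 1)) ∨ (v' k' = v (i + 1) ∧ v' (k' + 1) = v i)) ∧
      ∀ f, Spare E n e (fun t => t = k) f → f ≠ g → Spare E n e' (fun t => t = k') f := by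
  have hk := hD.2
  have hge : g ≠ e i := fun h => hg.2 i hi (by tauto) h.symm
  have hP : PartialPath E a b n v e (fun t => t = i ∨ t = l ∨ t = k) :=
    hD.1.mono (by intro t _ h; tauto)
  have hei : Spare E n e (fun t => t = i ∨ t = l ∨ t = k) (e i) :=
    hD.1.spare hi hik (by intro t _ h; tauto)
  have hg' : Spare E n e (fun t => t = i ∨ t = l ∨ t = k) g :=
    hg.mono (by intro t _ h; tauto)
  have hl1 := hD.1.left i hi hik
  have hr1 := hD.1.right i hi hik
  have key : ∀ lo hi', lo < hi' → hi' + 1 < n → ((lo = l ∧ hi' = k) ∨ (lo = k ∧ hi' = l)) →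
      v lo ∈ e i → v hi' ∈ e i → v (lo + 1) ∈ g → v (hi' + 1) ∈ g → 
      ∃ v' e' p k', Defect E a b n v' e' k' ∧ p + 1 < n ∧ p ≠ k' ∧ v' k' ∈ e' p ∧
      v' (k' + 1) ∈ e' p ∧
      ((v' k' = v i ∧ v' (k' + 1) = v (i + 1)) ∨ (v' k' = v (i + 1) ∧ v' (k' + 1) = v i)) ∧
      ∀ f, Spare E n e (fun t => t = k) f → f ≠ g → Spare E n e' (fun t => t = k') f := by
    intro lo hi' hlt hhi hor q1 q2 q3 q4
    have hU : ∀ t, t + 1 < n → ¬ t = revLab lo hi' i →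
        ¬ (revLab lo hi' t = i ∨ revLab lo hi' t = l ∨ revLab lo hi' t = k) ∨ t = lo ∨ t = hi' := by
      intro t _ h
      have : revLab lo hi' t ≠ i := by
        rintro rfl; rw [revLab_revLab] at h; exact h rfl
      rcases hor with ⟨rfl, rfl⟩ | ⟨rfl, rfl⟩ <;>
      · unfold revLab at *; split_ifs at * <;> omega
    have hC := hP.cross (U' := fun t => t = revLab lo hi' i) hlt hhi (by omega) (by omega)
      hei hg' hge.symm q1 q2 q3 q4 hU
    have hlo : lo ≠ revLab lo hi' i := by
      unfold revLab; split_ifs <;> omega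
    have hve : (v (revPos lo hi' (revLab lo hi' i)) = v i ∧
        v (revPos lo hi' (revLab lo hi' i + 1)) = v (i + 1)) ∨
        (v (revPos lo hi' (revLab lo hi' i)) = v (i + 1) ∧
        v (revPos lo hi' (revLab lo hi' i + 1)) = v i) := by
      by_cases hin : lo < i ∧ i < hi'
      · right
        rw [revLab_in hin.1 hin.2, revPos_in (by omega) (by omega), revPos_in (by omega) (by omega)]
        constructor <;> congr 1 <;> omega
      · left
        rw [revLab_out (by omega), revPos_out (by omega), revPos_out (by omega)]
        exact ⟨rfl, rfl⟩
    refine ⟨_, _, lo, revLab lo hi' i, ⟨hC, revLab_lt hhi hi⟩, by omega, hlo, ?_, ?_, hve, ?_⟩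
    · rw [Function.update_of_ne hlt.ne, Function.update_self]
      rcases hve with ⟨h, -⟩ | ⟨h, -⟩ <;> (simp only [h]; assumption)
    · rw [Function.update_of_ne hlt.ne, Function.update_self]
      rcases hve with ⟨-, h⟩ | ⟨-, h⟩ <;> (simp only [h]; assumption)
    · intro f hf hfg
      exact Spare.cross (U := fun t => t = i ∨ t = l ∨ t = k) (hf.mono (by intro t _ h; tauto)) hhi
        (hf.2 i hi hik).symm hfg hU
  rcases lt_or_gt_of_ne hlk with hlt | hlt
  · exact key l k hlt hk (Or.inl ⟨rfl, rfl⟩) h2 h1 hg2 hg1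
  · exact key k l hlt hl (Or.inr ⟨rfl, rfl⟩) h1 h2 hg1 hg2

/-- Consecutive labels `j, j + 1` with `j` joined to the left end and `j + 1` to the right end
of the defect give a path avoiding the vertex `v (j + 1)`. -/
theorem Defect.not_jLeft_jRight_succ (hN : NoPath E a b n) (hF : NoPath E a b (n - 1))
    (hD : Defect E a b n v e k) {j : ℕ} (h1 : JLeft E n v e k j) :
    ¬ JRight E n v e k (j + 1) := by
  obtain ⟨hj, hjk, g, hg, hg1, hg2⟩ := h1
  rintro ⟨hj', hjk', h, hh, hh1, hh2⟩
  have hk := hD.2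
  have hne : g ≠ h := by
    rintro rfl
    refine hD.not_mem_both hN ⟨hg.1, fun t ht htk => ?_⟩ hg1 hh1
    rcases eq_or_ne t j with rfl | htj
    · exact hh.2 t ht (by omega)
    · exact hg.2 t ht (by tauto)
  have hP : PartialPath E a b n v e (fun t => t = j ∨ t = j + 1 ∨ t = k) :=
    hD.1.mono (by intro t _ h; tauto)
  have hg' : Spare E n e (fun t => t = j ∨ t = j + 1 ∨ t = k) g :=
    hg.mono (by intro t _ h; tauto)
  have hh' : Spare E n e (fun t => t = j ∨ t = j + 1 ∨ t = k) h :=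
    hh.mono (by intro t _ h; tauto)
  have hR := hP.remove (j := j) (by omega) (Or.inl rfl)
  have hg'' := hg'.remove (j := j)
  have hh'' := hh'.remove (j := j)
  rcases lt_or_gt_of_ne hjk with hlt | hlt
  · refine hF _ _ (hR.cross (lo := j) (hi := k - 1) (by omega) (by omega) ?_ ?_ hg'' hh'' hne ?_ ?_
      ?_ ?_ ?_)
    · simp
    · rw [if_neg (by omega)]; omega
    · simpa using hg2
    · simpa [show ¬ k - 1 ≤ j by omega, show k - 1 + 1 = k by omega] using hg1
    · simpa using hh2
    · simpa [show k - 1 + 1 = k by omega, show ¬ k ≤ j by omega] using hh1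
    · intro t _ _; unfold revLab; split_ifs <;> omega
  · refine hF _ _ (hR.cross (lo := k) (hi := j) hlt (by omega) ?_ ?_ hg'' hh'' hne ?_ ?_
      ?_ ?_ ?_)
    · rw [if_pos (by omega)]; omega
    · simp
    · simpa [hlt.le] using hg1
    · simpa using hg2
    · rwa [if_pos (show k + 1 ≤ j by omega)]
    · simpa using hh2
    · intro t _ _; unfold revLab; split_ifs <;> omega

end DefectLemmas

section Counting

open Classical in
/-- The edges through `z` not used at labels outside `U`. -/
noncomputable def unusedAt {V : Type*} (E : Finset (Finset V)) (N : ℕ) (e : ℕ → Finset V)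
    (U : ℕ → Prop) (z : V) : Finset (Finset V) :=
  E.filter (fun g => Spare E N e U g ∧ z ∈ g)

open Classical in
/-- The neighbours of `z` in the unused edges. -/
noncomputable def nbr {V : Type*} [Fintype V] (E : Finset (Finset V)) (N : ℕ)
    (e : ℕ → Finset V) (U : ℕ → Prop) (z : V) : Finset V :=
  Finset.univ.filter (fun w => w ≠ z ∧ ∃ g, Spare E N e U g ∧ z ∈ g ∧ w ∈ g)

open Classical in
/-- The labels whose edge contains `z`. -/
noncomputable def usedAt {V : Type*} (N : ℕ) (e : ℕ → Finset V) (U : ℕ → Prop) (z : V) :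
    Finset ℕ :=
  (Finset.range (N - 1)).filter (fun i => ¬ U i ∧ z ∈ e i)

open Classical in
/-- The labels `i` with `v i ∈ S`. -/
noncomputable def leftIn {V : Type*} (N : ℕ) (v : ℕ → V) (S : Finset V) : Finset ℕ :=
  (Finset.range (N - 1)).filter (fun i => v i ∈ S)

open Classical in
/-- The labels `i` with `v (i + 1) ∈ S`. -/
noncomputable def rightIn {V : Type*} (N : ℕ) (v : ℕ → V) (S : Finset V) : Finset ℕ :=
  (Finset.range (N - 1)).filter (fun i => v (i + 1) ∈ S)

open Classical in
/-- The labels satisfying `JLeft`. -/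
noncomputable def jl {V : Type*} (E : Finset (Finset V)) (n : ℕ) (v : ℕ → V) (e : ℕ → Finset V)
    (k : ℕ) : Finset ℕ :=
  (Finset.range (n - 1)).filter (fun i => JLeft E n v e k i)

open Classical in
/-- The labels satisfying `JRight`. -/
noncomputable def jr {V : Type*} (E : Finset (Finset V)) (n : ℕ) (v : ℕ → V) (e : ℕ → Finset V)
    (k : ℕ) : Finset ℕ :=
  (Finset.range (n - 1)).filter (fun i => JRight E n v e k i)

variable {V : Type*} {E : Finset (Finset V)} {a b : V} {N n : ℕ} {v : ℕ → V}
  {e : ℕ → Finset V} {U : ℕ → Prop} {k : ℕ} {g : Finset V} {z w : V} {i : ℕ} {S : Finset V}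

theorem mem_unusedAt : g ∈ unusedAt E N e U z ↔ Spare E N e U g ∧ z ∈ g := by
  classical
  simp only [unusedAt, Finset.mem_filter]
  exact ⟨fun h => h.2, fun h => ⟨h.1.1, h⟩⟩

theorem mem_nbr [Fintype V] :
    w ∈ nbr E N e U z ↔ w ≠ z ∧ ∃ g, Spare E N e U g ∧ z ∈ g ∧ w ∈ g := by
  classical
  simp [nbr]

theorem mem_usedAt : i ∈ usedAt N e U z ↔ i + 1 < N ∧ ¬ U i ∧ z ∈ e i := by
  classical
  simp only [usedAt, Finset.mem_filter, Finset.mem_range, Nat.lt_sub_iff_add_lt]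

theorem mem_leftIn : i ∈ leftIn N v S ↔ i + 1 < N ∧ v i ∈ S := by
  classical
  simp only [leftIn, Finset.mem_filter, Finset.mem_range, Nat.lt_sub_iff_add_lt]

theorem mem_rightIn : i ∈ rightIn N v S ↔ i + 1 < N ∧ v (i + 1) ∈ S := by
  classical
  simp only [rightIn, Finset.mem_filter, Finset.mem_range, Nat.lt_sub_iff_add_lt]

theorem mem_jl : i ∈ jl E n v e k ↔ JLeft E n v e k i := by
  classical
  simp only [jl, Finset.mem_filter, Finset.mem_range]
  exact ⟨fun h => h.2, fun h => ⟨by have := h.1; omega, h⟩⟩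

theorem mem_jr : i ∈ jr E n v e k ↔ JRight E n v e k i := by
  classical
  simp only [jr, Finset.mem_filter, Finset.mem_range]
  exact ⟨fun h => h.2, fun h => ⟨by have := h.1; omega, h⟩⟩

theorem PartialPath.degree_eq [DecidableEq V] (hP : PartialPath E a b N v e U) (z : V) :
    degree E z = (usedAt N e U z).card + (unusedAt E N e U z).card := by
  classical
  have himg : ((usedAt N e U z).image e).card = (usedAt N e U z).card := by
    apply Finset.card_image_of_injOn
    intro i hi j hj h
    have h1 := mem_usedAt.1 (Finset.mem_coe.1 hi)
    have h2 := mem_usedAt.1 (Finset.mem_coe.1 hj)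
    exact hP.einj i j h1.1 h2.1 h1.2.1 h2.2.1 h
  rw [← himg, degree, ← Finset.card_union_of_disjoint]
  · congr 1
    ext g
    simp only [Finset.mem_filter, Finset.mem_union, Finset.mem_image, mem_usedAt, mem_unusedAt]
    constructor
    · rintro ⟨h1, h2⟩
      by_cases h : ∃ i, i + 1 < N ∧ ¬ U i ∧ e i = g
      · obtain ⟨i, h3, h4, rfl⟩ := h
        exact Or.inl ⟨i, ⟨h3, h4, h2⟩, rfl⟩
      · push Not at h
        exact Or.inr ⟨⟨h1, h⟩, h2⟩
    · rintro (⟨i, ⟨h1, h2, h3⟩, rfl⟩ | ⟨h1, h2⟩)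
      · exact ⟨hP.mem i h1 h2, h3⟩
      · exact ⟨h1.1, h2⟩
  · rw [Finset.disjoint_left]
    intro g h1 h2
    simp only [Finset.mem_image, mem_usedAt, mem_unusedAt] at h1 h2
    obtain ⟨i, ⟨h3, h4, -⟩, h5⟩ := h1
    exact h2.1.2 i h3 h4 h5

theorem card_unusedAt_le [Fintype V] {r : ℕ} (hu : ∀ g ∈ E, g.card = r) :
    (unusedAt E N e U z).card ≤ (nbr E N e U z).card.choose (r - 1) := by
  classical
  rw [← Finset.card_powersetCard]
  apply Finset.card_le_card_of_injOn (fun g => g.erase z)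
  · intro g hg
    have hg' := mem_unusedAt.1 (Finset.mem_coe.1 hg)
    rw [Finset.mem_coe, Finset.mem_powersetCard]
    refine ⟨fun w hw => ?_, by rw [Finset.card_erase_of_mem hg'.2, hu g hg'.1.1]⟩
    rw [Finset.mem_erase] at hw
    exact mem_nbr.2 ⟨hw.1, g, hg'.1, hg'.2, hw.2⟩
  · intro g hg h hh heq
    have hg' := mem_unusedAt.1 (Finset.mem_coe.1 hg)
    have hh' := mem_unusedAt.1 (Finset.mem_coe.1 hh)
    have : g.erase z = h.erase z := heq
    rw [← Finset.insert_erase hg'.2, this, Finset.insert_erase hh'.2]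

/-- If the bound `card_unusedAt_le` is attained, every possible edge is unused. -/
theorem spare_of_card_unusedAt [Fintype V] {r : ℕ} (hu : ∀ g ∈ E, g.card = r)
    (hc : (nbr E N e U z).card.choose (r - 1) ≤ (unusedAt E N e U z).card)
    (hzg : z ∈ g) (hg : g.card = r) (hsub : ∀ w ∈ g, w ≠ z → w ∈ nbr E N e U z) :
    Spare E N e U g := by
  classical
  have himg : (unusedAt E N e U z).image (fun g => g.erase z) =
      (nbr E N e U z).powersetCard (r - 1) := by
    apply Finset.eq_of_subset_of_card_le
    · intro s hs
      obtain ⟨h, hh, rfl⟩ := Finset.mem_image.1 hs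
      have hh' := mem_unusedAt.1 hh
      rw [Finset.mem_powersetCard]
      refine ⟨fun w hw => ?_, by rw [Finset.card_erase_of_mem hh'.2, hu h hh'.1.1]⟩
      rw [Finset.mem_erase] at hw
      exact mem_nbr.2 ⟨hw.1, h, hh'.1, hh'.2, hw.2⟩
    · rw [Finset.card_powersetCard, Finset.card_image_of_injOn]
      · exact hc
      · intro g hg h hh heq
        have hg' := mem_unusedAt.1 (Finset.mem_coe.1 hg)
        have hh' := mem_unusedAt.1 (Finset.mem_coe.1 hh)
        have : g.erase z = h.erase z := heq
        rw [← Finset.insert_erase hg'.2, this, Finset.insert_erase hh'.2]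
  have : g.erase z ∈ (unusedAt E N e U z).image (fun g => g.erase z) := by
    rw [himg, Finset.mem_powersetCard]
    refine ⟨fun w hw => ?_, by rw [Finset.card_erase_of_mem hzg, hg]⟩
    rw [Finset.mem_erase] at hw
    exact hsub w hw.2 hw.1
  obtain ⟨h, hh, heq⟩ := Finset.mem_image.1 this
  have hh' := mem_unusedAt.1 hh
  have : h = g := by
    rw [← Finset.insert_erase hh'.2, show h.erase z = g.erase z from heq, Finset.insert_erase hzg]
  exact this ▸ hh'.1

theorem PartialPath.exists_eq [Fintype V] (hP : PartialPath E a b n v e U)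
    (hn : Fintype.card V = n) (z : V) : ∃ i, i < n ∧ v i = z := by
  classical
  have : (Finset.range n).image v = Finset.univ := by
    apply Finset.eq_univ_of_card
    rw [Finset.card_image_of_injOn, Finset.card_range, hn]
    intro i hi j hj h
    simp only [Finset.coe_range, Set.mem_Iio] at hi hj
    exact hP.inj i j hi hj h
  have hz := Finset.mem_univ z
  rw [← this, Finset.mem_image] at hz
  obtain ⟨i, hi, h⟩ := hz
  exact ⟨i, Finset.mem_range.1 hi, h⟩

open Classical in
theorem PartialPath.card_positions (hP : PartialPath E a b N v e U)
    (hS : ∀ z ∈ S, ∃ i, i < N ∧ v i = z) :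
    ((Finset.range N).filter (fun i => v i ∈ S)).card = S.card := by
  have himg : ((Finset.range N).filter (fun i => v i ∈ S)).image v = S := by
    ext z
    simp only [Finset.mem_image, Finset.mem_filter, Finset.mem_range]
    constructor
    · rintro ⟨i, h, rfl⟩; exact h.2
    · intro hz
      obtain ⟨i, hi, rfl⟩ := hS z hz
      exact ⟨i, ⟨hi, hz⟩, rfl⟩
  conv_rhs => rw [← himg]
  rw [Finset.card_image_of_injOn]
  intro i hi j hj h
  simp only [Finset.coe_filter, Finset.mem_range, Set.mem_ofPred_eq] at hi hj
  exact hP.inj i j hi.1 hj.1 h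

open Classical in
theorem PartialPath.card_leftIn (hP : PartialPath E a b N v e U) (hN : 0 < N)
    (hS : ∀ z ∈ S, ∃ i, i < N ∧ v i = z) :
    S.card = (leftIn N v S).card + if v (N - 1) ∈ S then 1 else 0 := by
  have hc := hP.card_positions hS
  obtain ⟨M, rfl⟩ : ∃ M, N = M + 1 := ⟨N - 1, by omega⟩
  rw [← hc, Finset.range_add_one, Finset.filter_insert, leftIn]
  simp only [Nat.add_sub_cancel]
  split_ifs with h
  · rw [Finset.card_insert_of_notMem (by simp)]
  · rfl

theorem card_eq_of_reflect {s t : Finset ℕ} (hs : ∀ i ∈ s, i + 1 < N ∧ N - 2 - i ∈ t)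
    (ht : ∀ i ∈ t, i + 1 < N ∧ N - 2 - i ∈ s) : s.card = t.card :=
  Finset.card_nbij' (fun i => N - 2 - i) (fun i => N - 2 - i) (fun i hi => (hs i hi).2)
    (fun i hi => (ht i hi).2)
    (fun i hi => by have := (hs i hi).1; show N - 2 - (N - 2 - i) = i; omega)
    (fun i hi => by have := (ht i hi).1; show N - 2 - (N - 2 - i) = i; omega)

open Classical in
theorem PartialPath.card_rightIn (hP : PartialPath E a b N v e U) (hN : 0 < N)
    (hS : ∀ z ∈ S, ∃ i, i < N ∧ v i = z) :
    S.card = (rightIn N v S).card + if v 0 ∈ S then 1 else 0 := by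
  have := hP.mirror.card_leftIn (S := S) hN (by
    intro z hz
    obtain ⟨i, hi, rfl⟩ := hS z hz
    exact ⟨N - 1 - i, by omega, by congr 1; omega⟩)
  rw [this]
  simp only [Nat.sub_self]
  congr 1
  refine card_eq_of_reflect (N := N) ?_ ?_
  · intro i hi
    have := mem_leftIn.1 hi
    refine ⟨this.1, mem_rightIn.2 ⟨by omega, ?_⟩⟩
    simpa [show N - 2 - i + 1 = N - 1 - i by omega] using this.2
  · intro i hi
    have := mem_rightIn.1 hi
    refine ⟨this.1, mem_leftIn.2 ⟨by omega, ?_⟩⟩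
    simpa [show N - 1 - (N - 2 - i) = i + 1 by omega] using this.2

theorem card_jl_mirror (hk : k + 1 < n) :
    (jl E n (fun t => v (n - 1 - t)) (fun t => e (n - 2 - t)) (n - 2 - k)).card =
      (jr E n v e k).card := by
  refine card_eq_of_reflect (N := n) ?_ ?_
  · intro i hi
    have := mem_jl.1 hi
    exact ⟨this.1, mem_jr.2 ((jLeft_mirror_iff hk this.1).1 this)⟩
  · intro i hi
    have := mem_jr.1 hi
    have h1 := this.1
    refine ⟨h1, mem_jl.2 ((jLeft_mirror_iff hk (by omega)).2 ?_)⟩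
    rwa [show n - 2 - (n - 2 - i) = i by omega]

theorem Defect.usedAt_subset_jl (hD : Defect E a b n v e k) :
    usedAt n e (fun t => t = k) (v k) ⊆ jl E n v e k := by
  intro i hi
  have := mem_usedAt.1 hi
  exact mem_jl.2 (hD.jLeft_of_mem this.1 this.2.1 this.2.2)

theorem Defect.leftIn_subset_jl [Fintype V] :
    leftIn n v (nbr E n e (fun t => t = k) (v k)) ⊆ jl E n v e k := by
  intro i hi
  have h1 := mem_leftIn.1 hi
  obtain ⟨h2, g, h3, h4, h5⟩ := mem_nbr.1 h1.2
  exact mem_jl.2 ⟨h1.1, by rintro rfl; exact h2 rfl, g, h3.or_left i, h4, h5⟩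

theorem Defect.card_nbr_left [Fintype V] (hn : Fintype.card V = n) (hD : Defect E a b n v e k) :
    (nbr E n e (fun t => t = k) (v k)).card ≤
        (leftIn n v (nbr E n e (fun t => t = k) (v k))).card + 1 ∧
      (v (n - 1) ∉ nbr E n e (fun t => t = k) (v k) →
        (nbr E n e (fun t => t = k) (v k)).card =
          (leftIn n v (nbr E n e (fun t => t = k) (v k))).card) := by
  classical
  have := hD.2
  have := hD.1.card_leftIn (S := nbr E n e (fun t => t = k) (v k)) (by omega)
    (fun z _ => hD.1.exists_eq hn z)
  constructor
  · split_ifs at this <;> omega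
  · intro h; rw [if_neg h] at this; exact this

open Classical in
theorem card_le_labels_add :
    E.card ≤ (N - 1) + (E.filter (fun g => Spare E N e U g)).card := by
  have : E ⊆ (Finset.range (N - 1)).image e ∪ E.filter (fun g => Spare E N e U g) := by
    intro g hg
    simp only [Finset.mem_union, Finset.mem_image, Finset.mem_range, Finset.mem_filter]
    by_cases h : ∃ i, i < N - 1 ∧ e i = g
    · exact Or.inl h
    · push Not at h
      exact Or.inr ⟨hg, hg, fun t ht _ => h t (by omega)⟩
  refine (Finset.card_le_card this).trans ((Finset.card_union_le _ _).trans ?_)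
  have := (Finset.card_image_le (s := Finset.range (N - 1)) (f := e))
  rw [Finset.card_range] at this
  omega

theorem card_mul_le_of_degree [Fintype V] [DecidableEq V] {r δ : ℕ} (hu : ∀ g ∈ E, g.card = r)
    (hdeg : ∀ z, δ ≤ degree E z) : Fintype.card V * δ ≤ r * E.card := by
  have h1 : ∑ z : V, degree E z = ∑ g ∈ E, g.card := by
    simp only [degree, Finset.card_eq_sum_ones, Finset.sum_filter]
    rw [Finset.sum_comm]
    simp
  have h2 : ∑ g ∈ E, g.card = r * E.card := by
    rw [Finset.sum_congr rfl hu, Finset.sum_const, smul_eq_mul, mul_comm]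
  rw [← h2, ← h1, Fintype.card, ← smul_eq_mul, ← Finset.sum_const]
  exact Finset.sum_le_sum fun z _ => hdeg z

end Counting

section FreeVertex

variable {V : Type*} {E : Finset (Finset V)} {a b : V} {N : ℕ} {w : ℕ → V}
  {e : ℕ → Finset V} {x : V} {f g g' h : Finset V}

/-- The vertex `x` cannot be inserted in a path. -/
theorem PartialPath.not_insert (hN : NoPath E a b (N + 1)) {j : ℕ}
    (hP : PartialPath E a b N w e (fun t => t = j)) (hx : ∀ i, i < N → w i ≠ x) (hj : j + 1 < N)
    (hg : Spare E N e (fun t => t = j) g) (hg' : Spare E N e (fun t => t = j) g')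
    (h1 : w j ∈ g) (h2 : x ∈ g) (h3 : x ∈ g') (h4 : w (j + 1) ∈ g') : g = g' := by
  by_contra hne
  have hI := hP.insert hj hx rfl
  have hA := hI.assign (i := j) (g := g) (U' := fun t => t = j + 1) (hg.insert hj) (by simpa)
    (by simpa) (by intro t _ h; split_ifs <;> omega)
  refine hN _ _ (hA.assign (i := j + 1) (g := g') ((hg'.insert hj).assign (Ne.symm hne) ?_)
    (by simpa) (by simpa) ?_)
  · intro t _ h; split_ifs <;> omega
  · intro t _ h; tauto

/-- Insertion of `x` after reversing the segment between two labels. -/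
theorem PartialPath.not_cross_insert (hN : NoPath E a b (N + 1)) {α β : ℕ}
    (hP : PartialPath E a b N w e (fun _ => False)) (hx : ∀ i, i < N → w i ≠ x)
    (hα : α + 1 < N) (hβ : β + 1 < N) (hαβ : α ≠ β)
    (hh : Spare E N e (fun t => t = α ∨ t = β) h) (hg : Spare E N e (fun t => t = α ∨ t = β) g)
    (hg' : Spare E N e (fun t => t = α ∨ t = β) g')
    (h1 : w α ∈ h) (h2 : w β ∈ h) (h3 : x ∈ g) (h4 : w (α + 1) ∈ g) (h5 : x ∈ g')
    (h6 : w (β + 1) ∈ g') (hhg : h ≠ g) (hhg' : h ≠ g') : g = g' := by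
  wlog hlt : α < β generalizing α β g g'
  · exact (this hβ hα hαβ.symm (hh.mono (by intro t _ h; tauto)) (hg'.mono (by intro t _ h; tauto))
      (hg.mono (by intro t _ h; tauto)) h2 h1 h5 h6 h3 h4 hhg' hhg (by omega)).symm
  have hP' : PartialPath E a b N w e (fun t => t = α ∨ t = β) :=
    hP.mono (by intro t _ _; tauto)
  have hU : ∀ t, t + 1 < N → ¬ t = β → ¬ (revLab α β t = α ∨ revLab α β t = β) ∨ t = α := by
    intro t _ h; unfold revLab; split_ifs <;> omega
  have hR := (hP'.rev hlt hβ (Or.inl rfl) (Or.inr rfl)).assign (i := α) (U' := fun t => t = β)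
    (hh.rev hβ) (by simpa [revPos_out] using h1)
    (by
      show w (revPos α β (α + 1)) ∈ h
      rwa [revPos_in (by omega) (by omega), show α + β + 1 - (α + 1) = β by omega]) hU
  refine PartialPath.not_insert hN hR ?_ hβ ((hg.rev hβ).assign hhg.symm hU)
    ((hg'.rev hβ).assign hhg'.symm hU) ?_ h3 h5 ?_
  · intro i hi
    exact hx _ (by unfold revPos; split_ifs <;> omega)
  · rwa [revPos_in hlt le_rfl, show α + β + 1 - β = α + 1 by omega]
  · rwa [revPos_out (by omega)]

theorem PartialPath.not_cross_insert' (hN : NoPath E a b (N + 1)) {α β : ℕ}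
    (hP : PartialPath E a b N w e (fun _ => False)) (hx : ∀ i, i < N → w i ≠ x)
    (hα : α + 1 < N) (hβ : β + 1 < N) (hαβ : α ≠ β)
    (hh : Spare E N e (fun t => t = α ∨ t = β) h) (hg : Spare E N e (fun t => t = α ∨ t = β) g)
    (hg' : Spare E N e (fun t => t = α ∨ t = β) g')
    (h1 : w (α + 1) ∈ h) (h2 : w (β + 1) ∈ h) (h3 : x ∈ g) (h4 : w α ∈ g) (h5 : x ∈ g')
    (h6 : w β ∈ g') (hhg : h ≠ g) (hhg' : h ≠ g') : g = g' := by
  have hmir : ∀ {g}, Spare E N e (fun t => t = α ∨ t = β) g →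
      Spare E N (fun t => e (N - 2 - t)) (fun t => t = N - 2 - α ∨ t = N - 2 - β) g :=
    fun hg => hg.mirror.mono (by intro t _ _; omega)
  refine PartialPath.not_cross_insert hN.symm (α := N - 2 - α) (β := N - 2 - β) hP.mirror
    (fun i hi => hx _ (by omega)) (by omega) (by omega) (by omega) (hmir hh) (hmir hg) (hmir hg')
    ?_ ?_ h3 ?_ h5 ?_ hhg hhg'
  · rwa [show N - 1 - (N - 2 - α) = α + 1 by omega]
  · rwa [show N - 1 - (N - 2 - β) = β + 1 by omega]
  · rwa [show N - 1 - (N - 2 - α + 1) = α by omega]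
  · rwa [show N - 1 - (N - 2 - β + 1) = β by omega]

theorem PartialPath.spare_of_used (hP : PartialPath E a b N w e (fun _ => False)) {i : ℕ}
    (hi : i + 1 < N) {U : ℕ → Prop} (hU : U i) : Spare E N e U (e i) :=
  hP.spare hi id (by intro t _ h; exact ⟨id, by rintro rfl; exact h hU⟩)

theorem Spare.of_unused (hg : Spare E N e (fun _ => False) g) (U : ℕ → Prop) : Spare E N e U g :=
  hg.mono (by intro t _ _; exact id)

variable [Fintype V]

theorem PartialPath.not_mem_nbr_left (hN : NoPath E a b (N + 1))
    (hP : PartialPath E a b N w e (fun _ => False)) (hx : ∀ i, i < N → w i ≠ x) {i : ℕ}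
    (hi : i + 1 < N) (hxe : x ∈ e i) : w i ∉ nbr E N e (fun _ => False) x := by
  intro h
  obtain ⟨-, g, hg, h1, h2⟩ := mem_nbr.1 h
  exact hg.2 i hi id (PartialPath.not_insert hN (hP.mono (by intro t _ _; exact id)) hx hi
    (hg.of_unused _) (hP.spare_of_used hi rfl) h2 h1 hxe (hP.right i hi id)).symm

theorem PartialPath.not_mem_nbr_right (hN : NoPath E a b (N + 1))
    (hP : PartialPath E a b N w e (fun _ => False)) (hx : ∀ i, i < N → w i ≠ x) {i : ℕ}
    (hi : i + 1 < N) (hxe : x ∈ e i) : w (i + 1) ∉ nbr E N e (fun _ => False) x := by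
  intro h
  obtain ⟨-, g, hg, h1, h2⟩ := mem_nbr.1 h
  exact hg.2 i hi id (PartialPath.not_insert hN (hP.mono (by intro t _ _; exact id)) hx hi
    (hP.spare_of_used hi rfl) (hg.of_unused _) (hP.left i hi id) hxe h1 h2)

/-- When two consecutive vertices are neighbours of `x`, a single unused edge contains both and
exchanging it reduces the unused edges at `x`. -/
theorem PartialPath.exists_swap (hN : NoPath E a b (N + 1))
    (hP : PartialPath E a b N w e (fun _ => False)) (hx : ∀ i, i < N → w i ≠ x) {i : ℕ}
    (hi : i + 1 < N) (h1 : w i ∈ nbr E N e (fun _ => False) x)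
    (h2 : w (i + 1) ∈ nbr E N e (fun _ => False) x) :
    ∃ f, PartialPath E a b N w (Function.update e i f) (fun _ => False) ∧
      unusedAt E N (Function.update e i f) (fun _ => False) x ⊂
        unusedAt E N e (fun _ => False) x := by
  have hxe : x ∉ e i := fun h => PartialPath.not_mem_nbr_left hN hP hx hi h h1
  obtain ⟨-, f, hf, h3, h4⟩ := mem_nbr.1 h1
  obtain ⟨-, f', hf', h5, h6⟩ := mem_nbr.1 h2
  obtain rfl := PartialPath.not_insert hN (hP.mono (by intro t _ _; exact id)) hx hi
    (hf.of_unused _) (hf'.of_unused _) h4 h3 h5 h6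
  refine ⟨f, hP.assign hf h4 h6 (by intro t _ _; exact Or.inl id), ?_⟩
  rw [Finset.ssubset_iff_of_subset]
  · refine ⟨f, mem_unusedAt.2 ⟨hf, h3⟩, fun h => ?_⟩
    exact (mem_unusedAt.1 h).1.2 i hi id (by simp)
  · intro g hg
    obtain ⟨hg1, hg2⟩ := mem_unusedAt.1 hg
    refine mem_unusedAt.2 ⟨⟨hg1.1, fun t ht _ h => ?_⟩, hg2⟩
    rcases eq_or_ne t i with rfl | hti
    · exact hxe (h ▸ hg2)
    · exact hg1.2 t ht id (by simpa [hti] using h)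

theorem nbr_subset_of_unusedAt_subset {e' : ℕ → Finset V} {U U' : ℕ → Prop} {M : ℕ} {z : V}
    (h : unusedAt E N e U z ⊆ unusedAt E M e' U' z) : nbr E N e U z ⊆ nbr E M e' U' z := by
  intro u hu
  obtain ⟨h1, g, hg, h2, h3⟩ := mem_nbr.1 hu
  have := mem_unusedAt.1 (h (mem_unusedAt.2 ⟨hg, h2⟩))
  exact mem_nbr.2 ⟨h1, g, this.1, this.2, h3⟩

end FreeVertex

theorem succ_le_choose_succ {M j : ℕ} (h : j + 1 ≤ M) : M + 1 ≤ (M + 1).choose (j + 1) := by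
  induction M generalizing j with
  | zero => omega
  | succ M ih =>
    rw [Nat.choose_succ_succ']
    rcases Nat.lt_or_ge M (j + 1) with h3 | h3
    · obtain rfl : M = j := by omega
      rw [Nat.choose_self, Nat.choose_succ_self_right]
    · have := ih h3
      have : 1 ≤ (M + 1).choose j := Nat.choose_pos (by omega)
      omega

theorem le_choose {m k : ℕ} (h1 : 1 ≤ k) (h2 : k + 1 ≤ m) : m ≤ m.choose k := by
  obtain ⟨j, rfl⟩ : ∃ j, k = j + 1 := ⟨k - 1, by omega⟩
  obtain ⟨M, rfl⟩ : ∃ M, m = M + 1 := ⟨m - 1, by omega⟩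
  exact succ_le_choose_succ (by omega)

theorem choose_add_mul_le {s k : ℕ} (hk : 2 ≤ k) (hks : k ≤ s) (t : ℕ) :
    s.choose k + t * (s + 1) ≤ (s + t).choose k + 1 := by
  obtain ⟨j, rfl⟩ : ∃ j, k = j + 1 := ⟨k - 1, by omega⟩
  induction t with
  | zero => simp
  | succ t ih =>
    have h1 : s + t ≤ (s + t).choose j := le_choose (by omega) (by omega)
    rw [← Nat.add_assoc, Nat.choose_succ_succ', Nat.add_mul]
    rcases Nat.eq_zero_or_pos t with rfl | ht
    · simp at *; omega
    · omega

section FreeCount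

variable {V : Type*} [Fintype V] {E : Finset (Finset V)} {a b : V} {N : ℕ} {w : ℕ → V}
  {e : ℕ → Finset V} {x : V} {f g g' h : Finset V}

theorem PartialPath.exists_eq_of_ne {U : ℕ → Prop} (hP : PartialPath E a b N w e U)
    (hn : Fintype.card V = N + 1) (hx : ∀ i, i < N → w i ≠ x) {z : V} (hz : z ≠ x) :
    ∃ i, i < N ∧ w i = z := by
  classical
  have : Insert.insert x ((Finset.range N).image w) = Finset.univ := by
    apply Finset.eq_univ_of_card
    rw [Finset.card_insert_of_notMem, Finset.card_image_of_injOn, Finset.card_range, hn]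
    · intro i hi j hj h
      simp only [Finset.coe_range, Set.mem_Iio] at hi hj
      exact hP.inj i j hi hj h
    · simp only [Finset.mem_image, Finset.mem_range]
      rintro ⟨i, hi, h⟩
      exact hx i hi h
  have hz' := Finset.mem_univ z
  rw [← this, Finset.mem_insert, Finset.mem_image] at hz'
  obtain ⟨i, hi, h⟩ := hz'.resolve_left hz
  exact ⟨i, Finset.mem_range.1 hi, h⟩

theorem PartialPath.free_count [DecidableEq V] (hN : NoPath E a b (N + 1)) (hN2 : 0 < N)
    (hP : PartialPath E a b N w e (fun _ => False)) (hx : ∀ i, i < N → w i ≠ x)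
    (hgood : ∀ i, i + 1 < N → w i ∈ nbr E N e (fun _ => False) x →
      w (i + 1) ∉ nbr E N e (fun _ => False) x) :
    (usedAt N e (fun _ => False) x ∪ leftIn N w (nbr E N e (fun _ => False) x) ∪
      rightIn N w (nbr E N e (fun _ => False) x)) ⊆ Finset.range (N - 1) ∧
    (usedAt N e (fun _ => False) x ∪ leftIn N w (nbr E N e (fun _ => False) x) ∪
      rightIn N w (nbr E N e (fun _ => False) x)).card = 
    (usedAt N e (fun _ => False) x).card + (leftIn N w (nbr E N e (fun _ => False) x)).card +
      (rightIn N w (nbr E N e (fun _ => False) x)).card := by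
  have hd1 : Disjoint (usedAt N e (fun _ => False) x)
      (leftIn N w (nbr E N e (fun _ => False) x)) := by
    rw [Finset.disjoint_left]
    intro i h1 h2
    rw [mem_usedAt] at h1
    exact PartialPath.not_mem_nbr_left hN hP hx h1.1 h1.2.2 (mem_leftIn.1 h2).2
  have hd2 : Disjoint (usedAt N e (fun _ => False) x ∪
      leftIn N w (nbr E N e (fun _ => False) x)) 
      (rightIn N w (nbr E N e (fun _ => False) x)) := by
    rw [Finset.disjoint_left]
    intro i h1 h2
    rw [mem_rightIn] at h2
    rcases Finset.mem_union.1 h1 with h1 | h1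
    · rw [mem_usedAt] at h1
      exact PartialPath.not_mem_nbr_right hN hP hx h1.1 h1.2.2 h2.2
    · exact hgood i h2.1 (mem_leftIn.1 h1).2 h2.2
  refine ⟨?_, by rw [Finset.card_union_of_disjoint hd2, Finset.card_union_of_disjoint hd1]⟩
  intro i hi
  simp only [Finset.mem_union, mem_usedAt, mem_leftIn, mem_rightIn] at hi
  rw [Finset.mem_range]; omega

/-- The possible numerical configurations at a free vertex. -/
theorem PartialPath.free_cases [DecidableEq V] {m r : ℕ} (hn : Fintype.card V = N + 1)
    (hm : m = (N + 1) / 2) (hr : 3 ≤ r) (hrm : r ≤ m) (hu : ∀ g ∈ E, g.card = r)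
    (hdeg : m.choose (r - 1) + 1 ≤ degree E x)
    (hN : NoPath E a b (N + 1)) 
    (hP : PartialPath E a b N w e (fun _ => False)) (hx : ∀ i, i < N → w i ≠ x)
    (hgood : ∀ i, i + 1 < N → w i ∈ nbr E N e (fun _ => False) x →
      w (i + 1) ∉ nbr E N e (fun _ => False) x) :
    (unusedAt E N e (fun _ => False) x).card = 0 ∨
    (N = 2 * m ∧ (usedAt N e (fun _ => False) x).card = 1 ∧
      (nbr E N e (fun _ => False) x).card = m ∧
      (unusedAt E N e (fun _ => False) x).card = m.choose (r - 1) ∧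
      (leftIn N w (nbr E N e (fun _ => False) x)).card = m - 1 ∧
      (rightIn N w (nbr E N e (fun _ => False) x)).card = m - 1) ∨
    (r = 3 ∧ m = 3 ∧ N = 6 ∧ (usedAt N e (fun _ => False) x).card = 3 ∧
      (nbr E N e (fun _ => False) x).card = 2 ∧
      (unusedAt E N e (fun _ => False) x).card = 1 ∧
      (leftIn N w (nbr E N e (fun _ => False) x)).card = 1 ∧
      (rightIn N w (nbr E N e (fun _ => False) x)).card = 1) := by
  classical
  obtain ⟨hsub, hc⟩ := PartialPath.free_count hN (by omega) hP hx hgood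
  have hle := Finset.card_le_card hsub
  rw [hc, Finset.card_range] at hle
  have hd := hP.degree_eq x
  have hb := card_unusedAt_le (N := N) (e := e) (U := fun _ => False) (z := x) hu
  have hS : ∀ z ∈ nbr E N e (fun _ => False) x, ∃ i, i < N ∧ w i = z :=
    fun z hz => hP.exists_eq_of_ne hn hx (mem_nbr.1 hz).1
  have hL := hP.card_leftIn (by omega) hS
  have hR := hP.card_rightIn (by omega) hS
  have hL' : (nbr E N e (fun _ => False) x).card ≤
      (leftIn N w (nbr E N e (fun _ => False) x)).card + 1 := by split_ifs at hL <;> omega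
  have hR' : (nbr E N e (fun _ => False) x).card ≤
      (rightIn N w (nbr E N e (fun _ => False) x)).card + 1 := by split_ifs at hR <;> omega
  generalize (usedAt N e (fun _ => False) x).card = a' at *
  generalize (leftIn N w (nbr E N e (fun _ => False) x)).card = L at *
  generalize (rightIn N w (nbr E N e (fun _ => False) x)).card = R at *
  generalize (nbr E N e (fun _ => False) x).card = s at *
  generalize (unusedAt E N e (fun _ => False) x).card = d at *
  clear hc hL hR hS hsub
  rcases Nat.eq_zero_or_pos d with h0 | h0
  · exact Or.inl h0
  right
  have hs : r - 1 ≤ s := by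
    by_contra h
    rw [Nat.choose_eq_zero_of_lt (by omega)] at hb
    omega
  have hsm : s ≤ m := by omega
  rcases Nat.eq_or_lt_of_le hsm with rfl | hlt
  · left; omega
  · right
    have := choose_add_mul_le (s := s) (k := r - 1) (by omega) hs (m - s)
    rw [show s + (m - s) = m by omega] at this
    obtain ⟨t, rfl⟩ : ∃ t, m = s + t + 1 := ⟨m - s - 1, by omega⟩
    rw [show s + t + 1 - s = t + 1 by omega] at this
    have h1 : a' ≤ 2 * t + 3 := by omega
    have h2 : (t + 1) * (s + 1) ≤ 2 * t + 3 := by omega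
    have hs2 : s = 2 := by
      by_contra hs2
      have := Nat.mul_le_mul_left (t + 1) (show 4 ≤ s + 1 by omega)
      omega
    subst hs2
    have ht : t = 0 := by omega
    subst ht
    obtain rfl : r = 3 := by omega
    simp at *
    omega

end FreeCount

section FreeExclude

variable {V : Type*} {E : Finset (Finset V)} {a b : V} {N : ℕ}
  {w : ℕ → V} {e : ℕ → Finset V} {x : V} {f g g' h : Finset V} {m r : ℕ}

theorem PartialPath.not_mem_two_used (hN : NoPath E a b (N + 1))
    (hP : PartialPath E a b N w e (fun _ => False)) (hx : ∀ i, i < N → w i ≠ x)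
    (hh : Spare E N e (fun _ => False) h) {i l : ℕ} (hi : i + 1 < N) (hl : l + 1 < N) (hil : i ≠ l)
    (hxi : x ∈ e i) (hxl : x ∈ e l) :
    ¬ (w i ∈ h ∧ w l ∈ h) ∧ ¬ (w (i + 1) ∈ h ∧ w (l + 1) ∈ h) := by
  constructor
  · rintro ⟨h1, h2⟩
    exact hil (hP.einj i l hi hl id id (PartialPath.not_cross_insert hN hP hx hi hl hil
      (hh.of_unused _) (hP.spare_of_used hi (Or.inl rfl)) (hP.spare_of_used hl (Or.inr rfl))
      h1 h2 hxi (hP.right i hi id) hxl (hP.right l hl id) (hh.2 i hi id).symm (hh.2 l hl id).symm))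
  · rintro ⟨h1, h2⟩
    exact hil (hP.einj i l hi hl id id (PartialPath.not_cross_insert' hN hP hx hi hl hil
      (hh.of_unused _) (hP.spare_of_used hi (Or.inl rfl)) (hP.spare_of_used hl (Or.inr rfl))
      h1 h2 hxi (hP.left i hi id) hxl (hP.left l hl id) (hh.2 i hi id).symm (hh.2 l hl id).symm))

theorem eq_of_mem_iff_positions [DecidableEq V] {S T : Finset V}
    (hS : ∀ z ∈ S, ∃ i, i < N ∧ w i = z)
    (hT : ∀ z ∈ T, ∃ i, i < N ∧ w i = z)
    (h : (Finset.range N).filter (fun i => w i ∈ S) = (Finset.range N).filter (fun i => w i ∈ T)) :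
    S = T := by
  ext z
  constructor
  · intro hz
    obtain ⟨i, hi, rfl⟩ := hS z hz
    have : i ∈ (Finset.range N).filter (fun i => w i ∈ S) := by simp [hi, hz]
    rw [h] at this
    exact (Finset.mem_filter.1 this).2
  · intro hz
    obtain ⟨i, hi, rfl⟩ := hT z hz
    have : i ∈ (Finset.range N).filter (fun i => w i ∈ T) := by simp [hi, hz]
    rw [← h] at this
    exact (Finset.mem_filter.1 this).2

theorem card_le_of_inter_le_one {α : Type*} [DecidableEq α] {T A C : Finset α}
    (h1 : ∀ i ∈ T, ∀ j ∈ T, i ∈ A → j ∈ A → i = j) (h2 : ∀ i ∈ T, i ∉ A → i ∈ C) :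
    T.card ≤ (T ∩ C).card + 1 := by
  have hs : T ⊆ (T ∩ C) ∪ (T ∩ A) := by
    intro i hi
    by_cases h : i ∈ A
    · exact Finset.mem_union_right _ (Finset.mem_inter.2 ⟨hi, h⟩)
    · exact Finset.mem_union_left _ (Finset.mem_inter.2 ⟨hi, h2 i hi h⟩)
  have hA : (T ∩ A).card ≤ 1 := by
    rw [Finset.card_le_one]
    intro i hi j hj
    rw [Finset.mem_inter] at hi hj
    exact h1 i hi.1 j hj.1 hi.2 hj.2
  exact (Finset.card_le_card hs).trans ((Finset.card_union_le _ _).trans (by omega))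

variable [Fintype V] [DecidableEq V]

/-- The free vertex lies in an unused edge. -/
theorem PartialPath.unusedAt_ne_zero (hn : Fintype.card V = N + 1)
    (hm : m = (N + 1) / 2) (hr : 3 ≤ r) (hrm : r ≤ m) (hu : ∀ g ∈ E, g.card = r)
    (hdeg : ∀ z, m.choose (r - 1) + 1 ≤ degree E z)
    (hN : NoPath E a b (N + 1))
    (hP : PartialPath E a b N w e (fun _ => False)) (hx : ∀ i, i < N → w i ≠ x) :
    (unusedAt E N e (fun _ => False) x).card ≠ 0 := by
  classical
  intro h0
  have hd := hP.degree_eq x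
  have hdx := hdeg x
  rw [h0] at hd
  rw [Finset.card_eq_zero] at h0
  have hxh : ∀ h, Spare E N e (fun _ => False) h → x ∉ h := by
    intro h hh hxh
    have := mem_unusedAt.2 ⟨hh, hxh⟩
    rw [h0] at this
    exact absurd this (Finset.notMem_empty _)
  set A := usedAt N e (fun _ => False) x with hA
  have hAsub : A ⊆ Finset.range N := by
    intro i hi
    have := (mem_usedAt.1 hi).1
    rw [Finset.mem_range]; omega
  set C := Finset.range N \ A with hC
  set C' := Finset.range N \ A.image (· + 1) with hC'
  have hCc : C.card = N - A.card := by rw [hC, Finset.card_sdiff_of_subset hAsub, Finset.card_range]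
  have hC'c : C'.card = N - A.card := by
    rw [hC', Finset.card_sdiff_of_subset, Finset.card_range, Finset.card_image_of_injective]
    · intro i j h; simpa using h
    · intro i hi
      obtain ⟨j, hj, rfl⟩ := Finset.mem_image.1 hi
      have := (mem_usedAt.1 hj).1
      rw [Finset.mem_range]; omega
  have hcov : ∀ h, Spare E N e (fun _ => False) h → ∀ z ∈ h, ∃ i, i < N ∧ w i = z :=
    fun h hh z hz => hP.exists_eq_of_ne hn hx (by rintro rfl; exact hxh h hh hz)
  have hT : ∀ h, Spare E N e (fun _ => False) h →
      ((Finset.range N).filter (fun i => w i ∈ h)).card = r := by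
    intro h hh
    have := hP.card_positions (hcov h hh)
    rw [← hu h hh.1, ← this]
    congr
  have hTC : ∀ h, Spare E N e (fun _ => False) h →
      r ≤ ((Finset.range N).filter (fun i => w i ∈ h) ∩ C).card + 1 := by
    intro h hh
    rw [← hT h hh]
    apply card_le_of_inter_le_one (A := A)
    · intro i hi j hj hiA hjA
      by_contra hij
      have h1 := mem_usedAt.1 hiA
      have h2 := mem_usedAt.1 hjA
      exact (PartialPath.not_mem_two_used hN hP hx hh h1.1 h2.1 hij h1.2.2 h2.2.2).1
        ⟨(Finset.mem_filter.1 hi).2, (Finset.mem_filter.1 hj).2⟩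
    · intro i hi hiA
      exact Finset.mem_sdiff.2 ⟨(Finset.mem_filter.1 hi).1, hiA⟩
  have hTC' : ∀ h, Spare E N e (fun _ => False) h →
      r ≤ ((Finset.range N).filter (fun i => w i ∈ h) ∩ C').card + 1 := by
    intro h hh
    rw [← hT h hh]
    apply card_le_of_inter_le_one (A := A.image (· + 1))
    · intro i hi j hj hiA hjA
      by_contra hij
      obtain ⟨i, hi', rfl⟩ := Finset.mem_image.1 hiA
      obtain ⟨j, hj', rfl⟩ := Finset.mem_image.1 hjA
      have h1 := mem_usedAt.1 hi'
      have h2 := mem_usedAt.1 hj'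
      exact (PartialPath.not_mem_two_used hN hP hx hh h1.1 h2.1 (by omega) h1.2.2 h2.2.2).2
        ⟨(Finset.mem_filter.1 hi).2, (Finset.mem_filter.1 hj).2⟩
    · intro i hi hiA
      exact Finset.mem_sdiff.2 ⟨(Finset.mem_filter.1 hi).1, hiA⟩
  have hE := card_mul_le_of_degree hu hdeg
  rw [hn] at hE
  have hE2 := card_le_labels_add (E := E) (N := N) (e := e) (U := fun _ => False)
  have hml : m ≤ m.choose (r - 1) := le_choose (by omega) (by omega)
  have hE3 : N + 1 ≤ E.card := by
    by_contra hlt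
    have h1 : (N + 1) * (r + 1) ≤ (N + 1) * (m.choose (r - 1) + 1) :=
      Nat.mul_le_mul_left _ (by omega)
    have h2 : r * E.card ≤ r * N := Nat.mul_le_mul_left _ (by omega)
    nlinarith
  obtain ⟨h₁, hh₁, h₂, hh₂, hne⟩ := Finset.one_lt_card.1
    (show 1 < (E.filter (fun g => Spare E N e (fun _ => False) g)).card by omega)
  replace hh₁ := (Finset.mem_filter.1 hh₁).2
  replace hh₂ := (Finset.mem_filter.1 hh₂).2
  have hA2 : A.card + r ≤ N + 1 := by
    have := hTC h₁ hh₁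
    have h2 : ((Finset.range N).filter (fun i => w i ∈ h₁) ∩ C).card ≤ C.card :=
      Finset.card_le_card Finset.inter_subset_right
    omega
  have hrm' : r = m ∧ N + 1 = A.card + m := by
    have := choose_add_mul_le (s := r - 1) (k := r - 1) (by omega) le_rfl (m - (r - 1))
    rw [Nat.choose_self, show r - 1 + (m - (r - 1)) = m by omega] at this
    obtain ⟨u, rfl⟩ : ∃ u, m = r + u := ⟨m - r, by omega⟩
    rw [show r + u - (r - 1) = u + 1 by omega, show r - 1 + 1 = r by omega] at this
    have hu0 : u = 0 := by
      by_contra h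
      have : (u + 1) * r ≤ 2 * u + r := by omega
      have := Nat.mul_le_mul_left u hr
      have := Nat.pos_of_ne_zero h
      nlinarith
    subst hu0
    omega
  obtain ⟨rfl, hA3⟩ := hrm'
  set T₁ := (Finset.range N).filter (fun i => w i ∈ h₁) with hT₁
  set T₂ := (Finset.range N).filter (fun i => w i ∈ h₂) with hT₂
  have hTne : T₁ ≠ T₂ := fun h => hne (eq_of_mem_iff_positions (hcov h₁ hh₁) (hcov h₂ hh₂) h)
  have hsub : ∀ D : Finset ℕ, D.card = r - 1 → r ≤ (T₁ ∩ D).card + 1 → r ≤ (T₂ ∩ D).card + 1 →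
      D = T₁ ∩ T₂ := by
    intro D hD h1 h2
    have h3 : T₁ ∩ D = D := Finset.eq_of_subset_of_card_le Finset.inter_subset_right (by omega)
    have h4 : T₂ ∩ D = D := Finset.eq_of_subset_of_card_le Finset.inter_subset_right (by omega)
    apply Finset.eq_of_subset_of_card_le
    · intro i hi
      rw [Finset.mem_inter]
      exact ⟨(Finset.mem_inter.1 (h3.symm ▸ hi)).1, (Finset.mem_inter.1 (h4.symm ▸ hi)).1⟩
    · by_contra hlt
      have h5 : T₁ ∩ T₂ = T₁ :=
        Finset.eq_of_subset_of_card_le Finset.inter_subset_left (by rw [hT h₁ hh₁]; omega)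
      have h6 : T₁ ∩ T₂ = T₂ :=
        Finset.eq_of_subset_of_card_le Finset.inter_subset_right (by rw [hT h₂ hh₂]; omega)
      exact hTne (h5.symm.trans h6)
  have hCC : C = C' := (hsub C (by omega) (hTC _ hh₁) (hTC _ hh₂)).trans
    (hsub C' (by omega) (hTC' _ hh₁) (hTC' _ hh₂)).symm
  have hall : ∀ i, i < N → i ∈ C := by
    intro i
    induction i with
    | zero =>
      intro hi
      rw [hCC, hC', Finset.mem_sdiff, Finset.mem_range]
      exact ⟨hi, by simp⟩
    | succ i ih =>
      intro hi
      have := ih (by omega)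
      rw [hC, Finset.mem_sdiff] at this
      rw [hCC, hC', Finset.mem_sdiff, Finset.mem_range]
      refine ⟨hi, ?_⟩
      simpa using this.2
  have : A = ∅ := by
    rw [Finset.eq_empty_iff_forall_notMem]
    intro i hi
    have := hall i (Finset.mem_range.1 (hAsub hi))
    rw [hC, Finset.mem_sdiff] at this
    exact this.2 hi
  rw [this] at hA3
  simp at hA3
  omega

end FreeExclude

section FreeSmall

variable {V : Type*} {E : Finset (Finset V)} {a b : V}
  {w : ℕ → V} {e : ℕ → Finset V} {x : V} {f h : Finset V}

theorem PartialPath.ends_mem_of_six [Fintype V] (hn : Fintype.card V = 7)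
    (hu : ∀ g ∈ E, g.card = 3) (hN : NoPath E a b 7)
    (hP : PartialPath E a b 6 w e (fun _ => False)) (hx : ∀ i, i < 6 → w i ≠ x)
    (h1 : x ∈ e 1) (h2 : x ∈ e 2) (h3 : x ∈ e 3) (hf : Spare E 6 e (fun _ => False) f)
    (hxf : x ∈ f) (hwf : w 0 ∈ f) (hh : Spare E 6 e (fun _ => False) h) (hxh : x ∉ h) :
    w 0 ∈ h ∧ w 5 ∈ h := by
  classical
  have n12 := PartialPath.not_mem_two_used hN hP hx hh (i := 1) (l := 2) (by omega) (by omega)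
    (by omega) h1 h2
  have n13 := PartialPath.not_mem_two_used hN hP hx hh (i := 1) (l := 3) (by omega) (by omega)
    (by omega) h1 h3
  have n23 := PartialPath.not_mem_two_used hN hP hx hh (i := 2) (l := 3) (by omega) (by omega)
    (by omega) h2 h3
  have n14 : ¬ (w 1 ∈ h ∧ w 4 ∈ h) := by
    rintro ⟨h4, h5⟩
    exact hf.2 3 (by omega) id (PartialPath.not_cross_insert' hN hP hx (α := 0) (β := 3)
      (by omega) (by omega) (by omega) (hh.of_unused _) (hf.of_unused _)
      (hP.spare_of_used (by omega) (Or.inr rfl)) h4 h5 hxf hwf h3 (hP.left 3 (by omega) id)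
      (by rintro rfl; exact hxh hxf) (by rintro rfl; exact hxh h3)).symm
  have hc := hP.card_positions (S := h)
    (fun z hz => hP.exists_eq_of_ne hn hx (by rintro rfl; exact hxh hz))
  rw [hu h hh.1] at hc
  simp only [Finset.card_filter, Finset.sum_range_succ, Finset.sum_range_zero] at hc
  norm_num at n12 n13 n23
  by_cases k0 : w 0 ∈ h <;> by_cases k1 : w 1 ∈ h <;> by_cases k2 : w 2 ∈ h <;>
    by_cases k3 : w 3 ∈ h <;> by_cases k4 : w 4 ∈ h <;> by_cases k5 : w 5 ∈ h <;>
    simp_all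

/-- The exceptional configuration on seven vertices does not occur. -/
theorem PartialPath.not_exceptional [Fintype V] [DecidableEq V] (hn : Fintype.card V = 7)
    (hu : ∀ g ∈ E, g.card = 3) (hdeg : ∀ z, 4 ≤ degree E z) (hN : NoPath E a b 7)
    (hP : PartialPath E a b 6 w e (fun _ => False)) (hx : ∀ i, i < 6 → w i ≠ x)
    (hA : (usedAt 6 e (fun _ => False) x).card = 3)
    (hX : (nbr E 6 e (fun _ => False) x).card = 2)
    (hd : (unusedAt E 6 e (fun _ => False) x).card = 1)
    (hL : (leftIn 6 w (nbr E 6 e (fun _ => False) x)).card = 1)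
    (hR : (rightIn 6 w (nbr E 6 e (fun _ => False) x)).card = 1) : False := by
  classical
  have hcov : ∀ z ∈ nbr E 6 e (fun _ => False) x, ∃ i, i < 6 ∧ w i = z :=
    fun z hz => hP.exists_eq_of_ne hn hx (mem_nbr.1 hz).1
  have h5 : w 5 ∈ nbr E 6 e (fun _ => False) x := by
    by_contra h
    have := hP.card_leftIn (by omega) hcov
    simp [h] at this
    omega
  have h0 : w 0 ∈ nbr E 6 e (fun _ => False) x := by
    by_contra h
    have := hP.card_rightIn (by omega) hcov
    simp [h] at this
    omega
  have hAeq : usedAt 6 e (fun _ => False) x = {1, 2, 3} := by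
    apply Finset.eq_of_subset_of_card_le
    · intro i hi
      rw [mem_usedAt] at hi
      have k0 : i ≠ 0 := by
        rintro rfl; exact PartialPath.not_mem_nbr_left hN hP hx hi.1 hi.2.2 h0
      have k4 : i ≠ 4 := by
        rintro rfl; exact PartialPath.not_mem_nbr_right hN hP hx hi.1 hi.2.2 h5
      simp only [Finset.mem_insert, Finset.mem_singleton]
      omega
    · rw [hA]; rfl
  have hxe : ∀ i ∈ ({1, 2, 3} : Finset ℕ), x ∈ e i := by
    intro i hi
    rw [← hAeq] at hi
    exact (mem_usedAt.1 hi).2.2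
  have hx0 : x ∉ e 0 := by
    intro h
    have : 0 ∈ usedAt 6 e (fun _ => False) x := mem_usedAt.2 ⟨by omega, id, h⟩
    rw [hAeq] at this
    simp at this
  obtain ⟨-, f, hf, hxf, hwf⟩ := mem_nbr.1 h0
  have hE := card_mul_le_of_degree hu hdeg
  have hE2 := card_le_labels_add (E := E) (N := 6) (e := e) (U := fun _ => False)
  rw [hn] at hE
  set S := (E.filter (fun g => Spare E 6 e (fun _ => False) g)) \
    unusedAt E 6 e (fun _ => False) x with hS
  have hS4 : 4 ≤ S.card := by
    have : _ ≤ S.card := Finset.le_card_sdiff (unusedAt E 6 e (fun _ => False) x)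
      (E.filter (fun g => Spare E 6 e (fun _ => False) g))
    omega
  have hmS : ∀ h ∈ S, Spare E 6 e (fun _ => False) h ∧ x ∉ h := by
    intro h hh
    rw [hS, Finset.mem_sdiff, Finset.mem_filter, mem_unusedAt] at hh
    tauto
  have hends : ∀ h ∈ S, w 0 ∈ h ∧ w 5 ∈ h := fun h hh =>
    PartialPath.ends_mem_of_six hn hu hN hP hx (hxe 1 (by simp)) (hxe 2 (by simp))
      (hxe 3 (by simp)) hf hxf hwf (hmS h hh).1 (hmS h hh).2
  have hw : ∀ i j, i < 6 → j < 6 → i ≠ j → w i ≠ w j := fun i j hi hj hij h =>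
    hij (hP.inj i j hi hj h)
  have htri : ∀ h : Finset V, h.card = 3 → ∀ i, 0 < i → i < 5 → w 0 ∈ h → w 5 ∈ h → w i ∈ h →
      h = {w 0, w 5, w i} := by
    intro h hc i hi hi' k0 k5 ki
    symm
    apply Finset.eq_of_subset_of_card_le
    · intro z hz
      simp only [Finset.mem_insert, Finset.mem_singleton] at hz
      rcases hz with rfl | rfl | rfl <;> assumption
    · rw [hc, Finset.card_eq_three.2 ⟨w 0, w 5, w i, hw _ _ (by omega) (by omega) (by omega),
        hw _ _ (by omega) (by omega) (by omega), hw _ _ (by omega) (by omega) (by omega), rfl⟩]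
  obtain ⟨h, hhS, h1⟩ : ∃ h ∈ S, w 1 ∈ h := by
    by_contra hcon
    push Not at hcon
    have : S ⊆ ({2, 3, 4} : Finset ℕ).image (fun i => ({w 0, w 5, w i} : Finset V)) := by
      intro h hh
      have hk := hends h hh
      have hc := hu h (hmS h hh).1.1
      obtain ⟨z, hz, hzne⟩ := Finset.exists_mem_notMem_of_card_lt_card
        (s := ({w 0, w 5} : Finset V)) (t := h)
        (by rw [hc]; exact Finset.card_le_two.trans_lt (by omega))
      obtain ⟨i, hi, rfl⟩ := hP.exists_eq_of_ne hn hx (z := z)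
        (by rintro rfl; exact (hmS h hh).2 hz)
      have i0 : i ≠ 0 := by rintro rfl; simp at hzne
      have i5 : i ≠ 5 := by rintro rfl; simp at hzne
      have i1 : i ≠ 1 := by rintro rfl; exact hcon h hh hz
      refine Finset.mem_image.2 ⟨i, ?_, (htri h hc i (by omega) (by omega) hk.1 hk.2 hz).symm⟩
      simp only [Finset.mem_insert, Finset.mem_singleton]
      omega
    have h3 := (Finset.card_le_card this).trans Finset.card_image_le
    have h4 : ({2, 3, 4} : Finset ℕ).card = 3 := rfl
    omega
  obtain ⟨hh, hxh⟩ := hmS h hhS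
  have hk := hends h hhS
  have hP' := hP.assign (i := 0) (U' := fun _ => False) hh hk.1 h1 (fun _ _ _ => Or.inl id)
  have hne0 := hh.2 0 (by omega) id
  have hs0 : Spare E 6 (Function.update e 0 h) (fun _ => False) (e 0) := by
    refine ⟨hP.mem 0 (by omega) id, fun t ht _ heq => ?_⟩
    rcases eq_or_ne t 0 with rfl | ht0
    · simp only [Function.update_self] at heq
      exact hne0 heq.symm
    · rw [Function.update_of_ne ht0] at heq
      exact ht0 (hP.einj t 0 ht (by omega) id id heq)
  have hk' := PartialPath.ends_mem_of_six hn hu hN hP' hx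
    (by simpa using hxe 1 (by simp)) (by simpa using hxe 2 (by simp))
    (by simpa using hxe 3 (by simp))
    (hf.assign (by rintro rfl; exact hxh hxf) (fun _ _ _ => Or.inl id)) hxf hwf hs0 hx0
  apply hne0
  rw [htri h (hu h hh.1) 1 (by omega) (by omega) hk.1 hk.2 h1]
  exact htri (e 0) (hu _ hs0.1) 1 (by omega) (by omega) hk'.1 hk'.2 (hP.right 0 (by omega) id)

end FreeSmall

section FreeVertexFinal

variable {V : Type*} [Fintype V] [DecidableEq V] {E : Finset (Finset V)} {a b : V} {N m r : ℕ}

/-- Every label not covered by an edge at the free vertex `x` has an end in the neighbourhood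
of `x`. -/
theorem PartialPath.mem_nbr_or (hn : Fintype.card V = N + 1)
    (hm : m = (N + 1) / 2) (hr : 3 ≤ r) (hrm : r ≤ m) (hu : ∀ g ∈ E, g.card = r)
    (hdeg : ∀ z, m.choose (r - 1) + 1 ≤ degree E z) (hN : NoPath E a b (N + 1)) :
    ∀ D : ℕ, ∀ (w : ℕ → V) (e : ℕ → Finset V) (x : V),
      PartialPath E a b N w e (fun _ => False) → (∀ i, i < N → w i ≠ x) →
      (unusedAt E N e (fun _ => False) x).card = D → ∀ l, l + 1 < N → x ∉ e l →
      w l ∈ nbr E N e (fun _ => False) x ∨ w (l + 1) ∈ nbr E N e (fun _ => False) x := by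
  intro D
  induction D using Nat.strong_induction_on with
  | _ D ih =>
    intro w e x hP hx hD l hl hxl
    by_cases hgood : ∀ i, i + 1 < N → w i ∈ nbr E N e (fun _ => False) x →
        w (i + 1) ∉ nbr E N e (fun _ => False) x
    · rcases hP.free_cases hn hm hr hrm hu (hdeg x) hN hx hgood with
        h | ⟨h1, h2, h3, h4, h5, h6⟩ | ⟨rfl, rfl, rfl, h2, h3, h4, h5, h6⟩
      · exact absurd h (hP.unusedAt_ne_zero hn hm hr hrm hu hdeg hN hx)
      · obtain ⟨hc1, hc2⟩ := PartialPath.free_count hN (by omega) hP hx hgood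
        have := Finset.eq_of_subset_of_card_le hc1 (by rw [Finset.card_range]; omega)
        have hl' : l ∈ Finset.range (N - 1) := by rw [Finset.mem_range]; omega
        rw [← this, Finset.mem_union, Finset.mem_union, mem_usedAt, mem_leftIn, mem_rightIn] at hl'
        tauto
      · exact (PartialPath.not_exceptional hn hu hdeg hN hP hx (by omega) (by omega) (by omega)
          (by omega) (by omega)).elim
    · push Not at hgood
      obtain ⟨i, hi, h1, h2⟩ := hgood
      rcases eq_or_ne i l with rfl | hil
      · exact Or.inl h1
      · obtain ⟨f, hP', hss⟩ := PartialPath.exists_swap hN hP hx hi h1 h2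
        have hsub := nbr_subset_of_unusedAt_subset hss.subset
        exact (ih _ (hD ▸ Finset.card_lt_card hss) w _ x hP' hx rfl l hl
          (by rwa [Function.update_of_ne hil.symm])).imp (@hsub _) (@hsub _)

/-- If all `r`-sets formed by `x` and its neighbours are unused edges, two neighbours can be
separated by such an edge. -/
theorem exists_unused_separating {e : ℕ → Finset V} {U : ℕ → Prop} {x p q : V}
    (hr : 3 ≤ r) (hu : ∀ g ∈ E, g.card = r)
    (hX : (nbr E N e U x).card = m) (hrm : r ≤ m)
    (hd : (unusedAt E N e U x).card = m.choose (r - 1))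
    (hp : p ∈ nbr E N e U x) (hq : q ∈ nbr E N e U x) (hpq : p ≠ q) :
    ∃ g, Spare E N e U g ∧ x ∈ g ∧ p ∈ g ∧ q ∉ g := by
  have hxX : x ∉ nbr E N e U x := fun h => (mem_nbr.1 h).1 rfl
  obtain ⟨S, hS1, hS2, hS3⟩ := Finset.exists_subsuperset_card_eq (s := {p})
    (t := (nbr E N e U x).erase q) (n := r - 1)
    (by simpa using ⟨hpq, hp⟩) (by rw [Finset.card_singleton]; omega)
    (by rw [Finset.card_erase_of_mem hq]; omega)
  have hxS : x ∉ S := fun h => hxX (Finset.mem_of_mem_erase (hS2 h))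
  refine ⟨Insert.insert x S, spare_of_card_unusedAt hu (by rw [hX, hd])
    (Finset.mem_insert_self _ _) (by rw [Finset.card_insert_of_notMem hxS]; omega) ?_,
    Finset.mem_insert_self _ _, Finset.mem_insert_of_mem (hS1 (Finset.mem_singleton_self _)), ?_⟩
  · intro w hw hwx
    exact Finset.mem_of_mem_erase (hS2 ((Finset.mem_insert.1 hw).resolve_left hwx))
  · intro h
    rcases Finset.mem_insert.1 h with rfl | h
    · exact hxX hq
    · exact Finset.notMem_erase _ _ (hS2 h)

/-- The extremal configuration at a free vertex does not occur. -/
theorem PartialPath.not_full {w : ℕ → V} {e : ℕ → Finset V} {x : V}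
    (hn : Fintype.card V = N + 1) (hm : m = (N + 1) / 2) (hr : 3 ≤ r) (hrm : r ≤ m)
    (hu : ∀ g ∈ E, g.card = r) (hdeg : ∀ z, m.choose (r - 1) + 1 ≤ degree E z)
    (hN : NoPath E a b (N + 1)) (hP : PartialPath E a b N w e (fun _ => False))
    (hx : ∀ i, i < N → w i ≠ x) (hNm : N = 2 * m)
    (hA : (usedAt N e (fun _ => False) x).card = 1)
    (hX : (nbr E N e (fun _ => False) x).card = m)
    (hd : (unusedAt E N e (fun _ => False) x).card = m.choose (r - 1))
    (hL : (leftIn N w (nbr E N e (fun _ => False) x)).card = m - 1)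
    (hR : (rightIn N w (nbr E N e (fun _ => False) x)).card = m - 1) : False := by
  have htouch := PartialPath.mem_nbr_or hn hm hr hrm hu hdeg hN
  have hcov : ∀ z ∈ nbr E N e (fun _ => False) x, ∃ i, i < N ∧ w i = z :=
    fun z hz => hP.exists_eq_of_ne hn hx (mem_nbr.1 hz).1
  have hlast : w (N - 1) ∈ nbr E N e (fun _ => False) x := by
    by_contra h
    have := hP.card_leftIn (by omega) hcov
    simp [h] at this
    omega
  have hfirst : w 0 ∈ nbr E N e (fun _ => False) x := by
    by_contra h
    have := hP.card_rightIn (by omega) hcov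
    simp [h] at this
    omega
  obtain ⟨l, hl⟩ := Finset.card_eq_one.1 hA
  have hl' : l ∈ usedAt N e (fun _ => False) x := by rw [hl]; exact Finset.mem_singleton_self _
  obtain ⟨hlN, -, hxl⟩ := mem_usedAt.1 hl'
  have hlu : ∀ i, i + 1 < N → x ∈ e i → i = l := by
    intro i hi hxi
    have : i ∈ usedAt N e (fun _ => False) x := mem_usedAt.2 ⟨hi, id, hxi⟩
    rw [hl] at this
    exact Finset.mem_singleton.1 this
  have hwl := PartialPath.not_mem_nbr_left hN hP hx hlN hxl
  have hwl' := PartialPath.not_mem_nbr_right hN hP hx hlN hxl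
  have htX : ∀ i, i + 1 < N → i ≠ l → w i ∈ nbr E N e (fun _ => False) x ∨
      w (i + 1) ∈ nbr E N e (fun _ => False) x := fun i hi hil =>
    htouch _ w e x hP hx rfl i hi (fun h => hil (hlu i hi h))
  have hl0 : l ≠ 0 := by rintro rfl; exact hwl hfirst
  have hl1 : l + 1 ≠ N - 1 := fun h => hwl' (h ▸ hlast)
  have hsep : ∀ p q, p ∈ nbr E N e (fun _ => False) x → q ∈ nbr E N e (fun _ => False) x →
      p ≠ q → ∃ g, Spare E N e (fun _ => False) g ∧ x ∈ g ∧ p ∈ g ∧ q ∉ g :=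
    fun p q hp hq hpq => exists_unused_separating hr hu hX hrm hd hp hq hpq
  have hpair : ∀ p q, p ∈ nbr E N e (fun _ => False) x → q ∈ nbr E N e (fun _ => False) x →
      p ≠ q → ∃ g g', Spare E N e (fun _ => False) g ∧ Spare E N e (fun _ => False) g' ∧ x ∈ g ∧
        x ∈ g' ∧ p ∈ g ∧ q ∈ g' ∧ g ≠ g' := by
    intro p q hp hq hpq
    obtain ⟨g, h1, h2, h3, h4⟩ := hsep p q hp hq hpq
    obtain ⟨g', h5, h6, h7, h8⟩ := hsep q p hq hp hpq.symm
    exact ⟨g, g', h1, h5, h2, h6, h3, h7, fun h => h4 (h ▸ h7)⟩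
  -- a vertex of the path outside the neighbourhood of `x` and outside `e l`
  obtain ⟨z, hzX, hzl⟩ : ∃ z, z ∈ (nbr E N e (fun _ => False) x)ᶜ ∧ z ∉ e l := by
    by_contra hcon
    push Not at hcon
    have h1 := Finset.card_le_card (show (nbr E N e (fun _ => False) x)ᶜ ⊆ e l from hcon)
    rw [Finset.card_compl, hu _ (hP.mem l hlN id), hn, hX] at h1
    omega
  rw [Finset.mem_compl] at hzX
  obtain ⟨j, hj, rfl⟩ := hP.exists_eq_of_ne hn hx (z := z) (by rintro rfl; exact hzl hxl)
  have hjl : j ≠ l := by rintro rfl; exact hzl (hP.left j hlN id)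
  have hjl' : j ≠ l + 1 := by rintro rfl; exact hzl (hP.right l hlN id)
  have hj0 : j ≠ 0 := by rintro rfl; exact hzX hfirst
  have hj1 : j ≠ N - 1 := by rintro rfl; exact hzX hlast
  obtain ⟨i, rfl⟩ : ∃ i, j = i + 1 := ⟨j - 1, by omega⟩
  have hwi : w i ∈ nbr E N e (fun _ => False) x := (htX i hj (by omega)).resolve_right hzX
  have hwi' : w (i + 1 + 1) ∈ nbr E N e (fun _ => False) x :=
    (htX (i + 1) (by omega) hjl).resolve_left hzX
  have hwlm : w (l - 1) ∈ nbr E N e (fun _ => False) x :=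
    (htX (l - 1) (by omega) (by omega)).resolve_right
      (by rwa [show l - 1 + 1 = l by omega])
  have hwlp : w (l + 1 + 1) ∈ nbr E N e (fun _ => False) x :=
    (htX (l + 1) (by omega) (by omega)).resolve_left hwl'
  have hwne : ∀ s t, s < N → t < N → s ≠ t → w s ≠ w t := fun s t hs ht hst h =>
    hst (hP.inj s t hs ht h)
  obtain ⟨g₁, g₂, hg₁, hg₂, hx₁, hx₂, hw₁, hw₂, hg⟩ := hpair _ _ hwi hwi'
    (hwne _ _ (by omega) (by omega) (by omega))
  have hP1 : PartialPath E a b N (Function.update w (i + 1) x) e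
      (fun t => t = i ∨ t = i + 1) :=
    (hP.mono (U' := fun t => t = i ∨ t = i + 1) (fun _ _ _ => id)).replace (j := i) (by omega) hx
      (Or.inl rfl) (Or.inr rfl)
  have hP2 := hP1.assign (i := i) (U' := fun t => t = i + 1) (hg₁.of_unused _)
    (by rwa [Function.update_of_ne (by omega)]) (by rwa [Function.update_self])
    (by intro t _ h; tauto)
  have hP3 := hP2.assign (i := i + 1) (U' := fun _ => False)
    ((hg₂.of_unused (fun t => t = i ∨ t = i + 1)).assign hg.symm
      (by intro t _ h; tauto))
    (by rwa [Function.update_self]) (by rwa [Function.update_of_ne (by omega)])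
    (by intro t _ h; tauto)
  have htl := htouch _ _ _ (w (i + 1)) hP3
    (by
      intro t ht
      rcases eq_or_ne t (i + 1) with rfl | hti
      · rw [Function.update_self]; exact (hx _ hj).symm
      · rw [Function.update_of_ne hti]; exact hwne _ _ ht hj hti) rfl l hlN
    (by rwa [Function.update_of_ne hjl.symm, Function.update_of_ne (by omega)])
  rw [Function.update_of_ne hjl.symm, Function.update_of_ne (by omega)] at htl
  have hSp : ∀ f, Spare E N (Function.update (Function.update e i g₁) (i + 1) g₂)
      (fun _ => False) f → f ≠ g₁ ∧ f ≠ g₂ ∧ f ∈ E ∧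
        ∀ t, t + 1 < N → t ≠ i → t ≠ i + 1 → e t ≠ f := by
    intro f hf
    refine ⟨?_, ?_, hf.1, ?_⟩
    · have := hf.2 i (by omega) id
      rw [Function.update_of_ne (by omega), Function.update_self] at this
      exact this.symm
    · have := hf.2 (i + 1) (by omega) id
      rw [Function.update_self] at this
      exact this.symm
    · intro t ht h1 h2
      have := hf.2 t ht id
      rwa [Function.update_of_ne h2, Function.update_of_ne h1] at this
  rcases htl with htl | htl
  · obtain ⟨-, f, hf, hf1, hf2⟩ := mem_nbr.1 htl
    obtain ⟨k1, k2, k3, k4⟩ := hSp f hf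
    by_cases hfi : e i = f
    · obtain ⟨g, g', hg, hg', hxg, hxg', hwg, hwg', hgg⟩ := hpair _ _ hwi hwlm
        (hwne _ _ (by omega) (by omega) (by omega))
      refine hgg (PartialPath.not_cross_insert' hN hP hx (α := i) (β := l - 1) (h := f) (by omega)
        (by omega) (by omega) (hfi ▸ hP.spare_of_used (by omega) (Or.inl rfl)) (hg.of_unused _)
        (hg'.of_unused _) hf1 (by rwa [show l - 1 + 1 = l by omega]) hxg hwg hxg' hwg' ?_ ?_)
      · exact hfi ▸ hg.2 i (by omega) id
      · exact hfi ▸ hg'.2 i (by omega) id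
    · refine hg₂.2 l hlN id (PartialPath.not_cross_insert hN hP hx (α := i + 1) (β := l) (h := f)
        (by omega) hlN hjl ⟨k3, ?_⟩ (hg₂.of_unused _) (hP.spare_of_used hlN (Or.inr rfl)) hf1 hf2
        hx₂ hw₂ hxl (hP.right l hlN id) k2 (k4 l hlN (by omega) hjl.symm).symm).symm
      intro t ht h
      rcases eq_or_ne t i with rfl | hti
      · exact hfi
      · exact k4 t ht hti (by tauto)
  · obtain ⟨-, f, hf, hf1, hf2⟩ := mem_nbr.1 htl
    obtain ⟨k1, k2, k3, k4⟩ := hSp f hf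
    by_cases hfi : e (i + 1) = f
    · obtain ⟨g, g', hg, hg', hxg, hxg', hwg, hwg', hgg⟩ := hpair _ _ hwi' hwlp
        (hwne _ _ (by omega) (by omega) (by omega))
      refine hgg (PartialPath.not_cross_insert hN hP hx (α := i + 1) (β := l + 1) (h := f)
        (by omega)
        (by omega) (by omega) (hfi ▸ hP.spare_of_used (by omega) (Or.inl rfl)) (hg.of_unused _)
        (hg'.of_unused _) hf1 hf2 hxg hwg hxg' hwg' ?_ ?_)
      · exact hfi ▸ hg.2 (i + 1) (by omega) id
      · exact hfi ▸ hg'.2 (i + 1) (by omega) id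
    · refine hg₁.2 l hlN id (PartialPath.not_cross_insert' hN hP hx (α := i) (β := l) (h := f)
        (by omega) hlN (by omega) ⟨k3, ?_⟩ (hg₁.of_unused _) (hP.spare_of_used hlN (Or.inr rfl))
        hf1 hf2 hx₁ hw₁ hxl (hP.left l hlN id) k1 (k4 l hlN (by omega) hjl.symm).symm).symm
      intro t ht h
      rcases eq_or_ne t (i + 1) with rfl | hti
      · exact hfi
      · exact k4 t ht (by tauto) hti

/-- A hypergraph of large minimum degree with a path through all but one vertex has a path through
all vertices. -/
theorem NoPath.pred (hn : Fintype.card V = N + 1) (hm : m = (N + 1) / 2) (hr : 3 ≤ r)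
    (hrm : r ≤ m) (hu : ∀ g ∈ E, g.card = r) (hdeg : ∀ z, m.choose (r - 1) + 1 ≤ degree E z)
    (hN : NoPath E a b (N + 1)) : NoPath E a b N := by
  suffices H : ∀ D : ℕ, ∀ (w : ℕ → V) (e : ℕ → Finset V) (x : V),
      PartialPath E a b N w e (fun _ => False) → (∀ i, i < N → w i ≠ x) →
      (unusedAt E N e (fun _ => False) x).card = D → False by
    intro w e hP
    obtain ⟨x, hx⟩ : ∃ x, x ∉ (Finset.range N).image w := by
      by_contra hcon
      push Not at hcon
      have h1 := Finset.card_le_card (show Finset.univ ⊆ (Finset.range N).image w from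
        fun z _ => hcon z)
      have h2 : ((Finset.range N).image w).card ≤ N := by
        simpa using Finset.card_image_le (s := Finset.range N) (f := w)
      rw [Finset.card_univ, hn] at h1
      omega
    exact H _ w e x hP (fun i hi h => hx (Finset.mem_image.2 ⟨i, Finset.mem_range.2 hi, h⟩)) rfl
  intro D
  induction D using Nat.strong_induction_on with
  | _ D ih =>
    intro w e x hP hx hD
    by_cases hgood : ∀ i, i + 1 < N → w i ∈ nbr E N e (fun _ => False) x →
        w (i + 1) ∉ nbr E N e (fun _ => False) x
    · rcases hP.free_cases hn hm hr hrm hu (hdeg x) hN hx hgood with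
        h | ⟨h1, h2, h3, h4, h5, h6⟩ | ⟨rfl, rfl, rfl, h2, h3, h4, h5, h6⟩
      · exact hP.unusedAt_ne_zero hn hm hr hrm hu hdeg hN hx h
      · exact hP.not_full hn hm hr hrm hu hdeg hN hx h1 h2 h3 h4 h5 h6
      · exact PartialPath.not_exceptional hn hu hdeg hN hP hx (by omega) (by omega) (by omega)
          (by omega) (by omega)
    · push Not at hgood
      obtain ⟨i, hi, h1, h2⟩ := hgood
      obtain ⟨f, hP', hss⟩ := PartialPath.exists_swap hN hP hx hi h1 h2
      exact ih _ (hD ▸ Finset.card_lt_card hss) w _ x hP' hx rfl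

end FreeVertexFinal

section Counting

/-- Two sets of labels, one of whose elements are never followed by an element of the other. -/
theorem card_inter_Ico_add_le {A B : Finset ℕ} {s : ℕ} (q : ℕ)
    (h : ∀ j, s ≤ j → j + 1 < s + q → j ∈ A → j + 1 ∉ B) :
    (A ∩ Finset.Ico s (s + q)).card + (B ∩ Finset.Ico s (s + q)).card ≤ q + 1 := by
  rcases Nat.eq_zero_or_pos q with rfl | hq
  · simp
  have h1 : (A ∩ Finset.Ico s (s + q)).card ≤
      (((A ∩ Finset.Ico s (s + q - 1)).image (· + 1))).card + 1 := by
    rw [Finset.card_image_of_injective _ (add_left_injective 1)]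
    have : A ∩ Finset.Ico s (s + q) ⊆ Insert.insert (s + q - 1) (A ∩ Finset.Ico s (s + q - 1)) := by
      intro i hi
      simp only [Finset.mem_inter, Finset.mem_Ico, Finset.mem_insert] at hi ⊢
      by_cases h : i = s + q - 1
      · exact Or.inl h
      · exact Or.inr ⟨hi.1, by omega⟩
    exact (Finset.card_le_card this).trans (Finset.card_insert_le _ _)
  have h2 : (B ∩ Finset.Ico s (s + q)).card ≤ (B ∩ Finset.Ico (s + 1) (s + q)).card + 1 := by
    have : B ∩ Finset.Ico s (s + q) ⊆ Insert.insert s (B ∩ Finset.Ico (s + 1) (s + q)) := by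
      intro i hi
      simp only [Finset.mem_inter, Finset.mem_Ico, Finset.mem_insert] at hi ⊢
      by_cases h : i = s
      · exact Or.inl h
      · exact Or.inr ⟨hi.1, by omega⟩
    exact (Finset.card_le_card this).trans (Finset.card_insert_le _ _)
  have hd : Disjoint ((A ∩ Finset.Ico s (s + q - 1)).image (· + 1))
      (B ∩ Finset.Ico (s + 1) (s + q)) := by
    rw [Finset.disjoint_left]
    intro i hi hi'
    obtain ⟨j, hj, rfl⟩ := Finset.mem_image.1 hi
    rw [Finset.mem_inter, Finset.mem_Ico] at hj hi'
    exact h j hj.2.1 (by omega) hj.1 hi'.1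
  have h3 : ((A ∩ Finset.Ico s (s + q - 1)).image (· + 1)) ∪ (B ∩ Finset.Ico (s + 1) (s + q)) ⊆
      Finset.Ico (s + 1) (s + q) := by
    intro i hi
    rw [Finset.mem_union] at hi
    rcases hi with hi | hi
    · obtain ⟨j, hj, rfl⟩ := Finset.mem_image.1 hi
      rw [Finset.mem_inter, Finset.mem_Ico] at hj
      rw [Finset.mem_Ico]; omega
    · exact (Finset.mem_inter.1 hi).2
  have h4 := Finset.card_le_card h3
  rw [Finset.card_union_of_disjoint hd, Nat.card_Ico] at h4
  omega

/-- Count of two sets of labels avoiding `z`, disjoint outside an interval in which no element of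
the first is followed by an element of the second. -/
theorem card_add_card_le {A B : Finset ℕ} {M s q z : ℕ} (hA : A ⊆ Finset.range M)
    (hB : B ⊆ Finset.range M) (hz : z < M) (hsq : s + q ≤ M) (hzs : z < s ∨ s + q ≤ z)
    (hzA : z ∉ A) (hzB : z ∉ B)
    (h : ∀ j, s ≤ j → j + 1 < s + q → j ∈ A → j + 1 ∉ B)
    (hdis : ∀ i, i < s ∨ s + q ≤ i → i ∈ A → i ∉ B) :
    A.card + B.card ≤ M ∧ (M ≤ A.card + B.card →
      ∀ i, i < M → i < s ∨ s + q ≤ i → i ≠ z → i ∈ A ∨ i ∈ B) := by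
  have hK := card_inter_Ico_add_le q h
  set K := Finset.Ico s (s + q) with hKdef
  have hdj : Disjoint (A \ K) (B \ K) := by
    rw [Finset.disjoint_left]
    intro i h1 h2
    rw [Finset.mem_sdiff, hKdef, Finset.mem_Ico] at h1 h2
    exact hdis i (by omega) h1.1 h2.1
  have hsub : (A \ K) ∪ (B \ K) ⊆ (Finset.range M \ K).erase z := by
    intro i hi
    rw [Finset.mem_erase, Finset.mem_sdiff]
    rw [Finset.mem_union, Finset.mem_sdiff, Finset.mem_sdiff] at hi
    rcases hi with hi | hi
    · exact ⟨by rintro rfl; exact hzA hi.1, hA hi.1, hi.2⟩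
    · exact ⟨by rintro rfl; exact hzB hi.1, hB hi.1, hi.2⟩
  have hc : ((Finset.range M \ K).erase z).card = M - q - 1 := by
    rw [Finset.card_erase_of_mem, Finset.card_sdiff_of_subset, Finset.card_range, hKdef,
      Nat.card_Ico]
    · omega
    · intro i hi; rw [hKdef, Finset.mem_Ico] at hi; rw [Finset.mem_range]; omega
    · rw [Finset.mem_sdiff, Finset.mem_range, hKdef, Finset.mem_Ico]; omega
  have h1 := Finset.card_le_card hsub
  rw [Finset.card_union_of_disjoint hdj, hc] at h1
  have hA' := Finset.card_inter_add_card_sdiff A K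
  have hB' := Finset.card_inter_add_card_sdiff B K
  refine ⟨by omega, fun hM i hi his hiz => ?_⟩
  have heq := Finset.eq_of_subset_of_card_le hsub
    (by rw [Finset.card_union_of_disjoint hdj, hc]; omega)
  have : i ∈ (Finset.range M \ K).erase z := by
    rw [Finset.mem_erase, Finset.mem_sdiff, Finset.mem_range, hKdef, Finset.mem_Ico]; omega
  rw [← heq, Finset.mem_union, Finset.mem_sdiff, Finset.mem_sdiff] at this
  tauto

end Counting

/-- The degree condition for uniformity at most half the number of vertices. -/
structure DenseHypergraph {V : Type*} [Fintype V] [DecidableEq V] (E : Finset (Finset V))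
    (n m r : ℕ) : Prop where
  card_eq : Fintype.card V = n
  half : m = n / 2
  three_le : 3 ≤ r
  le_half : r ≤ m
  unif : ∀ g ∈ E, g.card = r
  deg : ∀ z, m.choose (r - 1) + 1 ≤ degree E z

section DenseHypergraph

variable {V : Type*} {E : Finset (Finset V)} {a b : V} {n m r : ℕ}
  {v : ℕ → V} {e : ℕ → Finset V} {k : ℕ}

theorem jl_subset_range : jl E n v e k ⊆ Finset.range (n - 1) := by
  intro i hi
  have := (mem_jl.1 hi).1
  rw [Finset.mem_range]; omega

theorem jr_subset_range : jr E n v e k ⊆ Finset.range (n - 1) := by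
  intro i hi
  have := (mem_jr.1 hi).1
  rw [Finset.mem_range]; omega

theorem not_mem_jl : k ∉ jl E n v e k := fun h => (mem_jl.1 h).2.1 rfl

theorem not_mem_jr : k ∉ jr E n v e k := fun h => (mem_jr.1 h).2.1 rfl

variable [Fintype V] [DecidableEq V]

theorem DenseHypergraph.noPath_pred (hS : DenseHypergraph E n m r)
    (hN : NoPath E a b n) : NoPath E a b (n - 1) := by
  obtain ⟨h1, h2, h3, h4, h5, h6⟩ := hS
  have : n = n - 1 + 1 := by omega
  rw [this] at h1 h2 hN
  exact NoPath.pred h1 h2 h3 h4 h5 h6 hN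

theorem DenseHypergraph.choose_succ (hS : DenseHypergraph E n m r) :
    m.choose (r - 1) = (m - 1).choose (r - 2) + (m - 1).choose (r - 1) ∧
      m - 1 ≤ (m - 1).choose (r - 2) := by
  have h1 := hS.three_le
  have h2 := hS.le_half
  refine ⟨?_, le_choose (by omega) (by omega)⟩
  obtain ⟨s, rfl⟩ : ∃ s, r = s + 2 := ⟨r - 2, by omega⟩
  obtain ⟨t, rfl⟩ : ∃ t, m = t + 1 := ⟨m - 1, by omega⟩
  exact Nat.choose_succ_succ t s

/-- A vertex lies in many edges of the path or has many neighbours in unused edges. -/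
theorem DenseHypergraph.le_card (hS : DenseHypergraph E n m r)
    {U : ℕ → Prop} (hP : PartialPath E a b n v e U) (z : V) :
    m ≤ (usedAt n e U z).card ∨ m ≤ (nbr E n e U z).card := by
  by_contra hcon
  have h1 := hS.three_le
  have h2 := hS.le_half
  have h3 := hP.degree_eq z
  have h4 := hS.deg z
  have h5 := card_unusedAt_le (N := n) (e := e) (U := U) (z := z) hS.unif
  have h6 := hS.choose_succ
  have h7 : (nbr E n e U z).card.choose (r - 1) ≤ (m - 1).choose (r - 1) :=
    Nat.choose_le_choose _ (by omega)
  omega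

/-- If the neighbourhood of `z` is not too large, some edge of the path at `z` leaves it. -/
theorem DenseHypergraph.exists_outside (hS : DenseHypergraph E n m r) {U : ℕ → Prop} {z : V}
    (hX : (nbr E n e U z).card ≤ m) :
    ∃ i, i + 1 < n ∧ ¬ U i ∧ z ∈ e i ∧ ∃ w ∈ e i, w ≠ z ∧ w ∉ nbr E n e U z := by
  by_contra hcon
  push Not at hcon
  have h : degree E z ≤ ((nbr E n e U z).powersetCard (r - 1)).card := by
    apply Finset.card_le_card_of_injOn (fun g => g.erase z)
    · intro g hg
      obtain ⟨hgE, hzg⟩ := Finset.mem_filter.1 (Finset.mem_coe.1 hg)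
      rw [Finset.mem_coe, Finset.mem_powersetCard]
      refine ⟨fun w hw => ?_, by rw [Finset.card_erase_of_mem hzg, hS.unif g hgE]⟩
      rw [Finset.mem_erase] at hw
      by_cases h : Spare E n e U g
      · exact mem_nbr.2 ⟨hw.1, g, h, hzg, hw.2⟩
      · unfold Spare at h
        push Not at h
        obtain ⟨i, h1, h2, rfl⟩ := h hgE
        exact hcon i h1 h2 hzg w hw.2 hw.1
    · intro g hg h hh heq
      have hg' := (Finset.mem_filter.1 (Finset.mem_coe.1 hg)).2
      have hh' := (Finset.mem_filter.1 (Finset.mem_coe.1 hh)).2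
      have : g.erase z = h.erase z := heq
      rw [← Finset.insert_erase hg', this, Finset.insert_erase hh']
  rw [Finset.card_powersetCard] at h
  have h1 := Nat.choose_le_choose (r - 1) hX
  have h2 := hS.deg z
  omega

theorem DenseHypergraph.exact_left (hS : DenseHypergraph E n m r) (hD : Defect E a b n v e k)
    (h : (jl E n v e k).card ≤ m - 1) :
    (nbr E n e (fun t => t = k) (v k)).card = m ∧ (jl E n v e k).card = m - 1 ∧
      leftIn n v (nbr E n e (fun t => t = k) (v k)) = jl E n v e k ∧
      v (n - 1) ∈ nbr E n e (fun t => t = k) (v k) := by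
  have h1 := hS.three_le
  have h2 := hS.le_half
  have h3 := Finset.card_le_card hD.usedAt_subset_jl
  have h4 := (hS.le_card hD.1 (v k)).resolve_left (by omega)
  obtain ⟨h5, h6⟩ := hD.card_nbr_left hS.card_eq
  have h7 := Finset.card_le_card (Defect.leftIn_subset_jl (E := E) (n := n) (v := v) (e := e)
    (k := k))
  refine ⟨by omega, by omega, Finset.eq_of_subset_of_card_le Defect.leftIn_subset_jl (by omega), ?_⟩
  by_contra hcon
  have := h6 hcon
  omega

theorem DenseHypergraph.le_card_jl (hS : DenseHypergraph E n m r)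
    (hN : NoPath E a b n) (hD : Defect E a b n v e k)
    {i : ℕ} (h1 : JLeft E n v e k i) (h2 : JRight E n v e k i) : m ≤ (jl E n v e k).card := by
  by_contra hcon
  obtain ⟨-, -, h3, -⟩ := hS.exact_left hD (by omega)
  have : i ∈ leftIn n v (nbr E n e (fun t => t = k) (v k)) := by rw [h3]; exact mem_jl.2 h1
  obtain ⟨-, g, hg, h4, h5⟩ := mem_nbr.1 (mem_leftIn.1 this).2
  exact hD.not_jRight_of_spare hN hg h4 h5 h2

theorem DenseHypergraph.le_card_jr (hS : DenseHypergraph E n m r)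
    (hN : NoPath E a b n) (hD : Defect E a b n v e k)
    {i : ℕ} (h1 : JLeft E n v e k i) (h2 : JRight E n v e k i) : m ≤ (jr E n v e k).card := by
  have hk := hD.2
  have hi := h1.1
  rw [← card_jl_mirror hk]
  refine hS.le_card_jl hN.symm hD.mirror (i := n - 2 - i) ?_ ?_
  · rw [jLeft_mirror_iff hk (by omega)]; rwa [show n - 2 - (n - 2 - i) = i by omega]
  · rw [jRight_mirror_iff hk (by omega)]; rwa [show n - 2 - (n - 2 - i) = i by omega]

end DenseHypergraph

/-- A defect both of whose ends lie in the edge covering an earlier label `p`. -/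
def Doubled {V : Type*} (E : Finset (Finset V)) (a b : V) (n : ℕ) (v : ℕ → V) (e : ℕ → Finset V)
    (p k : ℕ) : Prop :=
  Defect E a b n v e k ∧ p < k ∧ v k ∈ e p ∧ v (k + 1) ∈ e p

section Doubled

variable {V : Type*} {E : Finset (Finset V)} {a b : V} {n m r : ℕ}
  {v : ℕ → V} {e : ℕ → Finset V} {p k : ℕ}

theorem Doubled.reverse (hT : Doubled E a b n v e p k) :
    Doubled E a b n (fun t => v (revPos p k t)) (fun t => e (revLab p k t)) p k := by
  obtain ⟨hD, hpk, h1, h2⟩ := hT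
  have hk := hD.2
  have hP : PartialPath E a b n v e (fun t => t = p ∨ t = k) :=
    hD.1.mono (by intro t _ h; tauto)
  have hR := (hP.rev hpk hk (Or.inl rfl) (Or.inr rfl)).assign (i := p) (g := e p)
    (U' := fun t => t = k)
    ((hD.spare (i := p) (by omega) (by omega)).rev hk)
    (by show v (revPos p k p) ∈ e p
        rw [revPos_out (by omega)]
        exact hD.1.left p (by omega) (by omega))
    (by show v (revPos p k (p + 1)) ∈ e p
        rwa [revPos_in (by omega) (by omega), show p + k + 1 - (p + 1) = k by omega])
    (by intro t _ h; unfold revLab; split_ifs <;> omega)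
  have hup : Function.update (fun t => e (revLab p k t)) p (e p) = fun t => e (revLab p k t) := by
    rw [Function.update_eq_self_iff, revLab_out (by omega)]
  rw [hup] at hR
  refine ⟨⟨hR, hk⟩, hpk, ?_, ?_⟩
  · simp only [revLab_out (show p ≤ p ∨ k ≤ p by omega), revPos_in hpk le_rfl]
    rw [show p + k + 1 - k = p + 1 by omega]
    exact hD.1.right p (by omega) (by omega)
  · simp only [revLab_out (show p ≤ p ∨ k ≤ p by omega),
      revPos_out (show k + 1 ≤ p ∨ k < k + 1 by omega)]
    exact h2

theorem Doubled.succ_lt (hF : NoPath E a b (n - 1)) (hT : Doubled E a b n v e p k) :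
    p + 1 < k := by
  obtain ⟨hD, hpk, h1, h2⟩ := hT
  have hk := hD.2
  by_contra hcon
  obtain rfl : k = p + 1 := by omega
  have hP : PartialPath E a b n v e (fun t => t = p ∨ t = p + 1) :=
    hD.1.mono (by intro t _ h; tauto)
  refine hF _ _ ((hP.remove (j := p) (by omega) (Or.inl rfl)).assign (i := p) (g := e p)
    ((hD.spare (i := p) (by omega) (by omega)).remove) ?_ ?_ ?_)
  · simpa using hD.1.left p (by omega) (by omega)
  · simpa using h2
  · intro t _ _; split_ifs <;> omega

theorem Defect.exists_doubled (hN : NoPath E a b n) (hD : Defect E a b n v e k) {i : ℕ}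
    (h1 : JLeft E n v e k i) (h2 : JRight E n v e k i) :
    ∃ v' e' p' k', Doubled E a b n v' e' p' k' := by
  obtain ⟨h3, h4⟩ := hD.mem_of_jLeft_jRight hN h1 h2
  have hi := h1.1
  have hik := h1.2.1
  have hk := hD.2
  rcases lt_or_gt_of_ne hik with hlt | hlt
  · exact ⟨v, e, i, k, hD, hlt, h3, h4⟩
  · refine ⟨v, Function.update e k (e i), k, i, hD.move hi hik h3 h4, hlt, ?_, ?_⟩
    · rw [Function.update_self]; exact hD.1.left i hi hik
    · rw [Function.update_self]; exact hD.1.right i hi hik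

variable [Fintype V] [DecidableEq V]

/-- In an extremal doubled defect no label after `k` is joined to `v (p + 1)`. -/
theorem Doubled.right_of_extremal (hS : DenseHypergraph E n m r) (hN : NoPath E a b n)
    (hT : Doubled E a b n v e p k)
    (hp : ∀ v' e' p' k', Doubled E a b n v' e' p' k' → p ≤ p')
    (hk : ∀ v' e' k', Doubled E a b n v' e' p k' → k' ≤ k) :
    n = 2 * m + 1 ∧ ∀ i, k < i → i + 1 < n → v (p + 1) ∉ e i ∧
      ∀ g, Spare E n e (fun t => t = k) g → v (p + 1) ∈ g → v (i + 1) ∉ g := by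
  have hpk1 := hT.succ_lt (hS.noPath_pred hN)
  obtain ⟨hD, hpk, h1, h2⟩ := hT
  have hkn := hD.2
  have hm := hS.half
  have hD' : Defect E a b n v (Function.update e k (e p)) p :=
    hD.move (by omega) (by omega) h1 h2
  have hek : (Function.update e k (e p)) k = e p := Function.update_self ..
  have hei : ∀ i, i ≠ k → (Function.update e k (e p)) i = e i :=
    fun i hi => Function.update_of_ne hi _ _
  set e₁ := Function.update e k (e p) with he₁
  have hkL : JLeft E n v e₁ p k :=
    hD'.jLeft_of_mem hkn (by omega) (hek ▸ hD.1.left p (by omega) (by omega))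
  have hkR : JRight E n v e₁ p k :=
    hD'.jRight_of_mem hkn (by omega) (hek ▸ hD.1.right p (by omega) (by omega))
  have hF := hS.noPath_pred hN
  obtain ⟨hc1, hc2⟩ := card_add_card_le (A := jl E n v e₁ p) (B := jr E n v e₁ p) (M := n - 1)
    (s := p + 1) (q := k - p) (z := p) jl_subset_range jr_subset_range (by omega) (by omega)
    (by omega) not_mem_jl not_mem_jr
    (fun j _ _ hj hj' => hD'.not_jLeft_jRight_succ hN hF (mem_jl.1 hj) (mem_jr.1 hj'))
    (by
      intro i hi hiA hiB
      rw [mem_jl] at hiA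
      rw [mem_jr] at hiB
      obtain ⟨h3, h4⟩ := hD'.mem_of_jLeft_jRight hN hiA hiB
      have hin := hiA.1
      have hip := hiA.2.1
      rcases lt_or_gt_of_ne hip with hlt | hlt
      · have := hp _ _ _ _ ⟨hD', hlt, h3, h4⟩
        omega
      · have := hk v (Function.update e₁ p (e₁ i)) i ⟨hD'.move hin hip h3 h4, hlt,
          by rw [Function.update_self]; exact hD'.1.left i hin hip,
          by rw [Function.update_self]; exact hD'.1.right i hin hip⟩
        omega)
  have hL := hS.le_card_jl hN hD' hkL hkR
  have hR := hS.le_card_jr hN hD' hkL hkR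
  refine ⟨by omega, ?_⟩
  have hall := hc2 (by omega)
  have hLall : ∀ s, k + s + 1 < n → JLeft E n v e₁ p (k + s) := by
    intro s
    induction s with
    | zero => intro _; exact hkL
    | succ s ih =>
      intro hs
      rcases hall (k + (s + 1)) (by omega) (by omega) (by omega) with h | h
      · exact mem_jl.1 h
      · exact absurd (mem_jr.1 h) (hD'.not_jLeft_jRight_succ hN hF (ih (by omega)))
  intro i hki hi
  have hnR : ¬ JRight E n v e₁ p i := by
    have := hD'.not_jLeft_jRight_succ hN hF (hLall (i - 1 - k) (by omega))
    rwa [show k + (i - 1 - k) + 1 = i by omega] at this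
  refine ⟨fun h => hnR (hD'.jRight_of_mem hi (by omega) (by rwa [hei i (by omega)])), ?_⟩
  intro g hg h3 h4
  exact hnR ⟨hi, by omega, g, (Spare.move (by omega) (by omega) hg).or_left i, h3, h4⟩

/-- The structure around an extremal doubled defect. -/
theorem Doubled.left_of_extremal (hS : DenseHypergraph E n m r) (hN : NoPath E a b n)
    (hT : Doubled E a b n v e p k)
    (hp : ∀ v' e' p' k', Doubled E a b n v' e' p' k' → p ≤ p')
    (hk : ∀ v' e' k', Doubled E a b n v' e' p k' → k' ≤ k) :
    leftIn n v (nbr E n e (fun t => t = k) (v k)) =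
        (usedAt n e (fun t => t = k) (v k)).erase p ∧
      v (n - 1) ∉ nbr E n e (fun t => t = k) (v k) ∧
      (nbr E n e (fun t => t = k) (v k)).card.choose (r - 1) ≤
        (unusedAt E n e (fun t => t = k) (v k)).card := by
  obtain ⟨hn, hright⟩ := hT.reverse.right_of_extremal hS hN hp hk
  have hpk1 := hT.succ_lt (hS.noPath_pred hN)
  obtain ⟨hD, hpk, h1, h2⟩ := hT
  have hkn := hD.2
  have hm := hS.half
  have hr3 := hS.three_le
  have hrm := hS.le_half
  have hF := hS.noPath_pred hN
  have hright' : ∀ i, k < i → i + 1 < n → v k ∉ e i ∧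
      ∀ g, Spare E n e (fun t => t = k) g → v k ∈ g → v (i + 1) ∉ g := by
    intro i hki hi
    have := hright i hki hi
    simp only [revPos_in (show p < p + 1 by omega) (show p + 1 ≤ k by omega),
      revPos_out (show i + 1 ≤ p ∨ k < i + 1 by omega), revLab_out (show i ≤ p ∨ k ≤ i by omega),
      show p + k + 1 - (p + 1) = k by omega] at this
    refine ⟨this.1, fun g hg => this.2 g ((hg.rev hkn).mono ?_)⟩
    intro t _ h; unfold revLab; split_ifs <;> omega
  have hrightN : ∀ t, k < t → t < n → v t ∉ nbr E n e (fun t => t = k) (v k) := by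
    intro t hkt ht hmem
    obtain ⟨-, g, hg, h3, h4⟩ := mem_nbr.1 hmem
    rcases eq_or_ne t (k + 1) with rfl | htk
    · exact hD.not_mem_both hN hg h3 h4
    · refine (hright' (t - 1) (by omega) (by omega)).2 g hg h3 ?_
      rwa [show t - 1 + 1 = t by omega]
  have hrightJ : ∀ i, k < i → ¬ JLeft E n v e k i := by
    rintro i hki ⟨hi, hik, g, hg, h3, h4⟩
    by_cases hgi : e i = g
    · exact (hright' i hki hi).1 (hgi ▸ h3)
    · refine hrightN i hki (by omega) (mem_nbr.2 ⟨
        fun h => hik (hD.1.inj i k (by omega) (by omega) h),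
        g, ⟨hg.1, fun t ht htk => ?_⟩, h3, h4⟩)
      rcases eq_or_ne t i with rfl | hti
      · exact hgi
      · exact hg.2 t ht (by tauto)
  have hpL : JLeft E n v e k p := hD.jLeft_of_mem (by omega) (by omega) h1
  have hpR : JRight E n v e k p := hD.jRight_of_mem (by omega) (by omega) h2
  have hL := hS.le_card_jl hN hD hpL hpR
  have hR := hS.le_card_jr hN hD hpL hpR
  obtain ⟨hc1, hc2⟩ := card_add_card_le (A := jl E n v e k) (B := jr E n v e k) (M := n - 1)
    (s := p) (q := k - p) (z := k) jl_subset_range jr_subset_range (by omega) (by omega)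
    (by omega) not_mem_jl not_mem_jr
    (fun j _ _ hj hj' => hD.not_jLeft_jRight_succ hN hF (mem_jl.1 hj) (mem_jr.1 hj'))
    (by
      intro i hi hiA hiB
      rw [mem_jl] at hiA
      rw [mem_jr] at hiB
      have hik := hiA.2.1
      rcases lt_or_gt_of_ne hik with hlt | hlt
      · obtain ⟨h3, h4⟩ := hD.mem_of_jLeft_jRight hN hiA hiB
        have := hp _ _ _ _ ⟨hD, hlt, h3, h4⟩
        omega
      · exact hrightJ i hlt hiA)
  have hall := hc2 (by omega)
  have hRall : ∀ s, s ≤ p → JRight E n v e k (p - s) := by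
    intro s
    induction s with
    | zero => intro _; exact hpR
    | succ s ih =>
      intro hs
      rcases hall (p - (s + 1)) (by omega) (by omega) (by omega) with h | h
      · refine absurd ?_ (hD.not_jLeft_jRight_succ hN hF (mem_jl.1 h))
        rw [show p - (s + 1) + 1 = p - s by omega]
        exact ih (by omega)
      · exact mem_jr.1 h
  have hleftJ : ∀ i, i < p → ¬ JLeft E n v e k i := by
    intro i hi h
    refine hD.not_jLeft_jRight_succ hN hF h ?_
    have := hRall (p - (i + 1)) (by omega)
    rwa [show p - (p - (i + 1)) = i + 1 by omega] at this
  have hpN : p ∉ leftIn n v (nbr E n e (fun t => t = k) (v k)) := by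
    intro h
    obtain ⟨-, g, hg, h3, h4⟩ := mem_nbr.1 (mem_leftIn.1 h).2
    exact hD.not_jRight_of_spare hN hg h3 h4 hpR
  have hsub : leftIn n v (nbr E n e (fun t => t = k) (v k)) ⊆ (jl E n v e k).erase p := by
    intro i hi
    exact Finset.mem_erase.2 ⟨fun h => hpN (h ▸ hi), Defect.leftIn_subset_jl hi⟩
  have hlast : v (n - 1) ∉ nbr E n e (fun t => t = k) (v k) := hrightN _ (by omega) (by omega)
  have hcN := (hD.card_nbr_left hS.card_eq).2 hlast
  have hcs := Finset.card_le_card hsub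
  rw [Finset.card_erase_of_mem (mem_jl.2 hpL)] at hcs
  have hA := (hS.le_card hD.1 (v k)).resolve_right (by omega)
  have hAJ : usedAt n e (fun t => t = k) (v k) = jl E n v e k :=
    Finset.eq_of_subset_of_card_le hD.usedAt_subset_jl (by omega)
  have hdeg := hD.1.degree_eq (v k)
  have hdeg' := hS.deg (v k)
  have hub := card_unusedAt_le (N := n) (e := e) (U := fun t => t = k) (z := v k) hS.unif
  obtain ⟨hch1, hch2⟩ := hS.choose_succ
  rw [hAJ] at hdeg
  have hNm : (nbr E n e (fun t => t = k) (v k)).card = m - 1 := by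
    by_contra hne
    have h3 : (nbr E n e (fun t => t = k) (v k)).card.choose (r - 1) ≤ (m - 2).choose (r - 1) :=
      Nat.choose_le_choose _ (by omega)
    have h4 : (m - 1).choose (r - 1) = (m - 2).choose (r - 2) + (m - 2).choose (r - 1) := by
      obtain ⟨s, rfl⟩ : ∃ s, r = s + 2 := ⟨r - 2, by omega⟩
      obtain ⟨t, ht⟩ : ∃ t, m = t + 2 := ⟨m - 2, by omega⟩
      rw [ht]
      exact Nat.choose_succ_succ t s
    have h5 : 0 < (m - 2).choose (r - 2) := Nat.choose_pos (by omega)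
    omega
  refine ⟨?_, hlast, by rw [hNm]; omega⟩
  rw [hAJ]
  apply Finset.eq_of_subset_of_card_le hsub
  rw [Finset.card_erase_of_mem (mem_jl.2 hpL)]
  omega

theorem Doubled.not_extremal (hS : DenseHypergraph E n m r) (hN : NoPath E a b n)
    (hT : Doubled E a b n v e p k)
    (hp : ∀ v' e' p' k', Doubled E a b n v' e' p' k' → p ≤ p')
    (hk : ∀ v' e' k', Doubled E a b n v' e' p k' → k' ≤ k) : False := by
  obtain ⟨h1, h2, h3⟩ := hT.left_of_extremal hS hN hp hk
  have hpk1 := hT.succ_lt (hS.noPath_pred hN)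
  have hT' := hT
  obtain ⟨hD, hpk, hx, hy⟩ := hT
  have hkn := hD.2
  have hkA : k - 1 ∈ leftIn n v (nbr E n e (fun t => t = k) (v k)) := by
    rw [h1, Finset.mem_erase, mem_usedAt]
    have := hD.1.right (k - 1) (by omega) (by omega)
    rw [show k - 1 + 1 = k by omega] at this
    exact ⟨by omega, by omega, by omega, this⟩
  obtain ⟨-, f, hf, hkf, hkf'⟩ := mem_nbr.1 (mem_leftIn.1 hkA).2
  have hD2 : Defect E a b n v (Function.update e (k - 1) f) k :=
    hD.swap hf hkf' (by rwa [show k - 1 + 1 = k by omega])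
  have hT2 : Doubled E a b n v (Function.update e (k - 1) f) p k :=
    ⟨hD2, hpk, by rwa [Function.update_of_ne (by omega)], by rwa [Function.update_of_ne (by omega)]⟩
  obtain ⟨h1', h2', h3'⟩ := hT2.left_of_extremal hS hN hp hk
  have hA : usedAt n (Function.update e (k - 1) f) (fun t => t = k) (v k) =
      usedAt n e (fun t => t = k) (v k) := by
    ext i
    rw [mem_usedAt, mem_usedAt]
    rcases eq_or_ne i (k - 1) with rfl | hi
    · rw [Function.update_self]
      have := hD.1.right (k - 1) (by omega) (by omega)
      rw [show k - 1 + 1 = k by omega] at this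
      simp only [hkf, this]
    · rw [Function.update_of_ne hi]
  rw [hA, ← h1] at h1'
  have hsub : ∀ w ∈ nbr E n e (fun t => t = k) (v k),
      w ∈ nbr E n (Function.update e (k - 1) f) (fun t => t = k) (v k) := by
    intro w hw
    obtain ⟨t, ht, rfl⟩ := hD.1.exists_eq hS.card_eq w
    have htn : t ≠ n - 1 := by rintro rfl; exact h2 hw
    have : t ∈ leftIn n v (nbr E n e (fun t => t = k) (v k)) := mem_leftIn.2 ⟨by omega, hw⟩
    rw [← h1'] at this
    exact (mem_leftIn.1 this).2
  have := spare_of_card_unusedAt hS.unif h3' hkf (hS.unif f hf.1)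
    (fun w hw hwx => hsub w (mem_nbr.2 ⟨hwx, f, hf, hkf, hw⟩))
  exact this.2 (k - 1) (by omega) (by omega) (Function.update_self ..)

/-- In a dense hypergraph no label is joined to both ends of a defect. -/
theorem DenseHypergraph.not_jRight (hS : DenseHypergraph E n m r)
    (hN : NoPath E a b n) (hD : Defect E a b n v e k)
    {i : ℕ} (h1 : JLeft E n v e k i) : ¬ JRight E n v e k i := by
  intro h2
  classical
  obtain ⟨v₀, e₀, p₀, k₀, hT₀⟩ := hD.exists_doubled hN h1 h2
  have hex : ∃ p, ∃ v' e' k', Doubled E a b n v' e' p k' := ⟨p₀, v₀, e₀, k₀, hT₀⟩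
  have hmin : ∀ v' e' p' k', Doubled E a b n v' e' p' k' → Nat.find hex ≤ p' :=
    fun v' e' p' k' h => Nat.find_min' hex ⟨v', e', k', h⟩
  have hex2 : ∃ d, ∃ v' e' k', Doubled E a b n v' e' (Nat.find hex) k' ∧ n - k' = d := by
    obtain ⟨v', e', k', h⟩ := Nat.find_spec hex
    exact ⟨_, v', e', k', h, rfl⟩
  obtain ⟨v₁, e₁, k₁, hT, hd⟩ := Nat.find_spec hex2
  refine hT.not_extremal hS hN hmin fun v' e' k' h => ?_
  have h3 := Nat.find_min' hex2 ⟨v', e', k', h, rfl⟩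
  have h4 := h.1.2
  have h5 := hT.1.2
  omega

end Doubled

section Rotations

variable {V : Type*} {E : Finset (Finset V)} {a b : V} {n : ℕ} {v : ℕ → V}
  {e : ℕ → Finset V} {k i lo hi : ℕ} {f h : Finset V}

/-- Rotate a defect at one of the labels `lo`, `hi`, using an unused edge for the left ends. -/
theorem Defect.rotate_left (hD : Defect E a b n v e k) (hlt : lo < hi) (hhi : hi + 1 < n)
    (hk : k = lo ∨ k = hi) (hf : Spare E n e (fun t => t = k) f) (h1 : v lo ∈ f)
    (h2 : v hi ∈ f) :
    Defect E a b n (fun t => v (revPos lo hi t))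
      (Function.update (fun t => e (revLab lo hi t)) lo f) hi := by
  have hP : PartialPath E a b n v e (fun t => t = lo ∨ t = hi) :=
    hD.1.mono (by intro t _ h; omega)
  have hf' : Spare E n e (fun t => t = lo ∨ t = hi) f := hf.mono (by intro t _ h; omega)
  refine ⟨(hP.rev hlt hhi (Or.inl rfl) (Or.inr rfl)).assign (i := lo) (hf'.rev hhi) ?_ ?_ ?_, hhi⟩
  · show v (revPos lo hi lo) ∈ f
    rwa [revPos_out (by omega)]
  · show v (revPos lo hi (lo + 1)) ∈ f
    rwa [revPos_in (by omega) (by omega), show lo + hi + 1 - (lo + 1) = hi by omega]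
  · intro t _ h; unfold revLab; split_ifs <;> omega

/-- Rotate a defect at one of the labels `lo`, `hi`, using an unused edge for the right ends. -/
theorem Defect.rotate_right (hD : Defect E a b n v e k) (hlt : lo < hi) (hhi : hi + 1 < n)
    (hk : k = lo ∨ k = hi) (hf : Spare E n e (fun t => t = k) f) (h1 : v (lo + 1) ∈ f)
    (h2 : v (hi + 1) ∈ f) :
    Defect E a b n (fun t => v (revPos lo hi t))
      (Function.update (fun t => e (revLab lo hi t)) hi f) lo := by
  have hP : PartialPath E a b n v e (fun t => t = lo ∨ t = hi) :=
    hD.1.mono (by intro t _ h; omega)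
  have hf' : Spare E n e (fun t => t = lo ∨ t = hi) f := hf.mono (by intro t _ h; omega)
  refine ⟨(hP.rev hlt hhi (Or.inl rfl) (Or.inr rfl)).assign (i := hi) (hf'.rev hhi) ?_ ?_ ?_,
    by omega⟩
  · show v (revPos lo hi hi) ∈ f
    rwa [revPos_in (by omega) (by omega), show lo + hi + 1 - hi = lo + 1 by omega]
  · show v (revPos lo hi (hi + 1)) ∈ f
    rwa [revPos_out (by omega)]
  · intro t _ h; unfold revLab; split_ifs <;> omega

theorem Defect.spare_rotate_iff (hD : Defect E a b n v e k) {c d : ℕ} (hlt : lo < hi)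
    (hhi : hi + 1 < n) (hki : (k = lo ∧ i = hi) ∨ (k = hi ∧ i = lo))
    (hcd : (c = lo ∧ d = hi) ∨ (c = hi ∧ d = lo)) (hf : Spare E n e (fun t => t = k) f) :
    Spare E n (Function.update (fun t => e (revLab lo hi t)) c f) (fun t => t = d) h ↔
      h = e i ∨ (Spare E n e (fun t => t = k) h ∧ h ≠ f) := by
  constructor
  · intro hh
    by_cases hhe : h = e i
    · exact Or.inl hhe
    refine Or.inr ⟨⟨hh.1, fun t ht htk => ?_⟩, ?_⟩
    · rcases eq_or_ne t i with rfl | hti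
      · exact Ne.symm hhe
      · have hlab : revLab lo hi t ≠ lo ∧ revLab lo hi t ≠ hi := by
          unfold revLab; split_ifs <;> omega
        have := hh.2 (revLab lo hi t) (revLab_lt hhi ht) (by omega)
        rwa [Function.update_of_ne (by omega), revLab_revLab] at this
    · have := hh.2 c (by omega) (by omega)
      rw [Function.update_self] at this
      exact this.symm
  · rintro (rfl | ⟨hh, hne⟩)
    · refine ⟨hD.1.mem i (by omega) (by omega), fun t ht htd => ?_⟩
      rcases eq_or_ne t c with rfl | htc
      · rw [Function.update_self]
        exact (hf.2 i (by omega) (by omega)).symm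
      · have hlab : revLab lo hi t ≠ lo ∧ revLab lo hi t ≠ hi := by
          unfold revLab; split_ifs <;> omega
        rw [Function.update_of_ne htc]
        intro heq
        have := hD.1.einj _ _ (revLab_lt hhi ht) (by omega) (by omega) (by omega) heq
        omega
    · refine ⟨hh.1, fun t ht htd => ?_⟩
      rcases eq_or_ne t c with rfl | htc
      · rw [Function.update_self]; exact hne.symm
      · have hlab : revLab lo hi t ≠ lo ∧ revLab lo hi t ≠ hi := by
          unfold revLab; split_ifs <;> omega
        rw [Function.update_of_ne htc]
        exact hh.2 _ (revLab_lt hhi ht) (by omega)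

end Rotations

/-- A label `p` joined to neither end of the defect, all other labels being joined to one of
them by unused edges. -/
structure ZeroLabel {V : Type*} (E : Finset (Finset V)) (a b : V) (n : ℕ) (v : ℕ → V)
    (e : ℕ → Finset V) (k p : ℕ) : Prop where
  defect : Defect E a b n v e k
  lt : p + 1 < n
  ne : p ≠ k
  not_left : ¬ JLeft E n v e k p
  not_right : ¬ JRight E n v e k p
  cover : ∀ l, l + 1 < n → l ≠ k → l ≠ p → JLeft E n v e k l ∨ JRight E n v e k l
  left_spare : ∀ l, JLeft E n v e k l → ∃ g, Spare E n e (fun t => t = k) g ∧ v k ∈ g ∧ v l ∈ g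
  right_spare : ∀ l, JRight E n v e k l →
    ∃ g, Spare E n e (fun t => t = k) g ∧ v (k + 1) ∈ g ∧ v (l + 1) ∈ g
  left_edge : ∃ i, i + 1 < n ∧ i ≠ k ∧ v k ∈ e i ∧ v p ∈ e i
  right_edge : ∃ j, j + 1 < n ∧ j ≠ k ∧ v (k + 1) ∈ e j ∧ v (p + 1) ∈ e j

section ZeroLabel

variable {V : Type*} {E : Finset (Finset V)} {a b : V} {n m r : ℕ} {v : ℕ → V}
  {e : ℕ → Finset V} {k p i j l : ℕ}

theorem ZeroLabel.mirror (hZ : ZeroLabel E a b n v e k p) :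
    ZeroLabel E b a n (fun t => v (n - 1 - t)) (fun t => e (n - 2 - t)) (n - 2 - k)
      (n - 2 - p) := by
  obtain ⟨hD, h1, h2, h3, h4, h5, h6, h7, ⟨i, hi1, hi2, hi3, hi4⟩, ⟨j, hj1, hj2, hj3, hj4⟩⟩ := hZ
  have hk := hD.2
  refine ⟨hD.mirror, by omega, by omega, ?_, ?_, ?_, ?_, ?_, ?_, ?_⟩
  · rwa [jLeft_mirror_iff hk (by omega), show n - 2 - (n - 2 - p) = p by omega]
  · rwa [jRight_mirror_iff hk (by omega), show n - 2 - (n - 2 - p) = p by omega]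
  · intro l hl hlk hlp
    rw [jLeft_mirror_iff hk hl, jRight_mirror_iff hk hl]
    exact (h5 (n - 2 - l) (by omega) (by omega) (by omega)).symm
  · intro l hl
    have hl1 := hl.1
    rw [jLeft_mirror_iff hk hl1] at hl
    obtain ⟨g, hg, hg1, hg2⟩ := h7 _ hl
    refine ⟨g, (Spare.mirror_iff_single hk).2 hg, ?_, ?_⟩
    · rwa [show n - 1 - (n - 2 - k) = k + 1 by omega]
    · rwa [show n - 1 - l = n - 2 - l + 1 by omega]
  · intro l hl
    have hl1 := hl.1
    rw [jRight_mirror_iff hk hl1] at hl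
    obtain ⟨g, hg, hg1, hg2⟩ := h6 _ hl
    refine ⟨g, (Spare.mirror_iff_single hk).2 hg, ?_, ?_⟩
    · rwa [show n - 1 - (n - 2 - k + 1) = k by omega]
    · rwa [show n - 1 - (l + 1) = n - 2 - l by omega]
  · refine ⟨n - 2 - j, by omega, by omega, ?_, ?_⟩
    · rwa [show n - 1 - (n - 2 - k) = k + 1 by omega, show n - 2 - (n - 2 - j) = j by omega]
    · rwa [show n - 1 - (n - 2 - p) = p + 1 by omega, show n - 2 - (n - 2 - j) = j by omega]
  · refine ⟨n - 2 - i, by omega, by omega, ?_, ?_⟩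
    · rwa [show n - 1 - (n - 2 - k + 1) = k by omega, show n - 2 - (n - 2 - i) = i by omega]
    · rwa [show n - 1 - (n - 2 - p + 1) = p by omega, show n - 2 - (n - 2 - i) = i by omega]

variable [Fintype V] [DecidableEq V]

theorem DenseHypergraph.not_jRight_of_mem (hS : DenseHypergraph E n m r) (hN : NoPath E a b n)
    (hD : Defect E a b n v e k) (hi : i + 1 < n) (hik : i ≠ k) (h1 : v k ∈ e i) (h2 : v l ∈ e i) :
    ¬ JRight E n v e k l := by
  intro hR
  have hL := hD.jLeft_of_mem hi hik h1
  have hil : i ≠ l := by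
    rintro rfl; exact hS.not_jRight hN hD hL hR
  obtain ⟨hl, hlk, g, hg, hg1, hg2⟩ := hR
  obtain ⟨v', e', q, k', hD', hq, hqk, hq1, hq2, -⟩ :=
    hD.transfer hi hl hik hlk hil h1 h2 hg hg1 hg2
  exact hS.not_jRight hN hD' (hD'.jLeft_of_mem hq hqk hq1) (hD'.jRight_of_mem hq hqk hq2)

theorem DenseHypergraph.not_jLeft_of_mem (hS : DenseHypergraph E n m r) (hN : NoPath E a b n)
    (hD : Defect E a b n v e k) (hj : j + 1 < n) (hjk : j ≠ k) (h1 : v (k + 1) ∈ e j)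
    (h2 : v (l + 1) ∈ e j) : ¬ JLeft E n v e k l := by
  intro hL
  have hk := hD.2
  have hl := hL.1
  have := hS.not_jRight_of_mem (l := n - 2 - l) hN.symm hD.mirror (i := n - 2 - j) (by omega)
    (by omega)
    (by rwa [show n - 1 - (n - 2 - k) = k + 1 by omega, show n - 2 - (n - 2 - j) = j by omega])
    (by rwa [show n - 1 - (n - 2 - l) = l + 1 by omega, show n - 2 - (n - 2 - j) = j by omega])
  rw [jRight_mirror_iff hk (by omega), show n - 2 - (n - 2 - l) = l by omega] at this
  exact this hL

theorem DenseHypergraph.exists_zero (hS : DenseHypergraph E n m r) (hN : NoPath E a b n)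
    (hD : Defect E a b n v e k) (h : (jl E n v e k).card ≤ m - 1) :
    ∃ p, p + 1 < n ∧ p ≠ k ∧ ¬ JLeft E n v e k p ∧ ¬ JRight E n v e k p ∧
      ∃ i, i + 1 < n ∧ i ≠ k ∧ v k ∈ e i ∧ v p ∈ e i := by
  obtain ⟨h1, -, h3, h4⟩ := hS.exact_left hD h
  obtain ⟨i, hi, hik, hki, w, hw, hwk, hwN⟩ := hS.exists_outside h1.le
  obtain ⟨t, ht, rfl⟩ := hD.1.exists_eq hS.card_eq w
  have htn : t ≠ n - 1 := by rintro rfl; exact hwN h4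
  have htk : t ≠ k := by rintro rfl; exact hwk rfl
  refine ⟨t, by omega, htk, fun hL => hwN ?_, hS.not_jRight_of_mem hN hD hi hik hki hw,
    i, hi, hik, hki, hw⟩
  have := mem_jl.2 hL
  rw [← h3] at this
  exact (mem_leftIn.1 this).2

theorem DenseHypergraph.exists_zeroLabel (hS : DenseHypergraph E n m r) (hN : NoPath E a b n)
    (hD : Defect E a b n v e k) : ∃ p, ZeroLabel E a b n v e k p := by
  have hk := hD.2
  have hm := hS.half
  have hr := hS.three_le
  have hrm := hS.le_half
  have hdis : Disjoint (jl E n v e k) (jr E n v e k) := by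
    rw [Finset.disjoint_left]
    intro l hl hl'
    exact hS.not_jRight hN hD (mem_jl.1 hl) (mem_jr.1 hl')
  have hmir := card_jl_mirror (E := E) (v := v) (e := e) hk
  have hzR : (jr E n v e k).card ≤ m - 1 →
      ∃ p, p + 1 < n ∧ p ≠ k ∧ ¬ JLeft E n v e k p ∧ ¬ JRight E n v e k p ∧
        ∃ j, j + 1 < n ∧ j ≠ k ∧ v (k + 1) ∈ e j ∧ v (p + 1) ∈ e j := by
    intro h
    obtain ⟨p, h1, h2, h3, h4, i, h5, h6, h7, h8⟩ := hS.exists_zero hN.symm hD.mirror (hmir ▸ h)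
    rw [jLeft_mirror_iff hk h1] at h3
    rw [jRight_mirror_iff hk h1] at h4
    refine ⟨n - 2 - p, by omega, by omega, h4, h3, n - 2 - i, by omega, by omega, ?_, ?_⟩
    · rwa [show n - 1 - (n - 2 - k) = k + 1 by omega] at h7
    · rwa [show n - 1 - p = n - 2 - p + 1 by omega] at h8
  have hL1 : m - 1 ≤ (jl E n v e k).card := by
    by_contra hcon
    have := (hS.exact_left hD (by omega)).2.1
    omega
  have hR1 : m - 1 ≤ (jr E n v e k).card := by
    by_contra hcon
    have := (hS.exact_left hD.mirror (by omega)).2.1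
    omega
  have hsub : ∀ T : Finset ℕ, T ⊆ Finset.range (n - 1) → k ∈ T →
      Disjoint T (jl E n v e k ∪ jr E n v e k) →
      (jl E n v e k).card + (jr E n v e k).card + T.card ≤ n - 1 := by
    intro T hT _ hd
    rw [← Finset.card_union_of_disjoint hdis, add_comm, ← Finset.card_union_of_disjoint hd]
    calc _ ≤ (Finset.range (n - 1)).card := Finset.card_le_card
          (Finset.union_subset hT (Finset.union_subset jl_subset_range jr_subset_range))
      _ = n - 1 := Finset.card_range _
  have hnotmem : ∀ p, ¬ JLeft E n v e k p → ¬ JRight E n v e k p →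
      p ∉ jl E n v e k ∪ jr E n v e k := by
    intro p h1 h2 h
    rcases Finset.mem_union.1 h with h | h
    · exact h1 (mem_jl.1 h)
    · exact h2 (mem_jr.1 h)
  have hkk : k ∉ jl E n v e k ∪ jr E n v e k := hnotmem k (fun h => h.2.1 rfl) (fun h => h.2.1 rfl)
  have h1 := hsub {k} (by intro t ht; rw [Finset.mem_singleton] at ht; rw [Finset.mem_range]; omega)
    (Finset.mem_singleton_self k) (Finset.disjoint_singleton_left.2 hkk)
  rw [Finset.card_singleton] at h1
  have hone : ∀ p, p + 1 < n → p ≠ k → ¬ JLeft E n v e k p → ¬ JRight E n v e k p →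
      (jl E n v e k).card + (jr E n v e k).card + 2 ≤ n - 1 := by
    intro p hp hpk h2 h3
    rw [← Finset.card_pair hpk.symm]
    refine hsub _ ?_ (Finset.mem_insert_self ..) ?_
    · intro t ht
      rw [Finset.mem_insert, Finset.mem_singleton] at ht; rw [Finset.mem_range]; omega
    · rw [Finset.disjoint_insert_left, Finset.disjoint_singleton_left]
      exact ⟨hkk, hnotmem p h2 h3⟩
  have hLm : (jl E n v e k).card ≤ m - 1 := by
    by_contra hcon
    obtain ⟨p, hp, hpk, h2, h3, -⟩ := hzR (by omega)
    have := hone p hp hpk h2 h3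
    omega
  obtain ⟨p, hp, hpk, hpL, hpR, hpi⟩ := hS.exists_zero hN hD hLm
  have hcount := hone p hp hpk hpL hpR
  obtain ⟨q, hq, hqk, hqL, hqR, hqj⟩ := hzR (by omega)
  have huniq : ∀ l, l + 1 < n → l ≠ k → l ≠ p → JLeft E n v e k l ∨ JRight E n v e k l := by
    intro l hl hlk hlp
    by_contra hcon
    push Not at hcon
    have := hsub {k, p, l} ?_ (Finset.mem_insert_self ..) ?_
    · rw [Finset.card_eq_three.2 ⟨k, p, l, hpk.symm, hlk.symm, hlp.symm, rfl⟩] at this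
      omega
    · intro t ht
      simp only [Finset.mem_insert, Finset.mem_singleton] at ht; rw [Finset.mem_range]; omega
    · rw [Finset.disjoint_insert_left, Finset.disjoint_insert_left, Finset.disjoint_singleton_left]
      exact ⟨hkk, hnotmem p hpL hpR, hnotmem l hcon.1 hcon.2⟩
  obtain rfl : q = p := by
    by_contra hqp
    exact (huniq q hq hqk hqp).elim hqL hqR
  have hexL := (hS.exact_left hD (by omega)).2.2.1
  have hexR := (hS.exact_left hD.mirror (by omega)).2.2.1
  refine ⟨q, hD, hq, hqk, hqL, hqR, huniq, ?_, ?_, hpi, hqj⟩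
  · intro l hl
    have := mem_jl.2 hl
    rw [← hexL] at this
    exact (mem_nbr.1 (mem_leftIn.1 this).2).2
  · intro l hl
    have hl1 := hl.1
    have : n - 2 - l ∈ jl E n (fun t => v (n - 1 - t)) (fun t => e (n - 2 - t)) (n - 2 - k) := by
      rw [mem_jl, jLeft_mirror_iff hk (by omega), show n - 2 - (n - 2 - l) = l by omega]
      exact hl
    rw [← hexR] at this
    obtain ⟨-, g, hg, hg1, hg2⟩ := mem_nbr.1 (mem_leftIn.1 this).2
    refine ⟨g, (Spare.mirror_iff_single hk).1 hg, ?_, ?_⟩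
    · rwa [show n - 1 - (n - 2 - k) = k + 1 by omega] at hg1
    · rwa [show n - 1 - (n - 2 - l) = l + 1 by omega] at hg2

end ZeroLabel

section FinalStep

variable {V : Type*} [Fintype V] [DecidableEq V] {E : Finset (Finset V)} {a b : V} {n m r : ℕ}
  {v : ℕ → V} {e : ℕ → Finset V} {k p i j : ℕ}

theorem ZeroLabel.between_of_lt (hS : DenseHypergraph E n m r) (hN : NoPath E a b n)
    (hZ : ZeroLabel E a b n v e k p) (hik : i < k) (hi1 : v k ∈ e i) (hi2 : v p ∈ e i)
    (hj : j + 1 < n) (hjk : j ≠ k) (hj1 : v (k + 1) ∈ e j) (hj2 : v (p + 1) ∈ e j) :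
    i < p ∧ p < k := by
  have hk := hZ.defect.2
  have hp := hZ.lt
  have hpk := hZ.ne
  have hLi := hZ.defect.jLeft_of_mem (i := i) (by omega) (by omega) hi1
  have hij : j ≠ i := by
    rintro rfl
    exact hS.not_jRight hN hZ.defect hLi (hZ.defect.jRight_of_mem hj hjk hj1)
  have hip : i ≠ p := by rintro rfl; exact hZ.not_left hLi
  by_contra hcon
  obtain ⟨f, hf, hf1, hf2⟩ := hZ.left_spare i hLi
  have hD' := hZ.defect.rotate_left hik hk (Or.inr rfl) hf hf2 hf1
  have hei := (hZ.defect.spare_rotate_iff hik hk (Or.inr ⟨rfl, rfl⟩) (Or.inl ⟨rfl, rfl⟩) hf).2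
    (Or.inl rfl)
  have hlab : revLab i k j ≠ i ∧ revLab i k j ≠ k := by unfold revLab; split_ifs <;> omega
  refine hS.not_jLeft_of_mem hN hD' (j := revLab i k j) (l := p) (revLab_lt hk hj) hlab.2 ?_ ?_
    ⟨hp, hpk, e i, hei.or_left p, ?_, ?_⟩
  · rw [Function.update_of_ne hlab.1, revLab_revLab, revPos_out (by omega)]; exact hj1
  · rw [Function.update_of_ne hlab.1, revLab_revLab, revPos_out (by omega)]; exact hj2
  · beta_reduce
    rw [revPos_in (by omega) (by omega), show i + k + 1 - k = i + 1 by omega]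
    exact hZ.defect.1.right i (by omega) (by omega)
  · beta_reduce; rw [revPos_out (by omega)]; exact hi2

theorem ZeroLabel.not_between_of_gt (hS : DenseHypergraph E n m r) (hN : NoPath E a b n)
    (hZ : ZeroLabel E a b n v e k p) (hi : i + 1 < n) (hi1 : v k ∈ e i)
    (hi2 : v p ∈ e i) (hj : j + 1 < n) (hjk : j ≠ k) (hj1 : v (k + 1) ∈ e j)
    (hj2 : v (p + 1) ∈ e j) (hkp : k < p) : i < p := by
  have hk := hZ.defect.2
  have hp := hZ.lt
  by_contra hcon
  have hLi := hZ.defect.jLeft_of_mem (i := i) (by omega) (by omega) hi1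
  have hij : j ≠ i := by
    rintro rfl
    exact hS.not_jRight hN hZ.defect hLi (hZ.defect.jRight_of_mem hj hjk hj1)
  have hip : i ≠ p := by rintro rfl; exact hZ.not_left hLi
  have hki : k < i := by omega
  obtain ⟨f, hf, hf1, hf2⟩ := hZ.left_spare i hLi
  have hD' := hZ.defect.rotate_left hki hi (Or.inl rfl) hf hf1 hf2
  have hei := (hZ.defect.spare_rotate_iff hki hi (Or.inl ⟨rfl, rfl⟩) (Or.inl ⟨rfl, rfl⟩) hf).2
    (Or.inl rfl)
  have hlab : revLab k i j ≠ i ∧ revLab k i j ≠ k := by unfold revLab; split_ifs <;> omega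
  refine hS.not_jRight_of_mem hN hD' (i := revLab k i j) (l := k + i - p) (revLab_lt hi hj) hlab.1
    ?_ ?_ ⟨by omega, by omega, e i, hei.or_left _, ?_, ?_⟩
  · rw [Function.update_of_ne hlab.2, revLab_revLab, revPos_in (by omega) (by omega),
      show k + i + 1 - i = k + 1 by omega]
    exact hj1
  · rw [Function.update_of_ne hlab.2, revLab_revLab, revPos_in (by omega) (by omega),
      show k + i + 1 - (k + i - p) = p + 1 by omega]
    exact hj2
  · beta_reduce; rw [revPos_out (by omega)]
    exact hZ.defect.1.right i (by omega) (by omega)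
  · beta_reduce
    rw [revPos_in (by omega) (by omega), show k + i + 1 - (k + i - p + 1) = p by omega]
    exact hi2

theorem ZeroLabel.not_chain (hS : DenseHypergraph E n m r) (hN : NoPath E a b n)
    (hZ : ZeroLabel E a b n v e k p) (hi1 : v k ∈ e i) (hj1 : v (k + 1) ∈ e j)
    (hj2 : v (p + 1) ∈ e j) (hip : i < p) (hpj : p < j) : ¬ j < k := by
  intro hjk
  have hk := hZ.defect.2
  have hLi := hZ.defect.jLeft_of_mem (i := i) (by omega) (by omega) hi1
  have hyi : v (k + 1) ∉ e i := fun h =>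
    hS.not_jRight hN hZ.defect hLi (hZ.defect.jRight_of_mem (by omega) (by omega) h)
  have hik : i < k := by omega
  obtain ⟨f, hf, hf1, hf2⟩ := hZ.left_spare i hLi
  have hD' := hZ.defect.rotate_left hik hk (Or.inr rfl) hf hf2 hf1
  have hsp := fun h => hZ.defect.spare_rotate_iff (h := h) hik hk (Or.inr ⟨rfl, rfl⟩)
    (Or.inl ⟨rfl, rfl⟩) hf
  obtain ⟨q, hZ'⟩ := hS.exists_zeroLabel hN hD'
  set v' := fun t => v (revPos i k t) with hv'
  set e' := Function.update (fun t => e (revLab i k t)) i f with he'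
  have hvk : v' (k + 1) = v (k + 1) := by
    rw [hv']; simp only [revPos_out (show k + 1 ≤ i ∨ k < k + 1 by omega)]
  have hvin : ∀ t, i < t → t ≤ k → v' t = v (i + k + 1 - t) := fun t h1 h2 => by
    rw [hv']; simp only [revPos_in h1 h2]
  have hRold : ∀ l, l + 1 < n → l ≠ k → (∃ g, Spare E n e' (fun t => t = k) g ∧ v (k + 1) ∈ g ∧
      v (l + 1) ∈ g) → JRight E n v e k l := by
    rintro l hl hlk ⟨g, hg, hg1, hg2⟩
    rcases (hsp g).1 hg with rfl | ⟨hg', -⟩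
    · exact absurd hg1 hyi
    · exact ⟨hl, hlk, g, hg'.or_left l, hg1, hg2⟩
  have hRj := hZ.defect.jRight_of_mem (by omega) hjk.ne hj1
  have hej : e' (i + k - j) = e j := by
    rw [he', Function.update_of_ne (by omega), revLab_in (by omega) (by omega)]
    congr 1; omega
  have hq : i + k - p - 1 = q := by
    by_contra hne
    rcases hZ'.cover (i + k - p - 1) (by omega) (by omega) hne with h | h
    · refine hS.not_jLeft_of_mem hN hD' (j := i + k - j) (l := i + k - p - 1) (by omega) (by omega)
        ?_ ?_ h
      · rw [hej, hvk]; exact hj1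
      · rw [hej, hvin _ (by omega) (by omega),
          show i + k + 1 - (i + k - p - 1 + 1) = p + 1 by omega]
        exact hj2
    · obtain ⟨g, hg, hg1, hg2⟩ := hZ'.right_spare _ h
      refine hZ.not_right (hRold p hZ.lt hZ.ne ⟨g, hg, hvk ▸ hg1, ?_⟩)
      rwa [hvin _ (by omega) (by omega),
        show i + k + 1 - (i + k - p - 1 + 1) = p + 1 by omega] at hg2
  have hback : ∀ s, i + s + 1 + j ≤ i + k → JRight E n v' e' k (i + k - j - 1 - s) := by
    intro s
    induction s with
    | zero =>
      intro _
      obtain ⟨g, hg, hg1, hg2⟩ := hZ.right_spare j hRj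
      have hgf : g ≠ f := by
        rintro rfl; exact hZ.defect.not_mem_both hN hf hf1 hg1
      refine ⟨by omega, by omega, g, ((hsp g).2 (Or.inr ⟨hg, hgf⟩)).or_left _, hvk.symm ▸ hg1, ?_⟩
      rwa [hvin _ (by omega) (by omega),
        show i + k + 1 - (i + k - j - 1 - 0 + 1) = j + 1 by omega]
    | succ s ih =>
      intro hs
      refine (hZ'.cover _ (by omega) (by omega) (by omega)).resolve_left fun h => ?_
      refine hD'.not_jLeft_jRight_succ hN (hS.noPath_pred hN) h ?_
      rw [show i + k - j - 1 - (s + 1) + 1 = i + k - j - 1 - s by omega]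
      exact ih (by omega)
  have hR := hback (k - j - 1) (by omega)
  rw [show i + k - j - 1 - (k - j - 1) = i by omega] at hR
  obtain ⟨g, hg, hg1, hg2⟩ := hZ'.right_spare _ hR
  rw [hvk] at hg1
  rw [hvin _ (by omega) (by omega), show i + k + 1 - (i + 1) = k by omega] at hg2
  rcases (hsp g).1 hg with rfl | ⟨hg', -⟩
  · exact hyi hg1
  · exact hZ.defect.not_mem_both hN hg' hg2 hg1

theorem DenseHypergraph.not_zero_left (hS : DenseHypergraph E n m r) (hN : NoPath E a b n) :
    ∀ (k : ℕ) (v : ℕ → V) (e : ℕ → Finset V) (p j : ℕ), ZeroLabel E a b n v e k p → p < j →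
      v (k + 1) ∈ e j → v (p + 1) ∈ e j → ¬ j < k := by
  intro k
  induction k with
  | zero => intros; omega
  | succ k ih =>
    intro v e p j hZ hpj hj1 hj2 hjk
    have hk := hZ.defect.2
    obtain ⟨i, hi, hik, hi1, hi2⟩ := hZ.left_edge
    rcases lt_or_gt_of_ne hik with hlt | hgt
    · have := hZ.between_of_lt hS hN hlt hi1 hi2 (by omega) (by omega) hj1 hj2
      exact hZ.not_chain hS hN hi1 hj1 hj2 this.1 hpj hjk
    have hLi := hZ.defect.jLeft_of_mem hi hik hi1
    obtain ⟨f, hf, hf1, hf2⟩ := hZ.left_spare i hLi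
    have hD₁ := hZ.defect.rotate_left hgt hi (Or.inl rfl) hf hf1 hf2
    have hsp₁ := fun h => hZ.defect.spare_rotate_iff (h := h) hgt hi (Or.inl ⟨rfl, rfl⟩)
      (Or.inl ⟨rfl, rfl⟩) hf
    have hei := (hsp₁ (e i)).2 (Or.inl rfl)
    have hD₂ := hD₁.rotate_right (lo := k) (hi := i) (by omega) hi (Or.inr rfl) hei
      (by rw [revPos_out (by omega)]; exact hi1)
      (by rw [revPos_out (by omega)]; exact hZ.defect.1.right i hi hik)
    have hsp₂ := fun h => hD₁.spare_rotate_iff (h := h) (lo := k) (hi := i) (by omega) hi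
      (Or.inr ⟨rfl, rfl⟩) (Or.inr ⟨rfl, rfl⟩) hei
    set e₁ := Function.update (fun t => e (revLab (k + 1) i t)) (k + 1) f with he₁
    have hek : e₁ k = e k := by
      rw [he₁, Function.update_of_ne (by omega), revLab_out (by omega)]
    have hvlow : ∀ t, t ≤ k → v (revPos (k + 1) i (revPos k i t)) = v t := by
      intro t ht
      rw [revPos_out (show t ≤ k ∨ i < t by omega), revPos_out (by omega)]
    have hvk : v (revPos (k + 1) i (revPos k i (k + 1))) = v (k + 1 + 1) := by
      rw [revPos_in (show k < k + 1 by omega) (show k + 1 ≤ i by omega),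
        revPos_in (by omega) (by omega)]
      congr 1; omega
    have hekk := hD₂.not_mem_both hN ((hsp₂ _).2 (Or.inl rfl)) (by
      rw [hek, hvlow k le_rfl]
      exact hZ.defect.1.left k (by omega) (by omega))
    rw [hvk, hek] at hekk
    have hjk' : j < k := by
      rcases Nat.lt_or_eq_of_le (Nat.lt_succ_iff.1 hjk) with h | rfl
      · exact h
      · exact absurd hj1 hekk
    have hej : Function.update (fun t => e₁ (revLab k i t)) i (e i) j = e j := by
      rw [Function.update_of_ne (by omega), revLab_out (by omega), he₁,
        Function.update_of_ne (by omega), revLab_out (by omega)]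
    obtain ⟨q, hZ'⟩ := hS.exists_zeroLabel hN hD₂
    have hqp : p = q := by
      by_contra hne
      rcases hZ'.cover p hZ.lt (by omega) hne with h | h
      · refine hS.not_jLeft_of_mem hN hD₂ (j := j) (l := p) (by omega) (by omega) ?_ ?_ h
        · rw [hej, hvk]; exact hj1
        · rw [hej, hvlow _ (by omega)]; exact hj2
      · obtain ⟨g, hg, hg1, hg2⟩ := hZ'.right_spare p h
        rw [hvk] at hg1
        rw [hvlow _ (by omega)] at hg2
        rcases (hsp₂ g).1 hg with rfl | ⟨hg', hgi⟩
        · rw [hek] at hg1; exact hekk hg1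
        · rcases (hsp₁ g).1 hg' with h | ⟨hg'', -⟩
          · exact hgi h
          · exact hZ.not_right ⟨hZ.lt, hZ.ne, g, hg''.or_left p, hg1, hg2⟩
    subst hqp
    refine ih _ _ p j hZ' hpj ?_ ?_ hjk'
    · rw [hej, hvk]; exact hj1
    · rw [hej, hvlow _ (by omega)]; exact hj2

theorem DenseHypergraph.not_zeroLabel (hS : DenseHypergraph E n m r) (hN : NoPath E a b n)
    (hZ : ZeroLabel E a b n v e k p) : ¬ p < k := by
  intro hpk
  have hk := hZ.defect.2
  obtain ⟨i, hi, hik, hi1, hi2⟩ := hZ.left_edge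
  obtain ⟨j, hj, hjk, hj1, hj2⟩ := hZ.right_edge
  have hL : v (n - 1 - (n - 2 - k)) ∈ e (n - 2 - (n - 2 - j)) := by
    rwa [show n - 1 - (n - 2 - k) = k + 1 by omega, show n - 2 - (n - 2 - j) = j by omega]
  have hL' : v (n - 1 - (n - 2 - p)) ∈ e (n - 2 - (n - 2 - j)) := by
    rwa [show n - 1 - (n - 2 - p) = p + 1 by omega, show n - 2 - (n - 2 - j) = j by omega]
  have hR : v (n - 1 - (n - 2 - k + 1)) ∈ e (n - 2 - (n - 2 - i)) := by
    rwa [show n - 1 - (n - 2 - k + 1) = k by omega, show n - 2 - (n - 2 - i) = i by omega]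
  have hR' : v (n - 1 - (n - 2 - p + 1)) ∈ e (n - 2 - (n - 2 - i)) := by
    rwa [show n - 1 - (n - 2 - p + 1) = p by omega, show n - 2 - (n - 2 - i) = i by omega]
  rcases lt_or_gt_of_ne hjk with hlt | hgt
  · have := hZ.mirror.not_between_of_gt hS hN.symm (i := n - 2 - j) (j := n - 2 - i) (by omega)
      hL hL' (by omega) (by omega) hR hR' (by omega)
    exact hS.not_zero_left hN k v e p j hZ (by omega) hj1 hj2 hlt
  · have := hZ.mirror.between_of_lt hS hN.symm (i := n - 2 - j) (j := n - 2 - i) (by omega)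
      hL hL' (by omega) (by omega) hR hR'
    omega

/-- A dense hypergraph has no defect unless it has a hamiltonian Berge path. -/
theorem DenseHypergraph.not_defect (hS : DenseHypergraph E n m r) (hN : NoPath E a b n) :
    ¬ Defect E a b n v e k := by
  intro hD
  obtain ⟨p, hZ⟩ := hS.exists_zeroLabel hN hD
  have hk := hD.2
  have h1 := hZ.lt
  have h2 := hZ.ne
  have h3 := hS.not_zeroLabel hN hZ
  have h4 := hS.not_zeroLabel hN.symm hZ.mirror
  omega

end FinalStep

/-- A uniform hypergraph whose edges contain more than half of the vertices, with minimum degree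
at least `r - 1`. -/
structure WideHypergraph {V : Type*} [Fintype V] [DecidableEq V] (E : Finset (Finset V))
    (n r : ℕ) : Prop where
  card_eq : Fintype.card V = n
  three_le : 3 ≤ r
  lt_two_mul : n < 2 * r
  unif : ∀ g ∈ E, g.card = r
  deg : ∀ z, r - 1 ≤ degree E z

section SpareEdges

variable {V : Type*} {E : Finset (Finset V)} {a b : V} {n : ℕ} {v : ℕ → V}
  {e : ℕ → Finset V} {k l : ℕ} {f g : Finset V}

theorem Defect.not_mem_right_of_spare (hN : NoPath E a b n) (hD : Defect E a b n v e k)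
    (hf : Spare E n e (fun t => t = k) f) (hx : v k ∈ f) (hg : Spare E n e (fun t => t = k) g)
    (hy : v (k + 1) ∈ g) (hl : l + 1 < n) (hlk : l ≠ k) (h : v l ∈ f) : v (l + 1) ∉ g :=
  fun h' => hD.not_jRight_of_spare hN hf hx h ⟨hl, hlk, g, hg.or_left l, hy, h'⟩

theorem Defect.right_not_mem_edge (hN : NoPath E a b n) (hD : Defect E a b n v e k)
    (hf : Spare E n e (fun t => t = k) f) (hx : v k ∈ f) (hl : l + 1 < n) (hlk : l ≠ k)
    (h : v l ∈ f) : v (k + 1) ∉ e l :=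
  fun h' => hD.not_jRight_of_spare hN hf hx h (hD.jRight_of_mem hl hlk h')

theorem Defect.left_not_mem_edge (hN : NoPath E a b n) (hD : Defect E a b n v e k)
    (hg : Spare E n e (fun t => t = k) g) (hy : v (k + 1) ∈ g) (hl : l + 1 < n) (hlk : l ≠ k)
    (h : v (l + 1) ∈ g) : v k ∉ e l :=
  fun h' => hD.not_jLeft_of_spare hN hg hy h (hD.jLeft_of_mem hl hlk h')

theorem Defect.card_union_spare (hN : NoPath E a b n) (hD : Defect E a b n v e k)
    (hf : Spare E n e (fun t => t = k) f) (hx : v k ∈ f)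
    (hg : Spare E n e (fun t => t = k) g) (hy : v (k + 1) ∈ g) :
    (leftIn n v f).card + (rightIn n v g).card = (leftIn n v f ∪ rightIn n v g).card + 1 ∧
      leftIn n v f ∪ rightIn n v g ⊆ Finset.range (n - 1) := by
  have hk := hD.2
  have hint : leftIn n v f ∩ rightIn n v g = {k} := by
    ext j
    simp only [Finset.mem_inter, mem_leftIn, mem_rightIn, Finset.mem_singleton]
    constructor
    · rintro ⟨⟨h1, h2⟩, -, h3⟩
      by_contra hjk
      exact hD.not_mem_right_of_spare hN hf hx hg hy h1 hjk h2 h3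
    · rintro rfl; exact ⟨⟨hk, hx⟩, hk, hy⟩
  have := Finset.card_union_add_card_inter (leftIn n v f) (rightIn n v g)
  rw [hint, Finset.card_singleton] at this
  refine ⟨this.symm, ?_⟩
  intro j hj
  simp only [Finset.mem_union, mem_leftIn, mem_rightIn] at hj
  rw [Finset.mem_range]; omega

end SpareEdges

section WideHypergraph

variable {V : Type*} [Fintype V] [DecidableEq V] {E : Finset (Finset V)} {a b : V} {n r : ℕ}
  {v : ℕ → V} {e : ℕ → Finset V} {k l p : ℕ} {f g : Finset V}

theorem WideHypergraph.eq_of_subset (hS : WideHypergraph E n r) (hf : f ∈ E) (hg : g ∈ E)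
    (h : f ⊆ g) : f = g :=
  Finset.eq_of_subset_of_card_le h (by rw [hS.unif f hf, hS.unif g hg])

theorem WideHypergraph.card_leftIn (hS : WideHypergraph E n r) (hD : Defect E a b n v e k)
    (hf : f ∈ E) :
    r ≤ (leftIn n v f).card + 1 ∧ (v (n - 1) ∉ f → r ≤ (leftIn n v f).card) := by
  have hk := hD.2
  have := hD.1.card_leftIn (S := f) (by omega) (fun z _ => hD.1.exists_eq hS.card_eq z)
  rw [hS.unif f hf] at this
  refine ⟨by split_ifs at this <;> omega, fun h => ?_⟩
  rw [if_neg h] at this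
  exact this.le

theorem WideHypergraph.card_rightIn (hS : WideHypergraph E n r) (hD : Defect E a b n v e k)
    (hf : f ∈ E) :
    r ≤ (rightIn n v f).card + 1 ∧ (v 0 ∉ f → r ≤ (rightIn n v f).card) := by
  have hk := hD.2
  have := hD.1.card_rightIn (S := f) (by omega) (fun z _ => hD.1.exists_eq hS.card_eq z)
  rw [hS.unif f hf] at this
  refine ⟨by split_ifs at this <;> omega, fun h => ?_⟩
  rw [if_neg h] at this
  exact this.le

theorem WideHypergraph.exists_unused (hS : WideHypergraph E n r) (hD : Defect E a b n v e k) :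
    ∃ h, Spare E n e (fun t => t = k) h := by
  have hk := hD.2
  by_contra! hno
  have hsub : E ⊆ ((Finset.range (n - 1)).erase k).image e := by
    intro g hg
    by_contra hgi
    refine hno g ⟨hg, fun t ht htk h => hgi ?_⟩
    exact Finset.mem_image.2
      ⟨t, Finset.mem_erase.2 ⟨htk, Finset.mem_range.2 (by omega)⟩, h⟩
  have h1 := (Finset.card_le_card hsub).trans Finset.card_image_le
  rw [Finset.card_erase_of_mem (Finset.mem_range.2 (by omega)), Finset.card_range] at h1
  have h2 := card_mul_le_of_degree hS.unif hS.deg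
  rw [hS.card_eq] at h2
  have h3 := h2.trans (Nat.mul_le_mul_left r h1)
  have h4 := hS.lt_two_mul
  obtain ⟨s, rfl⟩ : ∃ s, r = s + 1 := ⟨r - 1, by have := hS.three_le; omega⟩
  obtain ⟨q, rfl⟩ : ∃ q, n = q + 2 := ⟨n - 2, by omega⟩
  rw [show q + 2 - 1 - 1 = q by omega, show s + 1 - 1 = s by omega] at h3
  nlinarith

/-- Some arrangement leaves an edge at one end of the defect unused. -/
theorem WideHypergraph.exists_spare_at_end (hS : WideHypergraph E n r)
    (hD : Defect E a b n v e k) :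
    ∃ v' e' k' f, Defect E a b n v' e' k' ∧ Spare E n e' (fun t => t = k') f ∧
      (v' k' ∈ f ∨ v' (k' + 1) ∈ f) := by
  have hk := hD.2
  by_contra! H
  obtain ⟨h, hh⟩ := hS.exists_unused hD
  have hl := (hS.card_leftIn hD hh.1).1
  have hr := (hS.card_rightIn hD hh.1).1
  have hempty : ∀ z, (∀ g, Spare E n e (fun t => t = k) g → z ∉ g) →
      r ≤ (usedAt n e (fun t => t = k) z).card + 1 := by
    intro z hz
    have h1 := hD.1.degree_eq z
    have h2 := hS.deg z
    have h3 : unusedAt E n e (fun t => t = k) z = ∅ := by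
      apply Finset.eq_empty_of_forall_notMem
      intro g hg
      have := mem_unusedAt.1 hg
      exact hz g this.1 this.2
    rw [h3, Finset.card_empty] at h1
    omega
  have hx := hempty (v k) fun g hg => (H v e k g hD hg).1
  have hy := hempty (v (k + 1)) fun g hg => (H v e k g hD hg).2
  have key1 : ∀ j, j + 1 < n → j ≠ k → v j ∈ h → v (j + 1) ∈ h → v k ∉ e j ∧ v (k + 1) ∉ e j :=
    fun j hj hjk h1 h2 => H _ _ k (e j) (hD.swap hh h1 h2) (hD.spare_swap hj hjk hh)
  have key2 : ∀ j, j + 1 < n → j ≠ k → v k ∈ e j → v (k + 1) ∈ e j → v j ∉ h ∧ v (j + 1) ∉ h :=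
    fun j hj hjk h1 h2 => H _ _ j h (hD.move hj hjk h1 h2) (hh.move hj hjk)
  set A := leftIn n v h with hA
  set B := rightIn n v h with hB
  set C := usedAt n e (fun t => t = k) (v k) with hC
  set D := usedAt n e (fun t => t = k) (v (k + 1)) with hD'
  have hT : ∀ X ⊆ (Finset.range (n - 1)).erase k, X.card ≤ n - 2 := by
    intro X hX
    have := Finset.card_le_card hX
    rw [Finset.card_erase_of_mem (Finset.mem_range.2 (by omega)), Finset.card_range] at this
    omega
  have hmem : ∀ j, j ∈ A ∪ B ∪ C ∪ D → j ∈ (Finset.range (n - 1)).erase k := by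
    intro j hj
    have hxh := H v e k h hD hh
    simp only [Finset.mem_union, hA, hB, hC, hD', mem_leftIn, mem_rightIn, mem_usedAt] at hj
    rw [Finset.mem_erase, Finset.mem_range]
    refine ⟨?_, by omega⟩
    rintro rfl
    tauto
  have hd1 : Disjoint (A ∪ B) (C ∩ D) := by
    rw [Finset.disjoint_left]
    intro j hj hj'
    simp only [Finset.mem_union, Finset.mem_inter, hA, hB, hC, hD', mem_leftIn, mem_rightIn,
      mem_usedAt] at hj hj'
    have := key2 j hj'.1.1 hj'.1.2.1 hj'.1.2.2 hj'.2.2.2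
    tauto
  have hd2 : Disjoint (A ∩ B) (C ∪ D) := by
    rw [Finset.disjoint_left]
    intro j hj hj'
    simp only [Finset.mem_union, Finset.mem_inter, hA, hB, hC, hD', mem_leftIn, mem_rightIn,
      mem_usedAt] at hj hj'
    have := key1 j hj.1.1 (by tauto) hj.1.2 hj.2.2
    tauto
  have h1 := hT (A ∪ B ∪ C ∩ D) (by
    intro j hj; apply hmem; simp only [Finset.mem_union, Finset.mem_inter] at hj ⊢; tauto)
  have h2 := hT (A ∩ B ∪ (C ∪ D)) (by
    intro j hj; apply hmem; simp only [Finset.mem_union, Finset.mem_inter] at hj ⊢; tauto)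
  rw [Finset.card_union_of_disjoint hd1] at h1
  rw [Finset.card_union_of_disjoint hd2] at h2
  have h3 := Finset.card_union_add_card_inter A B
  have h4 := Finset.card_union_add_card_inter C D
  have := hS.lt_two_mul
  omega

/-- If `f` is an unused edge at the left end and no unused edge contains the right end, the
counting is tight. -/
theorem WideHypergraph.tight_of_not_spare (hS : WideHypergraph E n r) (hN : NoPath E a b n)
    (hD : Defect E a b n v e k) (hf : Spare E n e (fun t => t = k) f) (hx : v k ∈ f)
    (hno : ∀ g, Spare E n e (fun t => t = k) g → v (k + 1) ∉ g) :
    n + 1 = 2 * r ∧ degree E (v (k + 1)) = r - 1 ∧ v (n - 1) ∈ f ∧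
      ∀ l, l + 1 < n → l ≠ k → (v (k + 1) ∈ e l ↔ v l ∉ f) := by
  have hk := hD.2
  have h1 := hS.card_leftIn hD hf.1
  have h2 := hD.1.degree_eq (v (k + 1))
  have h3 := hS.deg (v (k + 1))
  have h4 : unusedAt E n e (fun t => t = k) (v (k + 1)) = ∅ := by
    apply Finset.eq_empty_of_forall_notMem
    intro g hg
    have := mem_unusedAt.1 hg
    exact hno g this.1 this.2
  rw [h4, Finset.card_empty, add_zero] at h2
  have hdis : Disjoint (leftIn n v f) (usedAt n e (fun t => t = k) (v (k + 1))) := by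
    rw [Finset.disjoint_left]
    intro j hj hj'
    have := mem_usedAt.1 hj'
    exact hD.right_not_mem_edge hN hf hx this.1 this.2.1 (mem_leftIn.1 hj).2 this.2.2
  have hsub : leftIn n v f ∪ usedAt n e (fun t => t = k) (v (k + 1)) ⊆ Finset.range (n - 1) := by
    intro j hj
    simp only [Finset.mem_union, mem_leftIn, mem_usedAt] at hj
    rw [Finset.mem_range]; omega
  have h5 := Finset.card_le_card hsub
  rw [Finset.card_union_of_disjoint hdis, Finset.card_range] at h5
  have h6 := hS.lt_two_mul
  have h7 := hS.three_le
  refine ⟨by omega, by omega, ?_, fun l hl hlk => ⟨fun h h' => ?_, fun h => ?_⟩⟩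
  · by_contra h
    have := h1.2 h
    omega
  · exact hD.right_not_mem_edge hN hf hx hl hlk h' h
  · have heq := Finset.eq_of_subset_of_card_le hsub (by
      rw [Finset.card_union_of_disjoint hdis, Finset.card_range]; omega)
    have hmem : l ∈ leftIn n v f ∪ usedAt n e (fun t => t = k) (v (k + 1)) := by
      rw [heq, Finset.mem_range]; omega
    rcases Finset.mem_union.1 hmem with h' | h'
    · exact absurd (mem_leftIn.1 h').2 h
    · exact (mem_usedAt.1 h').2.2

theorem WideHypergraph.cover_of_small (hS : WideHypergraph E n r) (hsm : n + 2 ≤ 2 * r)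
    (hN : NoPath E a b n) (hD : Defect E a b n v e k) (hf : Spare E n e (fun t => t = k) f)
    (hx : v k ∈ f) (hg : Spare E n e (fun t => t = k) g) (hy : v (k + 1) ∈ g) :
    v (n - 1) ∈ f ∧ ∀ l, l + 1 < n → v l ∈ f ∨ v (l + 1) ∈ g := by
  obtain ⟨h1, h2⟩ := hD.card_union_spare hN hf hx hg hy
  have h3 := Finset.card_le_card h2
  rw [Finset.card_range] at h3
  have h4 := hS.card_leftIn hD hf.1
  have h5 := (hS.card_rightIn hD hg.1).1
  have hk := hD.2
  refine ⟨?_, fun l hl => ?_⟩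
  · by_contra h
    have := h4.2 h
    omega
  · have heq := Finset.eq_of_subset_of_card_le h2 (by rw [Finset.card_range]; omega)
    have hmem : l ∈ leftIn n v f ∪ rightIn n v g := by
      rw [heq, Finset.mem_range]; omega
    exact (Finset.mem_union.1 hmem).imp (fun h => (mem_leftIn.1 h).2) fun h => (mem_rightIn.1 h).2

theorem WideHypergraph.exists_spare_right_of_small (hS : WideHypergraph E n r)
    (hsm : n + 2 ≤ 2 * r) (hN : NoPath E a b n) (hD : Defect E a b n v e k)
    (hf : Spare E n e (fun t => t = k) f) (hx : v k ∈ f) :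
    ∃ g, Spare E n e (fun t => t = k) g ∧ v (k + 1) ∈ g := by
  by_contra! hno
  have := (hS.tight_of_not_spare hN hD hf hx hno).1
  omega

theorem WideHypergraph.not_both_ends_of_small (hS : WideHypergraph E n r)
    (hsm : n + 2 ≤ 2 * r) (hN : NoPath E a b n) (hD : Defect E a b n v e k)
    (hf : Spare E n e (fun t => t = k) f) (hx : v k ∈ f) (hp : p + 1 < n) (hpk : p ≠ k)
    (h1 : v k ∈ e p) : v (k + 1) ∉ e p := by
  intro h2
  obtain ⟨g, hg, hy⟩ := hS.exists_spare_right_of_small hsm hN hD hf hx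
  rcases (hS.cover_of_small hsm hN hD hf hx hg hy).2 p hp with h | h
  · exact hD.right_not_mem_edge hN hf hx hp hpk h h2
  · exact hD.left_not_mem_edge hN hg hy hp hpk h h1

theorem WideHypergraph.not_spare_of_small (hS : WideHypergraph E n r)
    (hsm : n + 2 ≤ 2 * r) (hN : NoPath E a b n) (hD : Defect E a b n v e k)
    (hf : Spare E n e (fun t => t = k) f) : v k ∉ f := by
  intro hx
  have hk := hD.2
  obtain ⟨g, hg, hy⟩ := hS.exists_spare_right_of_small hsm hN hD hf hx
  have hcov := hS.cover_of_small hsm hN hD hf hx hg hy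
  have huniq : ∀ f', Spare E n e (fun t => t = k) f' → v k ∈ f' → f' = f := by
    intro f' hf' hx'
    refine hS.eq_of_subset hf'.1 hf.1 fun w hw => ?_
    obtain ⟨t, ht, rfl⟩ := hD.1.exists_eq hS.card_eq w
    by_cases htn : t = n - 1
    · rw [htn]; exact hcov.1
    by_cases htk : t = k
    · rw [htk]; exact hx
    exact (hcov.2 t (by omega)).resolve_right
      (hD.not_mem_right_of_spare hN hf' hx' hg hy (by omega) htk hw)
  have h1 := hD.1.degree_eq (v k)
  have h2 := hS.deg (v k)
  have h3 := hS.three_le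
  have h4 : (unusedAt E n e (fun t => t = k) (v k)).card ≤ 1 := by
    rw [Finset.card_le_one]
    intro s hs t ht
    have hs' := mem_unusedAt.1 hs
    have ht' := mem_unusedAt.1 ht
    rw [huniq s hs'.1 hs'.2, huniq t ht'.1 ht'.2]
  obtain ⟨i, hi⟩ : (usedAt n e (fun t => t = k) (v k)).Nonempty := by
    rw [← Finset.card_pos]; omega
  obtain ⟨hi, hik, hxi⟩ := mem_usedAt.1 hi
  have hif : v i ∈ f := (hcov.2 i hi).resolve_right
    fun h => hD.left_not_mem_edge hN hg hy hi hik h hxi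
  obtain ⟨z, hz, hzf⟩ : ∃ z ∈ e i, z ∉ f := by
    by_contra! h
    exact hf.2 i hi hik (hS.eq_of_subset (hD.1.mem i hi hik) hf.1 h)
  obtain ⟨l, hl, rfl⟩ := hD.1.exists_eq hS.card_eq z
  have hln : l ≠ n - 1 := by rintro rfl; exact hzf hcov.1
  have hlk : l ≠ k := by rintro rfl; exact hzf hx
  have hil : i ≠ l := by rintro rfl; exact hzf hif
  have hlg := (hcov.2 l (by omega)).resolve_left hzf
  obtain ⟨v', e', p, k', hD', hp, hpk, h5, h6, h7, h8⟩ :=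
    hD.transfer hi (by omega) hik hlk hil hxi hz (hg.or_left l) hy hlg
  have hf' := h8 f hf (by rintro rfl; exact hD.not_mem_both hN hf hx hy)
  have hk' := hD'.2
  rcases h7 with ⟨h7, -⟩ | ⟨-, h7⟩
  · exact hS.not_both_ends_of_small hsm hN hD' hf' (h7 ▸ hif) hp hpk h5 h6
  · refine hS.not_both_ends_of_small (p := n - 2 - p) hsm hN.symm hD'.mirror
      ((Spare.mirror_iff_single hk').2 hf') ?_ (by omega) (by omega) ?_ ?_
    · rwa [show n - 1 - (n - 2 - k') = k' + 1 by omega, h7]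
    · rwa [show n - 1 - (n - 2 - k') = k' + 1 by omega, show n - 2 - (n - 2 - p) = p by omega]
    · rwa [show n - 1 - (n - 2 - k' + 1) = k' by omega, show n - 2 - (n - 2 - p) = p by omega]

theorem WideHypergraph.mem_pred_of_cover (hS : WideHypergraph E n r) (hN : NoPath E a b n)
    (hD : Defect E a b n v e k) (hf : Spare E n e (fun t => t = k) f) (hx : v k ∈ f)
    (hg : Spare E n e (fun t => t = k) g) (hy : v (k + 1) ∈ g) (hlast : v (n - 1) ∈ f)
    (hcov : ∀ l, l + 1 < n → l ≠ p → v l ∈ f ∨ v (l + 1) ∈ g) (hk0 : 0 < k) (hp : p ≠ k - 1) :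
    v (k - 1) ∈ f ∧ v p ∈ e (k - 1) := by
  have hk := hD.2
  have hke : v k ∈ e (k - 1) := by
    simpa [show k - 1 + 1 = k by omega] using hD.1.right (k - 1) (by omega) (by omega)
  have h1 : v (k - 1) ∈ f := (hcov (k - 1) (by omega) hp.symm).resolve_right
    fun h => hD.left_not_mem_edge hN hg hy (by omega) (by omega) h hke
  refine ⟨h1, ?_⟩
  have hgf : g ≠ f := by rintro rfl; exact hD.not_mem_both hN hg hx hy
  have h2 : v (k - 1 + 1) ∈ f := by rwa [show k - 1 + 1 = k by omega]
  by_contra hpe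
  refine hf.2 (k - 1) (by omega) (by omega)
    (hS.eq_of_subset (hD.1.mem _ (by omega) (by omega)) hf.1 fun w hw => ?_)
  obtain ⟨t, ht, rfl⟩ := hD.1.exists_eq hS.card_eq w
  by_cases htn : t = n - 1
  · rw [htn]; exact hlast
  by_cases htk : t = k
  · rw [htk]; exact hx
  refine (hcov t (by omega) (by rintro rfl; exact hpe hw)).resolve_right ?_
  exact (hD.swap hf h1 h2).not_mem_right_of_spare hN
    (hD.spare_swap (by omega) (by omega) hf) hke (hg.swap hgf) hy (by omega) htk hw

theorem WideHypergraph.mem_succ_of_cover (hS : WideHypergraph E n r) (hN : NoPath E a b n)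
    (hD : Defect E a b n v e k) (hf : Spare E n e (fun t => t = k) f) (hx : v k ∈ f)
    (hg : Spare E n e (fun t => t = k) g) (hy : v (k + 1) ∈ g) (hfirst : v 0 ∈ g)
    (hp1 : p + 1 < n)
    (hcov : ∀ l, l + 1 < n → l ≠ p → v l ∈ f ∨ v (l + 1) ∈ g) (hk2 : k + 2 < n)
    (hp : p ≠ k + 1) : v (k + 2) ∈ g ∧ v (p + 1) ∈ e (k + 1) := by
  have hk := hD.2
  have := hS.mem_pred_of_cover (p := n - 2 - p) hN.symm hD.mirror
    ((Spare.mirror_iff_single hk).2 hg)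
    (by rwa [show n - 1 - (n - 2 - k) = k + 1 by omega])
    ((Spare.mirror_iff_single hk).2 hf)
    (by rwa [show n - 1 - (n - 2 - k + 1) = k by omega]) (by rwa [Nat.sub_self])
    (fun l hl hlp => by
      rw [show n - 1 - (l + 1) = n - 2 - l by omega, show n - 1 - l = n - 2 - l + 1 by omega]
      exact (hcov (n - 2 - l) (by omega) (by omega)).symm) (by omega) (by omega)
  rwa [show n - 1 - (n - 2 - k - 1) = k + 2 by omega, show n - 1 - (n - 2 - p) = p + 1 by omega,
    show n - 2 - (n - 2 - k - 1) = k + 1 by omega] at this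

theorem WideHypergraph.not_cover (hS : WideHypergraph E n r) (hn : 2 < n) (hN : NoPath E a b n)
    (hD : Defect E a b n v e k) (hf : Spare E n e (fun t => t = k) f) (hx : v k ∈ f)
    (hg : Spare E n e (fun t => t = k) g) (hy : v (k + 1) ∈ g) (hlast : v (n - 1) ∈ f) :
    ¬ ∀ l, l + 1 < n → v l ∈ f ∨ v (l + 1) ∈ g := by
  intro hcov
  have hk := hD.2
  rcases Nat.eq_zero_or_pos k with rfl | hk0
  · have h1 : v 1 ∈ e 1 := hD.1.left 1 hn (by omega)
    have h2 : v (1 + 1) ∈ g := (hcov 1 hn).resolve_left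
      fun h => hD.right_not_mem_edge hN hf hx hn (by omega) h h1
    have hfg : f ≠ g := by rintro rfl; exact hD.not_mem_both hN hf hx hy
    have hD' := hD.swap (i := 1) hg hy h2
    have hs := hD.spare_swap hn (by omega) hg
    refine hg.2 1 hn (by omega) (hS.eq_of_subset (hD.1.mem _ hn (by omega)) hg.1 fun w hw => ?_)
    obtain ⟨t, ht, rfl⟩ := hD.1.exists_eq hS.card_eq w
    rcases t with _ | t
    · exact absurd h1 (hD'.not_mem_both hN hs hw)
    by_cases ht0 : t = 0
    · rw [ht0]; exact hy
    refine (hcov t ht).resolve_left fun h => ?_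
    exact hD'.not_mem_right_of_spare hN (hf.swap hfg) hx hs h1 ht ht0 h hw
  · obtain ⟨p, hp, hpe⟩ : ∃ p, p ≠ k - 1 ∧ v p ∉ e (k - 1) := by
      refine ⟨k + 1, by omega, fun h => ?_⟩
      have hke : v k ∈ e (k - 1) := by
        simpa [show k - 1 + 1 = k by omega] using hD.1.right (k - 1) (by omega) (by omega)
      have h1 : v (k - 1) ∈ f := (hcov (k - 1) (by omega)).resolve_right
        fun h => hD.left_not_mem_edge hN hg hy (by omega) (by omega) h hke
      exact hD.right_not_mem_edge hN hf hx (by omega) (by omega) h1 h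
    exact hpe (hS.mem_pred_of_cover hN hD hf hx hg hy hlast (fun l hl _ => hcov l hl) hk0 hp).2

/-- Unused edges cannot occur at both ends of a defect. -/
theorem WideHypergraph.not_spare_both (hS : WideHypergraph E n r) (hN : NoPath E a b n)
    (hD : Defect E a b n v e k) (hf : Spare E n e (fun t => t = k) f) (hx : v k ∈ f)
    (hg : Spare E n e (fun t => t = k) g) : v (k + 1) ∉ g := by
  intro hy
  have hk := hD.2
  by_cases hsm : n + 2 ≤ 2 * r
  · exact hS.not_spare_of_small hsm hN hD hf hx
  have hlt := hS.lt_two_mul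
  have hr := hS.three_le
  obtain ⟨h1, h2⟩ := hD.card_union_spare hN hf hx hg hy
  have h3 := Finset.card_le_card h2
  rw [Finset.card_range] at h3
  have h4 := hS.card_leftIn hD hf.1
  have h5 := hS.card_rightIn hD hg.1
  have hall : n - 1 ≤ (leftIn n v f ∪ rightIn n v g).card →
      ∀ l, l + 1 < n → v l ∈ f ∨ v (l + 1) ∈ g := by
    intro hc l hl
    have heq := Finset.eq_of_subset_of_card_le h2 (by rwa [Finset.card_range])
    have hmem : l ∈ leftIn n v f ∪ rightIn n v g := by
      rw [heq, Finset.mem_range]; omega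
    exact (Finset.mem_union.1 hmem).imp (fun h => (mem_leftIn.1 h).2) fun h => (mem_rightIn.1 h).2
  by_cases hlast : v (n - 1) ∈ f
  swap
  · have h6 := h4.2 hlast
    have hfirst : v 0 ∈ g := by
      by_contra h
      have := h5.2 h
      omega
    refine hS.not_cover (by omega) hN.symm hD.mirror ((Spare.mirror_iff_single hk).2 hg)
      (by rwa [show n - 1 - (n - 2 - k) = k + 1 by omega])
      ((Spare.mirror_iff_single hk).2 hf)
      (by rwa [show n - 1 - (n - 2 - k + 1) = k by omega]) (by rwa [Nat.sub_self])
      fun l hl => ?_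
    rw [show n - 1 - (l + 1) = n - 2 - l by omega, show n - 1 - l = n - 2 - l + 1 by omega]
    exact (hall (by omega) (n - 2 - l) (by omega)).symm
  by_cases hfirst : v 0 ∈ g
  swap
  · have h6 := h5.2 hfirst
    exact hS.not_cover (by omega) hN hD hf hx hg hy hlast (hall (by omega))
  by_cases hc : n - 1 ≤ (leftIn n v f ∪ rightIn n v g).card
  · exact hS.not_cover (by omega) hN hD hf hx hg hy hlast (hall hc)
  obtain ⟨p, hp⟩ : ∃ p, Finset.range (n - 1) \ (leftIn n v f ∪ rightIn n v g) = {p} := by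
    rw [← Finset.card_eq_one, Finset.card_sdiff_of_subset h2, Finset.card_range]
    omega
  have hpmem : ∀ l, l + 1 < n → ¬ v l ∈ f → ¬ v (l + 1) ∈ g → l = p := by
    intro l hl hl1 hl2
    rw [← Finset.mem_singleton, ← hp]
    simp only [Finset.mem_sdiff, Finset.mem_range, Finset.mem_union, mem_leftIn, mem_rightIn]
    exact ⟨by omega, by tauto⟩
  have hcov : ∀ l, l + 1 < n → l ≠ p → v l ∈ f ∨ v (l + 1) ∈ g := by
    intro l hl hlp
    by_contra! h
    exact hlp (hpmem l hl h.1 h.2)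
  have hp1 : p + 1 < n ∧ p ≠ k := by
    have : p ∈ Finset.range (n - 1) \ (leftIn n v f ∪ rightIn n v g) := by simp [hp]
    simp only [Finset.mem_sdiff, Finset.mem_range, Finset.mem_union, mem_leftIn,
      mem_rightIn] at this
    refine ⟨by omega, ?_⟩
    rintro rfl
    exact this.2 (Or.inl ⟨hk, hx⟩)
  have hk0 : 0 < k := by
    rcases Nat.eq_zero_or_pos k with rfl | h
    · exact absurd hy (hD.not_mem_both hN hg hfirst)
    · exact h
  have hk2 : k + 2 < n := by
    by_contra h
    rw [show n - 1 = k + 1 by omega] at hlast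
    exact hD.not_mem_both hN hf hx hlast
  have hL := hS.mem_pred_of_cover hN hD hf hx hg hy hlast hcov hk0
  have hR := hS.mem_succ_of_cover hN hD hf hx hg hy hfirst hp1.1 hcov hk2
  have hke : v k ∈ e (k - 1) := by
    simpa [show k - 1 + 1 = k by omega] using hD.1.right (k - 1) (by omega) (by omega)
  have hke' : v (k + 1) ∈ e (k + 1) := hD.1.left (k + 1) hk2 (by omega)
  have hx' : v (k - 1 + 1) ∈ f := by rwa [show k - 1 + 1 = k by omega]
  have hgf : g ≠ f := by rintro rfl; exact hD.not_mem_both hN hg hx hy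
  by_cases hpl : p = k - 1
  · obtain ⟨q1, q2⟩ := hR (by omega)
    rw [show p + 1 = k by omega] at q2
    exact (hD.swap hg hy q1).not_mem_both hN (hD.spare_swap (by omega) (by omega) hg) q2 hke'
  by_cases hpr : p = k + 1
  · obtain ⟨q1, q2⟩ := hL hpl
    rw [hpr] at q2
    exact (hD.swap hf q1 hx').not_mem_both hN (hD.spare_swap (by omega) (by omega) hf) hke q2
  obtain ⟨q1, q2⟩ := hL hpl
  obtain ⟨q3, q4⟩ := hR hpr
  have hD' := hD.swap hf q1 hx'
  have hg' := hg.swap (i := k - 1) hgf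
  have hs := hD.spare_swap (i := k - 1) (by omega) (by omega) hf
  have hs' := hD'.spare_swap (i := k + 1) (by omega) (by omega) hg'
  rw [Function.update_of_ne (by omega)] at hs'
  refine (hD'.swap hg' hy q3).not_mem_right_of_spare hN
    (hs.swap (i := k + 1) ?_) hke hs' hke' hp1.1 hp1.2 q2 q4
  rintro rfl
  exact hD.not_mem_both hN hg hke hy

/-- If `f` is an unused edge at the left end, the counting is tight. -/
theorem WideHypergraph.tight (hS : WideHypergraph E n r) (hN : NoPath E a b n)
    (hD : Defect E a b n v e k) (hf : Spare E n e (fun t => t = k) f) (hx : v k ∈ f) :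
    n + 1 = 2 * r ∧ degree E (v (k + 1)) = r - 1 ∧ v (n - 1) ∈ f ∧
      ∀ l, l + 1 < n → l ≠ k → (v (k + 1) ∈ e l ↔ v l ∉ f) :=
  hS.tight_of_not_spare hN hD hf hx fun _ hg => hS.not_spare_both hN hD hf hx hg

theorem WideHypergraph.tight_mirror (hS : WideHypergraph E n r) (hN : NoPath E a b n)
    (hD : Defect E a b n v e k) (hf : Spare E n e (fun t => t = k) f) (hy : v (k + 1) ∈ f) :
    n + 1 = 2 * r ∧ degree E (v k) = r - 1 ∧ v 0 ∈ f ∧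
      ∀ l, l + 1 < n → l ≠ k → (v k ∈ e l ↔ v (l + 1) ∉ f) := by
  have hk := hD.2
  obtain ⟨h1, h2, h3, h4⟩ := hS.tight hN.symm hD.mirror ((Spare.mirror_iff_single hk).2 hf)
    (by rwa [show n - 1 - (n - 2 - k) = k + 1 by omega])
  rw [show n - 1 - (n - 2 - k + 1) = k by omega] at h2 h4
  rw [Nat.sub_self] at h3
  refine ⟨h1, h2, h3, fun l hl hlk => ?_⟩
  have := h4 (n - 2 - l) (by omega) (by omega)
  rwa [show n - 2 - (n - 2 - l) = l by omega, show n - 1 - (n - 2 - l) = l + 1 by omega] at this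

end WideHypergraph

/-- A set of at least `r` pairwise nonconsecutive numbers below `2 * r - 1` consists of the even
ones. -/
theorem mem_iff_even_of_not_consecutive {r : ℕ} {S : Finset ℕ} (hlt : ∀ t ∈ S, t + 1 < 2 * r)
    (hcard : r ≤ S.card) (hc : ∀ t ∈ S, t + 1 ∉ S) {t : ℕ} (ht : t + 1 < 2 * r) :
    t ∈ S ↔ t % 2 = 0 := by
  have hinj : Set.InjOn (fun t : ℕ => t / 2) S := by
    intro s hs t ht h
    have h' : s / 2 = t / 2 := h
    by_contra hne
    rcases lt_or_gt_of_ne hne with hlt | hlt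
    · exact hc s hs (by rwa [show s + 1 = t by omega])
    · exact hc t ht (by rwa [show t + 1 = s by omega])
  have himg : S.image (fun t : ℕ => t / 2) = Finset.range r := by
    apply Finset.eq_of_subset_of_card_le
    · intro j hj
      obtain ⟨t, ht, rfl⟩ := Finset.mem_image.1 hj
      have := hlt t ht
      rw [Finset.mem_range]; omega
    · rwa [Finset.card_range, Finset.card_image_of_injOn hinj]
  have hpair : ∀ s, s + 1 < 2 * r → s % 2 = 0 → s ∈ S ∨ s + 1 ∈ S := by
    intro s hs h0
    have : s / 2 ∈ S.image (fun t : ℕ => t / 2) := by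
      rw [himg, Finset.mem_range]; omega
    obtain ⟨t, ht, h⟩ := Finset.mem_image.1 this
    have h' : t / 2 = s / 2 := h
    rcases (by omega : t = s ∨ t = s + 1) with rfl | rfl
    · exact Or.inl ht
    · exact Or.inr ht
  have hodd : ∀ d s, s ∈ S → s % 2 = 1 → 2 * r ≠ s + 2 * d + 3 := by
    intro d
    induction d with
    | zero =>
      intro s hs h1 h2
      rcases hpair (s + 1) (by omega) (by omega) with h | h
      · exact hc s hs h
      · have := hlt _ h; omega
    | succ d ih =>
      intro s hs h1 h2
      rcases hpair (s + 1) (by omega) (by omega) with h | h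
      · exact hc s hs h
      · exact ih (s + 2) h (by omega) (by omega)
  have hno : ∀ s ∈ S, s % 2 = 0 := by
    intro s hs
    by_contra h
    have := hlt s hs
    exact hodd ((2 * r - s - 3) / 2) s hs (by omega) (by omega)
  refine ⟨hno t, fun h => (hpair t ht h).resolve_right fun h' => ?_⟩
  have := hno _ h'
  omega

section WideRotation

variable {V : Type*} {E : Finset (Finset V)} {a b : V} {n : ℕ} {v : ℕ → V}
  {e : ℕ → Finset V} {k i : ℕ} {f : Finset V}

theorem Defect.exists_rotation_of_lt (hD : Defect E a b n v e k)
    (hf : Spare E n e (fun t => t = k) f) (hx : v k ∈ f) (hik : i < k) (hi : v i ∈ f) :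
    ∃ v' e', Defect E a b n v' e' k ∧ Spare E n e' (fun t => t = k) (e i) ∧
      (∀ t, t ≤ i ∨ k < t → v' t = v t) ∧ (∀ t, i < t → t ≤ k → v' t = v (i + k + 1 - t)) ∧
      (∀ t, t < i ∨ k < t → e' t = e t) ∧ ∀ t, i < t → t < k → e' t = e (i + k - t) := by
  refine ⟨_, _, hD.rotate_left hik hD.2 (Or.inr rfl) hf hi hx,
    (hD.spare_rotate_iff hik hD.2 (Or.inr ⟨rfl, rfl⟩) (Or.inl ⟨rfl, rfl⟩) hf).2 (Or.inl rfl),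
    fun t ht => ?_, fun t h1 h2 => ?_, fun t ht => ?_, fun t h1 h2 => ?_⟩
  · rw [revPos_out ht]
  · rw [revPos_in h1 h2]
  · rw [Function.update_of_ne (by omega), revLab_out (by omega)]
  · rw [Function.update_of_ne (by omega), revLab_in h1 h2]

theorem Defect.exists_rotation_of_gt (hD : Defect E a b n v e k)
    (hf : Spare E n e (fun t => t = k) f) (hx : v k ∈ f) (hki : k < i) (hin : i + 1 < n)
    (hi : v i ∈ f) :
    ∃ v' e', Defect E a b n v' e' i ∧ Spare E n e' (fun t => t = i) (e i) ∧
      (∀ t, t ≤ k ∨ i < t → v' t = v t) ∧ v' i = v (k + 1) ∧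
      ∀ t, t < k ∨ i < t → e' t = e t := by
  refine ⟨_, _, hD.rotate_left hki hin (Or.inl rfl) hf hx hi,
    (hD.spare_rotate_iff hki hin (Or.inl ⟨rfl, rfl⟩) (Or.inl ⟨rfl, rfl⟩) hf).2 (Or.inl rfl),
    fun t ht => ?_, ?_, fun t ht => ?_⟩
  · rw [revPos_out ht]
  · rw [revPos_in hki le_rfl, show k + i + 1 - i = k + 1 by omega]
  · rw [Function.update_of_ne (by omega), revLab_out (by omega)]

end WideRotation

section WideTight

variable {V : Type*} [Fintype V] [DecidableEq V] {E : Finset (Finset V)} {a b : V} {n r : ℕ}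
  {v : ℕ → V} {e : ℕ → Finset V} {k i : ℕ} {f g : Finset V}

theorem WideHypergraph.spare_unique (hS : WideHypergraph E n r) (hN : NoPath E a b n)
    (hD : Defect E a b n v e k) (hf : Spare E n e (fun t => t = k) f) (hx : v k ∈ f)
    (hg : Spare E n e (fun t => t = k) g) (hx' : v k ∈ g) : g = f := by
  obtain ⟨-, -, hlast, hiff⟩ := hS.tight hN hD hf hx
  obtain ⟨-, -, -, hiff'⟩ := hS.tight hN hD hg hx'
  refine hS.eq_of_subset hg.1 hf.1 fun w hw => ?_
  obtain ⟨t, ht, rfl⟩ := hD.1.exists_eq hS.card_eq w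
  by_cases htn : t = n - 1
  · rw [htn]; exact hlast
  by_cases htk : t = k
  · rw [htk]; exact hx
  by_contra h
  exact (hiff' t (by omega) htk).1 ((hiff t (by omega) htk).2 h) hw

theorem WideHypergraph.left_not_mem_of_consecutive (hS : WideHypergraph E n r)
    (hN : NoPath E a b n) (hD : Defect E a b n v e k) (hf : Spare E n e (fun t => t = k) f)
    (hx : v k ∈ f) (hi : i + 1 < n) (hik : i ≠ k) (h1 : v i ∈ f) (h2 : v (i + 1) ∈ f) :
    v k ∉ e i := by
  intro h
  obtain ⟨-, -, hlast, hiff⟩ := hS.tight hN hD hf hx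
  obtain ⟨-, -, -, hiff'⟩ := hS.tight hN (hD.swap hf h1 h2) (hD.spare_swap hi hik hf) h
  refine hf.2 i hi hik (hS.eq_of_subset (hD.1.mem i hi hik) hf.1 fun w hw => ?_)
  obtain ⟨t, ht, rfl⟩ := hD.1.exists_eq hS.card_eq w
  by_cases htn : t = n - 1
  · rw [htn]; exact hlast
  by_cases htk : t = k
  · rw [htk]; exact hx
  by_cases hti : t = i
  · rw [hti]; exact h1
  have := hiff' t (by omega) htk
  rw [Function.update_of_ne hti] at this
  by_contra h
  exact this.1 ((hiff t (by omega) htk).2 h) hw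

theorem WideHypergraph.pred_not_mem (hS : WideHypergraph E n r) (hN : NoPath E a b n)
    (hD : Defect E a b n v e k) (hf : Spare E n e (fun t => t = k) f) (hx : v k ∈ f)
    (hk0 : 0 < k) : v (k - 1) ∉ f ∧ v k ∈ e (k - 1) ∧ v (k + 1) ∈ e (k - 1) := by
  have hk := hD.2
  have hke : v k ∈ e (k - 1) := by
    simpa [show k - 1 + 1 = k by omega] using hD.1.right (k - 1) (by omega) (by omega)
  have h : v (k - 1) ∉ f := fun h => hS.left_not_mem_of_consecutive hN hD hf hx (by omega)
    (by omega) h (by rwa [show k - 1 + 1 = k by omega]) hke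
  exact ⟨h, hke, ((hS.tight hN hD hf hx).2.2.2 (k - 1) (by omega) (by omega)).2 h⟩

theorem WideHypergraph.first_mem (hS : WideHypergraph E n r) (hN : NoPath E a b n)
    (hD : Defect E a b n v e k) (hf : Spare E n e (fun t => t = k) f) (hx : v k ∈ f)
    (hk0 : 0 < k) : v 0 ∈ f := by
  have hk := hD.2
  obtain ⟨-, h1, h2⟩ := hS.pred_not_mem hN hD hf hx hk0
  exact (hS.tight_mirror hN (hD.move (by omega) (by omega) h1 h2)
    (hf.move (by omega) (by omega)) (by rwa [show k - 1 + 1 = k by omega])).2.2.1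

theorem WideHypergraph.left_mem_succ (hS : WideHypergraph E n r) (hN : NoPath E a b n)
    (hD : Defect E a b n v e k) (hf : Spare E n e (fun t => t = k) f) (hy : v (k + 1) ∈ f)
    (hk2 : k + 2 < n) : v k ∈ e (k + 1) ∧ v (n - 1) ∈ f := by
  have hk := hD.2
  have hf' := (Spare.mirror_iff_single hk).2 hf
  have hy' : v (n - 1 - (n - 2 - k)) ∈ f := by rwa [show n - 1 - (n - 2 - k) = k + 1 by omega]
  have h1 := (hS.pred_not_mem hN.symm hD.mirror hf' hy' (by omega)).2.2
  have h2 := hS.first_mem hN.symm hD.mirror hf' hy' (by omega)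
  rw [show n - 1 - (n - 2 - k + 1) = k by omega,
    show n - 2 - (n - 2 - k - 1) = k + 1 by omega] at h1
  exact ⟨h1, h2⟩

theorem WideHypergraph.succ_not_mem (hS : WideHypergraph E n r) (hN : NoPath E a b n)
    (hD : Defect E a b n v e k) (hf : Spare E n e (fun t => t = k) f) (hx : v k ∈ f)
    (hi : i + 2 < n) (hik : i ≠ k) (h1 : v i ∈ f) : v (i + 1) ∉ f := by
  have hk := hD.2
  have hiff := (hS.tight hN hD hf hx).2.2.2
  rcases lt_or_gt_of_ne hik with hlt | hlt
  · have hik1 : i + 1 ≠ k := by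
      rintro rfl
      exact (hS.pred_not_mem hN hD hf hx (by omega)).1 h1
    obtain ⟨v', e', hD', hs, q1, q2, q3, q4⟩ := hD.exists_rotation_of_lt hf hx hlt h1
    have hvk : v' k = v (i + 1) := by
      rw [q2 k hlt le_rfl, show i + k + 1 - k = i + 1 by omega]
    have h2 := (hS.pred_not_mem hN hD' hs
      (by rw [hvk]; exact hD.1.right i (by omega) hik) (by omega)).2.2
    rw [q1 (k + 1) (by omega), q4 (k - 1) (by omega) (by omega),
      show i + k - (k - 1) = i + 1 by omega] at h2
    exact (hiff (i + 1) (by omega) hik1).1 h2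
  · obtain ⟨v', e', hD', hs, q1, q2, q3⟩ := hD.exists_rotation_of_gt hf hx hlt (by omega) h1
    have h2 := (hS.left_mem_succ hN hD' hs
      (by rw [q1 (i + 1) (by omega)]; exact hD.1.right i (by omega) hik) hi).1
    rw [q2, q3 (i + 1) (by omega)] at h2
    exact (hiff (i + 1) (by omega) (by omega)).1 h2

theorem WideHypergraph.pos_of_spare (hS : WideHypergraph E n r) (hN : NoPath E a b n)
    (hD : Defect E a b n v e k) (hf : Spare E n e (fun t => t = k) f) (hx : v k ∈ f) :
    0 < k := by
  by_contra hk0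
  obtain rfl : k = 0 := by omega
  obtain ⟨hnr, -, hlast, hiff⟩ := hS.tight hN hD hf hx
  have hr := hS.three_le
  have hpen : v (n - 2) ∉ f := by
    intro h
    obtain ⟨v', e', hD', hs, q1, q2, q3⟩ :=
      hD.exists_rotation_of_gt hf hx (i := n - 2) (by omega) (by omega) h
    have h1 := (hS.tight_mirror hN hD' hs
      (by rw [q1 _ (by omega)]; exact hD.1.right (n - 2) (by omega) (by omega))).2.2.1
    rw [q1 0 (by omega)] at h1
    exact hS.left_not_mem_of_consecutive hN hD hf hx (by omega) (by omega) h
      (by rwa [show n - 2 + 1 = n - 1 by omega]) h1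
  obtain ⟨i, hi, hi0⟩ : ∃ i ∈ leftIn n v f, i ≠ 0 := by
    have h1 := (hS.card_leftIn hD hf.1).1
    exact Finset.exists_mem_ne (by omega) 0
  obtain ⟨hin, hif⟩ := mem_leftIn.1 hi
  have hi2 : i ≠ n - 2 := by rintro rfl; exact hpen hif
  obtain ⟨v', e', hD', hs, q1, q2, q3⟩ := hD.exists_rotation_of_gt hf hx (by omega) hin hif
  have hright : v' (i + 1) ∈ e i := by
    rw [q1 _ (by omega)]; exact hD.1.right i hin hi0
  have h1 := (hS.left_mem_succ hN hD' hs hright (by omega)).2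
  have h2 := (hS.tight_mirror hN hD' hs hright).2.2.2 (n - 2) (by omega) (by omega)
  rw [q2, q3 (n - 2) (by omega), show n - 2 + 1 = n - 1 by omega] at h2
  exact h2.1 ((hiff (n - 2) (by omega) (by omega)).2 hpen) h1

theorem WideHypergraph.lt_of_spare (hS : WideHypergraph E n r) (hN : NoPath E a b n)
    (hD : Defect E a b n v e k) (hf : Spare E n e (fun t => t = k) f) (hy : v (k + 1) ∈ f) :
    k + 2 < n := by
  have hk := hD.2
  have := hS.pos_of_spare hN.symm hD.mirror ((Spare.mirror_iff_single hk).2 hf)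
    (by rwa [show n - 1 - (n - 2 - k) = k + 1 by omega])
  omega

/-- An unused edge at the left end of a defect occupies the even positions. -/
theorem WideHypergraph.mem_iff_even (hS : WideHypergraph E n r) (hN : NoPath E a b n)
    (hD : Defect E a b n v e k) (hf : Spare E n e (fun t => t = k) f) (hx : v k ∈ f)
    {t : ℕ} (ht : t < n) : v t ∈ f ↔ t % 2 = 0 := by
  have hk := hD.2
  obtain ⟨hnr, -, hlast, -⟩ := hS.tight hN hD hf hx
  have hr := hS.three_le
  have hy := hD.not_mem_both hN hf hx
  have hpen : v (n - 2) ∉ f := by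
    intro h
    have hkn : k ≠ n - 2 := by
      rintro rfl
      exact hy (by rwa [show n - 2 + 1 = n - 1 by omega])
    obtain ⟨v', e', hD', hs, q1, q2, q3⟩ :=
      hD.exists_rotation_of_gt hf hx (i := n - 2) (by omega) (by omega) h
    have := hS.lt_of_spare hN hD' hs
      (by rw [q1 _ (by omega)]; exact hD.1.right (n - 2) (by omega) hkn.symm)
    omega
  obtain ⟨S, hcard, hmem⟩ : ∃ S : Finset ℕ, r ≤ S.card ∧ ∀ s, s ∈ S ↔ s < n ∧ v s ∈ f := by
    refine ⟨_, (hS.unif f hf.1).symm.trans_le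
      (hD.1.card_positions (S := f) fun z _ => hD.1.exists_eq hS.card_eq z).ge, fun s => ?_⟩
    simp
  rw [← mem_iff_even_of_not_consecutive (r := r) (S := S)
    (fun s hs => by have := (hmem s).1 hs; omega) hcard (fun s hs hs' => ?_) (by omega), hmem]
  · simp [ht]
  · rw [hmem] at hs hs'
    rcases eq_or_ne s k with rfl | hsk
    · exact hy hs'.2
    by_cases hsn : s + 2 < n
    · exact hS.succ_not_mem hN hD hf hx hsn hsk hs.2 hs'.2
    · exact hpen (by rw [show n - 2 = s by omega]; exact hs.2)

theorem WideHypergraph.left_not_mem_even (hS : WideHypergraph E n r) (hN : NoPath E a b n)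
    (hD : Defect E a b n v e k) (hf : Spare E n e (fun t => t = k) f) (hx : v k ∈ f)
    (hi : i + 1 < n) (hik : i ≠ k) (hi2 : i % 2 = 0) : v k ∉ e i := by
  have hk := hD.2
  have hk0 := hS.pos_of_spare hN hD hf hx
  have hke := (hS.pred_not_mem hN hD hf hx hk0).2.2
  have hk2 := (hS.mem_iff_even hN hD hf hx (by omega)).1 hx
  have hif := (hS.mem_iff_even hN hD hf hx (t := i) (by omega)).2 hi2
  rcases lt_or_gt_of_ne hik with hlt | hlt
  · obtain ⟨v', e', hD', hs, q1, q2, q3, q4⟩ := hD.exists_rotation_of_lt hf hx hlt hif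
    have hvk : v' k = v (i + 1) := by
      rw [q2 k hlt le_rfl, show i + k + 1 - k = i + 1 by omega]
    have h := (hS.tight hN hD' hs (by rw [hvk]; exact hD.1.right i hi hik)).2.2.2 (i + 1)
      (by omega) (by omega)
    rw [q1 (k + 1) (by omega), q2 (i + 1) (by omega) (by omega), q4 (i + 1) (by omega) (by omega),
      show i + k + 1 - (i + 1) = k by omega, show i + k - (i + 1) = k - 1 by omega] at h
    exact h.1 hke
  · obtain ⟨v', e', hD', hs, q1, q2, q3⟩ := hD.exists_rotation_of_gt hf hx hlt hi hif
    have h := (hS.tight_mirror hN hD' hs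
      (by rw [q1 _ (by omega)]; exact hD.1.right i hi hik)).2.2.2 (k - 1) (by omega) (by omega)
    rw [q2, q3 (k - 1) (by omega), show k - 1 + 1 = k by omega, q1 k (by omega)] at h
    exact h.1 hke

theorem WideHypergraph.not_spare_left (hS : WideHypergraph E n r)
    (hbig : 4 ≤ r ∨ ∀ z, r ≤ degree E z) (hN : NoPath E a b n)
    (hD : Defect E a b n v e k) (hf : Spare E n e (fun t => t = k) f) : v k ∉ f := by
  intro hx
  have hk := hD.2
  obtain ⟨hnr, hdeg, hlast, hiff⟩ := hS.tight hN hD hf hx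
  have hr := hS.three_le
  have hr4 : 4 ≤ r := by
    refine hbig.resolve_right fun h => ?_
    have := h (v (k + 1))
    omega
  have heven : ∀ t, t < n → (v t ∈ f ↔ t % 2 = 0) := fun t ht => hS.mem_iff_even hN hD hf hx ht
  have hk0 := hS.pos_of_spare hN hD hf hx
  have hk2 := (heven k (by omega)).1 hx
  have h1 := hD.1.degree_eq (v k)
  have h2 := hS.deg (v k)
  have h4 : (unusedAt E n e (fun t => t = k) (v k)).card ≤ 1 := by
    rw [Finset.card_le_one]
    intro s hs t ht
    have hs' := mem_unusedAt.1 hs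
    have ht' := mem_unusedAt.1 ht
    exact hS.spare_unique hN hD ht'.1 ht'.2 hs'.1 hs'.2
  obtain ⟨j, hj, hjk1⟩ : ∃ j ∈ usedAt n e (fun t => t = k) (v k), j ≠ k - 1 :=
    Finset.exists_mem_ne (by omega) _
  obtain ⟨hj, hjk, hxj⟩ := mem_usedAt.1 hj
  have hj2 : j % 2 = 1 := by
    by_contra h
    exact hS.left_not_mem_even hN hD hf hx hj hjk (by omega) hxj
  have hyj : v (k + 1) ∈ e j := (hiff j hj hjk).2 fun h => by
    have := (heven j (by omega)).1 h; omega
  have hmove := (hS.tight_mirror hN (hD.move hj hjk hxj hyj) (hf.move hj hjk)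
    ((heven (j + 1) hj).2 (by omega))).2.2.2 (k - 2) (by omega) (by omega)
  rw [Function.update_of_ne (by omega), show k - 2 + 1 = k - 1 by omega] at hmove
  have hvj : v j ∈ e (k - 2) := hmove.2 fun h => by
    have := (heven (k - 1) (by omega)).1 h; omega
  obtain ⟨v', e', hD', hs, q1, q2, q3, q4⟩ := hD.exists_rotation_of_lt hf hx (i := k - 2)
    (by omega) ((heven _ (by omega)).2 (by omega))
  have hvk : v' k = v (k - 2 + 1) := by
    rw [q2 k (by omega) le_rfl, show k - 2 + k + 1 - k = k - 2 + 1 by omega]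
  have h := (hS.tight hN hD' hs
    (by rw [hvk]; exact hD.1.right (k - 2) (by omega) (by omega))).2.2.2 j hj hjk
  rw [q1 (k + 1) (by omega), q1 j (by omega), q3 j (by omega)] at h
  exact h.1 hyj hvj

/-- A wide hypergraph has no defect unless it has a hamiltonian Berge path. -/
theorem WideHypergraph.not_defect (hS : WideHypergraph E n r)
    (hbig : 4 ≤ r ∨ ∀ z, r ≤ degree E z) (hN : NoPath E a b n) : ¬ Defect E a b n v e k := by
  intro hD
  obtain ⟨v', e', k', f, hD', hf, h | h⟩ := hS.exists_spare_at_end hD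
  · exact hS.not_spare_left hbig hN hD' hf h
  · have hk' := hD'.2
    refine hS.not_spare_left hbig hN.symm hD'.mirror ((Spare.mirror_iff_single hk').2 hf) ?_
    rwa [show n - 1 - (n - 2 - k') = k' + 1 by omega]

end WideTight

theorem degree_mono {V : Type*} [DecidableEq V] {E E' : Finset (Finset V)} (h : E ⊆ E') (z : V) :
    degree E z ≤ degree E' z :=
  Finset.card_le_card (Finset.filter_subset_filter _ h)

/-- The cyclic interval of length `r` starting at `i` in `{0, …, n - 1}`. -/
theorem exists_cyclic_interval {n r i : ℕ} (hr : r ≤ n) (hi : i < n) :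
    ∃ J : Finset ℕ, J.card = r ∧ ∀ x, x ∈ J ↔ x < n ∧ (i ≤ x ∧ x < i + r ∨ x + n < i + r) := by
  by_cases h : i + r ≤ n
  · refine ⟨Finset.Ico i (i + r), by simp, fun x => ?_⟩
    rw [Finset.mem_Ico]; omega
  · refine ⟨Finset.Ico i n ∪ Finset.range (i + r - n), ?_, fun x => ?_⟩
    · rw [Finset.card_union_of_disjoint, Nat.card_Ico, Finset.card_range]
      · omega
      · rw [Finset.disjoint_left]
        intro x h1 h2
        rw [Finset.mem_Ico] at h1
        rw [Finset.mem_range] at h2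
        omega
    · rw [Finset.mem_union, Finset.mem_Ico, Finset.mem_range]; omega

section Reduction

variable {V : Type*} [Fintype V] [DecidableEq V] {E : Finset (Finset V)} {a b : V} {n r : ℕ}

theorem exists_enumeration (hcard : Fintype.card V = n) (hab : a ≠ b) :
    ∃ v : ℕ → V, v 0 = a ∧ v (n - 1) = b ∧ ∀ i j, i < n → j < n → v i = v j → i = j := by
  have hn : 1 < n := hcard ▸ Fintype.one_lt_card_iff.2 ⟨a, b, hab⟩
  set ε : Fin n ≃ V := (Fintype.equivFinOfCardEq hcard).symm
  set τ : Fin n ≃ V := ε.trans (Equiv.swap (ε ⟨0, by omega⟩) a)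
  set σ : Fin n ≃ V := τ.trans (Equiv.swap (τ ⟨n - 1, by omega⟩) b)
  have hτ : τ ⟨0, by omega⟩ = a := Equiv.swap_apply_left _ _
  have hlast : σ ⟨n - 1, by omega⟩ = b := Equiv.swap_apply_left _ _
  have hfirst : σ ⟨0, by omega⟩ = a := by
    show Equiv.swap (τ ⟨n - 1, by omega⟩) b (τ ⟨0, by omega⟩) = a
    rw [Equiv.swap_apply_of_ne_of_ne _ (hτ ▸ hab), hτ]
    intro h
    have := Fin.mk.inj_iff.1 (τ.injective h)
    omega
  refine ⟨fun t => if h : t < n then σ ⟨t, h⟩ else a, ?_, ?_, fun i j hi hj h => ?_⟩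
  · beta_reduce
    rw [dif_pos (by omega), hfirst]
  · beta_reduce
    rw [dif_pos (by omega), hlast]
  · beta_reduce at h
    rw [dif_pos hi, dif_pos hj] at h
    exact Fin.mk.inj_iff.1 (σ.injective h)

/-- The complete `r`-uniform hypergraph has a hamiltonian Berge path. -/
theorem not_noPath_of_complete (hcard : Fintype.card V = n) (hr : 2 ≤ r) (hrn : r < n)
    (hab : a ≠ b) (hE : ∀ g : Finset V, g.card = r → g ∈ E) : ¬ NoPath E a b n := by
  intro hN
  obtain ⟨v, h0, hlast, hinj⟩ := exists_enumeration hcard hab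
  have hJ : ∀ i, ∃ J : Finset ℕ, i < n → J.card = r ∧
      ∀ x, x ∈ J ↔ x < n ∧ (i ≤ x ∧ x < i + r ∨ x + n < i + r) := fun i => by
    by_cases hi : i < n
    · obtain ⟨J, h⟩ := exists_cyclic_interval hrn.le hi
      exact ⟨J, fun _ => h⟩
    · exact ⟨∅, fun h => absurd h hi⟩
  choose J hJ using hJ
  have hmem : ∀ i t, i < n → t < n → (v t ∈ (J i).image v ↔ t ∈ J i) := by
    intro i t hi ht
    refine ⟨fun h => ?_, fun h => Finset.mem_image_of_mem v h⟩
    obtain ⟨s, hs, hst⟩ := Finset.mem_image.1 h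
    exact hinj s t (((hJ i hi).2 s).1 hs).1 ht hst ▸ hs
  have hne : ∀ i j, i < j → j < n → (J i).image v ≠ (J j).image v := by
    intro i j hij hj h
    have h1 := hmem j j hj hj
    have h2 := hmem j (j - 1) hj (by omega)
    rw [← h, hmem i _ (by omega) (by omega), (hJ i (by omega)).2, (hJ j hj).2] at h1 h2
    omega
  refine hN v (fun i => (J i).image v) ⟨h0, hlast, hinj, fun i hi _ => hE _ ?_,
    fun i hi _ => ?_, fun i hi _ => ?_, fun i j hi hj _ _ h => ?_⟩
  · rw [Finset.card_image_of_injOn, (hJ i (by omega)).1]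
    intro s hs t ht hst
    exact hinj s t (((hJ i (by omega)).2 s).1 hs).1 (((hJ i (by omega)).2 t).1 ht).1 hst
  · rw [hmem i i (by omega) (by omega), (hJ i (by omega)).2]; omega
  · rw [hmem i (i + 1) (by omega) hi, (hJ i (by omega)).2]; omega
  · by_contra hij
    rcases lt_or_gt_of_ne hij with hlt | hlt
    · exact hne i j hlt (by omega) h
    · exact hne j i hlt (by omega) h.symm

/-- An edge-maximal hypergraph without hamiltonian Berge path has a path with one defect. -/
theorem exists_defect (hcard : Fintype.card V = n) (hr : 2 ≤ r) (hrn : r < n) (hab : a ≠ b)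
    (hu : ∀ g ∈ E, g.card = r) (hN : NoPath E a b n) :
    ∃ E', E ⊆ E' ∧ (∀ g ∈ E', g.card = r) ∧ NoPath E' a b n ∧
      ∃ v e k, Defect E' a b n v e k := by
  classical
  obtain ⟨E', hE', hmax⟩ := Finset.exists_max_image
    ((Finset.powersetCard r (Finset.univ : Finset V)).powerset.filter
      (fun F => E ⊆ F ∧ ∀ v e, ¬ PartialPath F a b n v e (fun _ => False))) Finset.card
    ⟨E, by
      rw [Finset.mem_filter, Finset.mem_powerset]
      exact ⟨fun g hg => Finset.mem_powersetCard.2 ⟨Finset.subset_univ g, hu g hg⟩,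
        Finset.Subset.refl E, hN⟩⟩
  rw [Finset.mem_filter, Finset.mem_powerset] at hE'
  obtain ⟨hsub, hEE', hN'⟩ := hE'
  refine ⟨E', hEE', fun g hg => (Finset.mem_powersetCard.1 (hsub hg)).2, hN', ?_⟩
  obtain ⟨f, hf, hfE⟩ : ∃ f : Finset V, f.card = r ∧ f ∉ E' := by
    by_contra! h
    exact not_noPath_of_complete hcard hr hrn hab h hN'
  have hP : ∃ v e, PartialPath (insert f E') a b n v e (fun _ => False) := by
    by_contra! h
    have := hmax (insert f E') (by
      rw [Finset.mem_filter, Finset.mem_powerset]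
      refine ⟨Finset.insert_subset
        (Finset.mem_powersetCard.2 ⟨Finset.subset_univ f, hf⟩) hsub,
        hEE'.trans (Finset.subset_insert f E'), h⟩)
    rw [Finset.card_insert_of_notMem hfE] at this
    omega
  obtain ⟨v, e, hP⟩ := hP
  obtain ⟨k, hk, hkf⟩ : ∃ k, k + 1 < n ∧ e k = f := by
    by_contra! h
    exact hN' v e ⟨hP.first, hP.last, hP.inj,
      fun i hi hU => Finset.mem_of_mem_insert_of_ne (hP.mem i hi hU) (h i hi),
      hP.left, hP.right, hP.einj⟩
  refine ⟨v, e, k, ⟨hP.first, hP.last, hP.inj, fun i hi hik => ?_,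
    fun i hi _ => hP.left i hi id, fun i hi _ => hP.right i hi id,
    fun i j hi hj _ _ => hP.einj i j hi hj id id⟩, hk⟩
  refine Finset.mem_of_mem_insert_of_ne (hP.mem i hi id) fun h => hik ?_
  exact hP.einj i k hi hk id id (h.trans hkf.symm)

end Reduction

theorem PartialPath.exists_isBergePath {n : ℕ} {E : Finset (Finset (Fin n))} {a b : Fin n}
    {v : ℕ → Fin n} {e : ℕ → Finset (Fin n)}
    (hP : PartialPath E a b n v e (fun _ => False)) :
    ∃ (vs : Fin (n - 1 + 1) → Fin n) (hs : Fin (n - 1) → Finset (Fin n)),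
      IsBergePath E (n - 1) vs hs ∧ vs 0 = a ∧ vs (Fin.last (n - 1)) = b ∧
      Function.Surjective vs := by
  have hn : 0 < n := a.pos
  refine ⟨fun i => v i, fun i => e i, ⟨fun i j h => ?_, fun i j h => ?_, fun i => ?_, fun i => ?_⟩,
    hP.first, hP.last, fun z => ?_⟩
  · exact Fin.ext (hP.inj i j (by omega) (by omega) h)
  · exact Fin.ext (hP.einj i j (by omega) (by omega) id id h)
  · exact hP.mem i (by omega) id
  · exact ⟨hP.left i (by omega) id, hP.right i (by omega) id⟩
  · obtain ⟨t, ht, h⟩ := hP.exists_eq (Fintype.card_fin n) z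
    exact ⟨⟨t, by omega⟩, h⟩

/-- Kostochka–Luo–McCourt: under either of the minimum degree conditions
(i) `r ≤ n/2` and `δ(H) ≥ C(⌊n/2⌋, r−1) + 1`,
(ii) `n−1 ≥ r > n/2 ≥ 3` and `δ(H) ≥ r−1`, or
(iii) `r = 3`, `n = 5`, `δ(H) ≥ 3`,
an `n`-vertex `r`-uniform hypergraph is hamiltonian-connected: any two distinct
vertices are joined by a Berge path whose defining vertices are all `n` vertices. -/
theorem hamiltonian_connected_min_degree (n r : ℕ) (hrn : r ≤ n) (hr : 3 ≤ r)
    (E : Finset (Finset (Fin n))) (hunif : ∀ e ∈ E, e.card = r)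
    (hcond :
      (2 * r ≤ n ∧ ∀ x : Fin n, Nat.choose (n / 2) (r - 1) + 1 ≤ degree E x) ∨
      (r + 1 ≤ n ∧ n < 2 * r ∧ 6 ≤ n ∧ ∀ x : Fin n, r - 1 ≤ degree E x) ∨
      (r = 3 ∧ n = 5 ∧ ∀ x : Fin n, 3 ≤ degree E x)) :
    ∀ u v : Fin n, u ≠ v →
      ∃ (vs : Fin (n - 1 + 1) → Fin n) (hs : Fin (n - 1) → Finset (Fin n)),
        IsBergePath E (n - 1) vs hs ∧ vs 0 = u ∧ vs (Fin.last (n - 1)) = v ∧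
        Function.Surjective vs := by
  intro a b hab
  by_contra hno
  have hN : NoPath E a b n := fun v e hP => hno hP.exists_isBergePath
  have hlt : r < n := by omega
  obtain ⟨E', hEE', hu, hN', v, e, k, hD⟩ :=
    exists_defect (Fintype.card_fin n) (by omega) hlt hab hunif hN
  rcases hcond with ⟨h2r, hdeg⟩ | ⟨-, h2r, h6, hdeg⟩ | ⟨rfl, rfl, hdeg⟩
  · have hS : DenseHypergraph E' n (n / 2) r :=
      ⟨Fintype.card_fin n, rfl, hr, by omega, hu, fun z => (hdeg z).trans (degree_mono hEE' z)⟩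
    exact hS.not_defect hN' hD
  · have hS : WideHypergraph E' n r :=
      ⟨Fintype.card_fin n, hr, h2r, hu, fun z => (hdeg z).trans (degree_mono hEE' z)⟩
    exact hS.not_defect (Or.inl (by omega)) hN' hD
  · have hd : ∀ z, 3 ≤ degree E' z := fun z => (hdeg z).trans (degree_mono hEE' z)
    have hS : WideHypergraph E' 5 3 :=
      ⟨Fintype.card_fin 5, hr, by omega, hu, fun z => le_trans (by omega) (hd z)⟩
    exact hS.not_defect (Or.inr hd) hN' hD
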